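/- (Theorem 1.1(i), upper bound, n = 2.) Let n = 2, assume λ ≤ det D²u ≤ Λ in Ω, and let V ⊂⊂ Ω be open. Then there is a constant C > 0 depending only on V, Ω, λ, Λ such that: for every x₀ ∈ V, every 0 < t < 1/4 with S_u(x₀, t^{1/2}) ⊂⊂ V, and every Green's function g_V(·, x₀) of L_u in V with pole x₀, one has g_V(x, x₀) ≤ C · |log t| for all x ∈ ∂S_u(x₀, t). -/

import Mathlib

open MeasureTheory

noncomputable section

/-- Euclidean space `ℝⁿ`. -/
abbrev E (n : ℕ) := EuclideanSpace ℝ (Fin n)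

/-- First partial derivative `∂_i f (x)`. -/
noncomputable def pd {n : ℕ} (f : E n → ℝ) (x : E n) (i : Fin n) : ℝ :=
  fderiv ℝ f x (EuclideanSpace.single i 1)

/-- Second partial derivative `∂_{ij} f (x)`. -/
noncomputable def pd2 {n : ℕ} (f : E n → ℝ) (x : E n) (i j : Fin n) : ℝ :=
  fderiv ℝ (fun y => fderiv ℝ f y (EuclideanSpace.single j 1)) x (EuclideanSpace.single i 1)

/-- Hessian matrix `D²f(x)`. -/
noncomputable def Hess {n : ℕ} (f : E n → ℝ) (x : E n) : Matrix (Fin n) (Fin n) ℝ :=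
  Matrix.of fun i j => pd2 f x i j

/-- The cofactor matrix `U = (det D²u)(D²u)⁻¹` of the Hessian of `u`,
realized as the adjugate. -/
noncomputable def cofU {n : ℕ} (u : E n → ℝ) (x : E n) : Matrix (Fin n) (Fin n) ℝ :=
  (Hess u x).adjugate

/-- Section of the convex function `u`:
`S_u(x₀,t) = {x ∈ cl Ω : u x < u x₀ + ∇u(x₀)·(x - x₀) + t}`. -/
def MASection {n : ℕ} (Ω : Set (E n)) (u : E n → ℝ) (x₀ : E n) (t : ℝ) : Set (E n) :=
  {x ∈ closure Ω | u x < u x₀ + fderiv ℝ u x₀ (x - x₀) + t}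

/-- `A ⊂⊂ B`: the closure of `A` is a compact subset of `B`. -/
def CptIn {n : ℕ} (A B : Set (E n)) : Prop :=
  IsCompact (closure A) ∧ closure A ⊆ B

/-- Uniform convexity of a domain: balls of radius proportional to `‖x - y‖²`
centered at midpoints of points of the closure stay in the closure. -/
def UnifConvex {n : ℕ} (Ω : Set (E n)) : Prop :=
  ∃ δ > 0, ∀ x ∈ closure Ω, ∀ y ∈ closure Ω,
    Metric.closedBall (midpoint ℝ x y) (δ * ‖x - y‖ ^ 2) ⊆ closure Ω

/-- Standing assumptions: `Ω` is a bounded, open, nonempty, uniformly convex domain and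
`u` is a smooth convex function on `cl Ω` vanishing on `∂Ω`. -/
def MASetup {n : ℕ} (Ω : Set (E n)) (u : E n → ℝ) : Prop :=
  IsOpen Ω ∧ Bornology.IsBounded Ω ∧ Ω.Nonempty ∧ UnifConvex Ω ∧
  ContDiffOn ℝ (⊤ : ℕ∞) u (closure Ω) ∧ ConvexOn ℝ (closure Ω) u ∧
  ∀ x ∈ frontier Ω, u x = 0

/-- `λ ≤ det D²u ≤ Λ` in `Ω`. -/
def DetBounds {n : ℕ} (Ω : Set (E n)) (u : E n → ℝ) (lam Lam : ℝ) : Prop :=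
  ∀ x ∈ Ω, lam ≤ (Hess u x).det ∧ (Hess u x).det ≤ Lam

/-- The Monge-Ampère measure of `u`: `μ(A) = ∫_A det D²u`. -/
noncomputable def maMeasure {n : ℕ} (u : E n → ℝ) (A : Set (E n)) : ℝ :=
  ∫ x in A, (Hess u x).det

/-- Center of mass of a set. -/
noncomputable def centerOfMass {n : ℕ} (S : Set (E n)) : E n :=
  (volume S).toReal⁻¹ • ∫ x in S, x

/-- The `α`-dilation of `S` with respect to its center of mass. -/
def dilateCM {n : ℕ} (α : ℝ) (S : Set (E n)) : Set (E n) :=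
  (fun x => centerOfMass S + α • (x - centerOfMass S)) '' S

/-- The Monge-Ampère measure of `u` is doubling with respect to the center of mass
on the sections of `u`, with constants `0 < α < 1 < β`. -/
def DoublingCM {n : ℕ} (Ω : Set (E n)) (u : E n → ℝ) (α β : ℝ) : Prop :=
  0 < α ∧ α < 1 ∧ 1 < β ∧
  ∀ x₀ ∈ Ω, ∀ t : ℝ, 0 < t → CptIn (MASection Ω u x₀ t) Ω →
    maMeasure u (MASection Ω u x₀ t) ≤ β * maMeasure u (dilateCM α (MASection Ω u x₀ (t / 2)))

/-- `g` is a Green's function of the linearized Monge-Ampère operator `L_u` in `V`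
with pole `y`: positive and smooth on `V \ {y}`, `L_u`-harmonic there, vanishing
continuously on `∂V`, and `∫_V g · (L_u φ) = φ(y)` (i.e. `∫_V g · U^{ij}∂_{ij}φ = -φ(y)`)
for all test functions `φ`. -/
def IsGreen {n : ℕ} (u : E n → ℝ) (V : Set (E n)) (y : E n) (g : E n → ℝ) : Prop :=
  (∀ x ∈ V \ {y}, 0 < g x) ∧
  ContDiffOn ℝ (⊤ : ℕ∞) g (V \ {y}) ∧
  (∀ x ∈ V \ {y}, ∑ i, ∑ j, cofU u x i j * pd2 g x i j = 0) ∧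
  ContinuousOn g (closure V \ {y}) ∧
  (∀ x ∈ frontier V, g x = 0) ∧
  ∀ φ : E n → ℝ, ContDiff ℝ (⊤ : ℕ∞) φ → HasCompactSupport φ → tsupport φ ⊆ V →
    (∫ x in V, g x * ∑ i, ∑ j, cofU u x i j * pd2 φ x i j) = -φ y

/-- Capacity of a compact set `K` relative to `V` for the operator `L_u`:
the infimum of `∫_V U^{ij} ∂_iΦ ∂_jΦ` over Lipschitz `Φ` compactly supported in `V`
with `Φ ≥ 1` on `K`. -/
noncomputable def capacity {n : ℕ} (u : E n → ℝ) (K V : Set (E n)) : ℝ :=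
  sInf { e : ℝ | ∃ Φ : E n → ℝ, (∃ L : NNReal, LipschitzWith L Φ) ∧
    HasCompactSupport Φ ∧ tsupport Φ ⊆ V ∧ (∀ x ∈ K, 1 ≤ Φ x) ∧
    e = ∫ x in V, ∑ i, ∑ j, cofU u x i j * pd Φ x i * pd Φ x j }

section Calculus

variable {F : Type*} [NormedAddCommGroup F] [NormedSpace ℝ F]

/-- Second derivative of `f` at `x` in the directions `v`, `w`. -/
def D2 (f : F → ℝ) (x v w : F) : ℝ :=
  fderiv ℝ (fun y => fderiv ℝ f y w) x v

lemma differentiableAt_fderiv {f : F → ℝ} {x : F} (h : ContDiffAt ℝ 2 f x) :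
    DifferentiableAt ℝ (fderiv ℝ f) x :=
  (h.fderiv_right (m := 1) (by norm_num)).differentiableAt (by norm_num)

lemma differentiableAt_fderiv_apply {f : F → ℝ} {x : F} (h : ContDiffAt ℝ 2 f x) (w : F) :
    DifferentiableAt ℝ (fun y => fderiv ℝ f y w) x :=
  (differentiableAt_fderiv h).clm_apply (differentiableAt_const w)

lemma D2_eq {f : F → ℝ} {x : F} (h : ContDiffAt ℝ 2 f x) (v w : F) :
    D2 f x v w = fderiv ℝ (fderiv ℝ f) x v w := by
  unfold D2
  rw [((differentiableAt_fderiv h).hasFDerivAt.clm_apply (hasFDerivAt_const w x)).fderiv]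
  simp

lemma D2_comm {f : F → ℝ} {x : F} (h : ContDiffAt ℝ 2 f x) (v w : F) :
    D2 f x v w = D2 f x w v := by
  rw [D2_eq h, D2_eq h]
  exact (h.isSymmSndFDerivAt (by simp)).eq v w

lemma D2_add_left {f : F → ℝ} {x : F} (h : ContDiffAt ℝ 2 f x) (v v' w : F) :
    D2 f x (v + v') w = D2 f x v w + D2 f x v' w := by
  simp [D2_eq h]

lemma D2_smul_left {f : F → ℝ} {x : F} (h : ContDiffAt ℝ 2 f x) (c : ℝ) (v w : F) :
    D2 f x (c • v) w = c * D2 f x v w := by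
  simp [D2_eq h]

lemma D2_add_right {f : F → ℝ} {x : F} (h : ContDiffAt ℝ 2 f x) (v w w' : F) :
    D2 f x v (w + w') = D2 f x v w + D2 f x v w' := by
  simp [D2_eq h]

lemma D2_smul_right {f : F → ℝ} {x : F} (h : ContDiffAt ℝ 2 f x) (c : ℝ) (v w : F) :
    D2 f x v (c • w) = c * D2 f x v w := by
  simp [D2_eq h]

lemma hasDerivAt_line (p v : F) (t : ℝ) : HasDerivAt (fun s : ℝ => p + s • v) v t := by
  simpa using ((hasDerivAt_id t).smul_const v).const_add p

lemma hasDerivAt_comp_line {f : F → ℝ} {p v : F} {t : ℝ}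
    (h : DifferentiableAt ℝ f (p + t • v)) :
    HasDerivAt (fun s : ℝ => f (p + s • v)) (fderiv ℝ f (p + t • v) v) t :=
  h.hasFDerivAt.comp_hasDerivAt t (hasDerivAt_line p v t)

lemma hasDerivAt_fderiv_comp_line {f : F → ℝ} {p v w : F} {t : ℝ}
    (h : ContDiffAt ℝ 2 f (p + t • v)) :
    HasDerivAt (fun s : ℝ => fderiv ℝ f (p + s • v) w) (D2 f (p + t • v) v w) t :=
  hasDerivAt_comp_line (f := fun y => fderiv ℝ f y w) (differentiableAt_fderiv_apply h w)

lemma eventually_contDiffAt {f : F → ℝ} {x : F} (h : ContDiffAt ℝ 2 f x) :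
    ∀ᶠ y in nhds x, ContDiffAt ℝ 2 f y :=
  h.eventually (by simp)

/-- Second derivative test at a local minimum. -/
lemma D2_nonneg_of_isLocalMin {f : F → ℝ} {x : F} (h : ContDiffAt ℝ 2 f x)
    (hm : IsLocalMin f x) (v : F) : 0 ≤ D2 f x v v := by
  by_contra hneg
  push Not at hneg
  set φ : ℝ → ℝ := fun s => -f (x + s • v) with hφ
  have hcont : Filter.Tendsto (fun s : ℝ => x + s • v) (nhds 0) (nhds x) := by
    have := (hasDerivAt_line x v 0).continuousAt.tendsto
    simpa using this
  have hev : ∀ᶠ s in nhds (0 : ℝ), ContDiffAt ℝ 2 f (x + s • v) :=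
    hcont.eventually (eventually_contDiffAt h)
  have hd : ∀ᶠ s in nhds (0 : ℝ), deriv φ s = -fderiv ℝ f (x + s • v) v := by
    filter_upwards [hev] with s hs
    exact ((hasDerivAt_comp_line (hs.differentiableAt (by norm_num))).neg).deriv
  have hdd : deriv (deriv φ) 0 = -D2 f x v v := by
    have h1 : HasDerivAt (fun s : ℝ => -fderiv ℝ f (x + s • v) v) (-D2 f x v v) 0 := by
      have := (hasDerivAt_fderiv_comp_line (f := f) (p := x) (v := v) (w := v) (t := 0)
        (by simpa using h)).fun_neg
      simpa using this
    rw [Filter.EventuallyEq.deriv_eq hd]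
    exact h1.deriv
  have hgrad : fderiv ℝ f x = 0 := hm.fderiv_eq_zero
  have hd0 : deriv φ 0 = 0 := by
    rw [hd.self_of_nhds]; simp [hgrad]
  have hφc : ContinuousAt φ 0 := by
    have : DifferentiableAt ℝ φ 0 :=
      ((hasDerivAt_comp_line (f := f) (p := x) (v := v) (t := 0)
        (by simpa using h.differentiableAt (by norm_num))).neg).differentiableAt
    exact this.continuousAt
  have hpos : 0 < deriv (deriv φ) 0 := by rw [hdd]; linarith
  have hmin : IsLocalMin φ 0 := isLocalMin_of_deriv_deriv_pos hpos hd0 hφc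
  have hmax : ∀ᶠ s in nhds (0 : ℝ), φ s ≤ φ 0 := by
    have := hcont.eventually hm
    filter_upwards [this] with s hs
    simpa [hφ] using hs
  have hconst : φ =ᶠ[nhds 0] fun _ => φ 0 := by
    filter_upwards [hmin, hmax] with s h1 h2 using le_antisymm h2 h1
  have : deriv (deriv φ) 0 = 0 := by
    rw [Filter.EventuallyEq.deriv_eq hconst.deriv]
    simp
  linarith

lemma D2_neg {f : F → ℝ} (x v w : F) : D2 (fun y => -f y) x v w = -D2 f x v w := by
  unfold D2
  have : (fun y => fderiv ℝ (fun y => -f y) y w) = fun y => -fderiv ℝ f y w := by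
    ext y; rw [fderiv_fun_neg]; simp
  rw [this, fderiv_fun_neg]; simp

lemma D2_nonpos_of_isLocalMax {f : F → ℝ} {x : F} (h : ContDiffAt ℝ 2 f x)
    (hm : IsLocalMax f x) (v : F) : D2 f x v v ≤ 0 := by
  have := D2_nonneg_of_isLocalMin (f := fun y => -f y) h.neg hm.neg v
  rw [D2_neg] at this
  linarith

lemma D2_congr {f g : F → ℝ} {x : F} (h : f =ᶠ[nhds x] g) (v w : F) :
    D2 f x v w = D2 g x v w := by
  unfold D2
  refine congrArg (fun L : F →L[ℝ] ℝ => L v) (Filter.EventuallyEq.fderiv_eq ?_)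
  filter_upwards [h.fderiv (𝕜 := ℝ)] with y hy
  rw [hy]

lemma D2_add {f g : F → ℝ} {x : F} (hf : ContDiffAt ℝ 2 f x) (hg : ContDiffAt ℝ 2 g x)
    (v w : F) : D2 (fun y => f y + g y) x v w = D2 f x v w + D2 g x v w := by
  unfold D2
  rw [← add_apply, ← fderiv_fun_add (differentiableAt_fderiv_apply hf w)
    (differentiableAt_fderiv_apply hg w)]
  refine congrArg (fun L : F →L[ℝ] ℝ => L v) (Filter.EventuallyEq.fderiv_eq ?_)
  filter_upwards [eventually_contDiffAt hf, eventually_contDiffAt hg] with y h1 h2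
  rw [fderiv_fun_add (h1.differentiableAt (by norm_num)) (h2.differentiableAt (by norm_num))]
  simp

lemma D2_sub {f g : F → ℝ} {x : F} (hf : ContDiffAt ℝ 2 f x) (hg : ContDiffAt ℝ 2 g x)
    (v w : F) : D2 (fun y => f y - g y) x v w = D2 f x v w - D2 g x v w := by
  have := D2_add hf hg.neg v w
  rw [D2_neg] at this
  simpa [sub_eq_add_neg] using this

lemma D2_mul {f g : F → ℝ} {x : F} (hf : ContDiffAt ℝ 2 f x) (hg : ContDiffAt ℝ 2 g x)
    (v w : F) : D2 (fun y => f y * g y) x v w = D2 f x v w * g x + f x * D2 g x v w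
      + fderiv ℝ f x v * fderiv ℝ g x w + fderiv ℝ f x w * fderiv ℝ g x v := by
  have h1 : (fun y => fderiv ℝ (fun y => f y * g y) y w) =ᶠ[nhds x]
      fun y => f y * fderiv ℝ g y w + g y * fderiv ℝ f y w := by
    filter_upwards [eventually_contDiffAt hf, eventually_contDiffAt hg] with y h1 h2
    rw [fderiv_fun_mul (h1.differentiableAt (by norm_num)) (h2.differentiableAt (by norm_num))]
    simp
  have hf1 := (hf.differentiableAt (by norm_num)).hasFDerivAt
  have hg1 := (hg.differentiableAt (by norm_num)).hasFDerivAt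
  have h2 := ((hf1.mul (differentiableAt_fderiv_apply hg w).hasFDerivAt).add
    (hg1.mul (differentiableAt_fderiv_apply hf w).hasFDerivAt))
  unfold D2
  rw [h1.fderiv_eq]
  erw [h2.fderiv]
  simp
  ring

lemma D2_comp {f : F → ℝ} {R R' : ℝ → ℝ} {x : F} {r'' : ℝ} (hf : ContDiffAt ℝ 2 f x)
    (hR : ∀ᶠ r in nhds (f x), HasDerivAt R (R' r) r) (hR' : HasDerivAt R' r'' (f x))
    (v w : F) : D2 (fun y => R (f y)) x v w =
      R' (f x) * D2 f x v w + r'' * (fderiv ℝ f x v * fderiv ℝ f x w) := by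
  have hc : ContinuousAt f x := hf.continuousAt
  have h1 : (fun y => fderiv ℝ (fun y => R (f y)) y w) =ᶠ[nhds x]
      fun y => R' (f y) * fderiv ℝ f y w := by
    filter_upwards [eventually_contDiffAt hf, hc.eventually hR] with y h1 h2
    have := h2.comp_hasFDerivAt y (h1.differentiableAt (by norm_num)).hasFDerivAt
    erw [this.fderiv]
    simp
  have hf1 := (hf.differentiableAt (by norm_num)).hasFDerivAt
  have h2 := (hR'.comp_hasFDerivAt x hf1).mul (differentiableAt_fderiv_apply hf w).hasFDerivAt
  unfold D2
  rw [h1.fderiv_eq]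
  erw [h2.fderiv]
  simp
  ring

end Calculus

section Algebra

/-- The operator `∑ U^{ij} ∂_{ij} ψ`. -/
def LU (u ψ : E 2 → ℝ) (x : E 2) : ℝ := ∑ i, ∑ j, cofU u x i j * pd2 ψ x i j

/-- The quadratic form `∑ U^{ij} ∂_i w ∂_j w`. -/
def QU (u w : E 2 → ℝ) (x : E 2) : ℝ :=
  pd2 u x 1 1 * pd w x 0 ^ 2 - 2 * pd2 u x 0 1 * (pd w x 0 * pd w x 1)
    + pd2 u x 0 0 * pd w x 1 ^ 2

/-- The area form of the plane. -/
def om (v w : E 2) : ℝ := v 0 * w 1 - v 1 * w 0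

lemma LU_eq (u ψ : E 2 → ℝ) (x : E 2) :
    LU u ψ x = pd2 u x 1 1 * pd2 ψ x 0 0 - pd2 u x 0 1 * pd2 ψ x 0 1
      - pd2 u x 1 0 * pd2 ψ x 1 0 + pd2 u x 0 0 * pd2 ψ x 1 1 := by
  simp only [LU, cofU, Hess, Fin.sum_univ_two, Matrix.adjugate_fin_two, Matrix.of_apply,
    Matrix.cons_val_zero, Matrix.cons_val_one]
  simp
  ring

lemma pd2_eq (f : E 2 → ℝ) (x : E 2) (i j : Fin 2) :
    pd2 f x i j = D2 f x (EuclideanSpace.single i 1) (EuclideanSpace.single j 1) := rfl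

lemma pd2_symm {f : E 2 → ℝ} {x : E 2} (h : ContDiffAt ℝ 2 f x) (i j : Fin 2) :
    pd2 f x i j = pd2 f x j i := D2_comm h _ _

lemma eq_coord (v : E 2) :
    v = v 0 • EuclideanSpace.single 0 (1 : ℝ) + v 1 • EuclideanSpace.single 1 (1 : ℝ) := by
  ext i
  fin_cases i <;> simp

lemma fderiv_coord (f : E 2 → ℝ) (x v : E 2) :
    fderiv ℝ f x v = v 0 * pd f x 0 + v 1 * pd f x 1 := by
  conv_lhs => rw [eq_coord v]
  simp [pd]

lemma D2_coord {f : E 2 → ℝ} {x : E 2} (h : ContDiffAt ℝ 2 f x) (v w : E 2) :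
    D2 f x v w = v 0 * w 0 * pd2 f x 0 0 + (v 0 * w 1 + v 1 * w 0) * pd2 f x 0 1
      + v 1 * w 1 * pd2 f x 1 1 := by
  conv_lhs => rw [eq_coord v, eq_coord w]
  rw [D2_add_left h, D2_add_right h, D2_add_right h]
  simp only [D2_smul_left h, D2_smul_right h, ← pd2_eq]
  rw [pd2_symm h 1 0]
  ring

lemma det_Hess (f : E 2 → ℝ) (x : E 2) :
    (Hess f x).det = pd2 f x 0 0 * pd2 f x 1 1 - pd2 f x 0 1 * pd2 f x 1 0 := by
  simp [Hess, Matrix.det_fin_two]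

lemma D2_det {f : E 2 → ℝ} {x : E 2} (h : ContDiffAt ℝ 2 f x) (v w : E 2) :
    D2 f x v v * D2 f x w w - D2 f x v w ^ 2 = om v w ^ 2 * (Hess f x).det := by
  rw [D2_coord h, D2_coord h, D2_coord h, det_Hess, pd2_symm h 1 0, om]
  ring

lemma det_mul_sq_le {u g : E 2 → ℝ} {x : E 2} (h : ContDiffAt ℝ 2 u x) (v : E 2) :
    (Hess u x).det * fderiv ℝ g x v ^ 2 ≤ D2 u x v v * QU u g x := by
  rw [D2_coord h, det_Hess, pd2_symm h 1 0, fderiv_coord, QU]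
  nlinarith [sq_nonneg ((pd2 u x 0 0 * v 0 + pd2 u x 0 1 * v 1) * pd g x 1
    - (pd2 u x 0 1 * v 0 + pd2 u x 1 1 * v 1) * pd g x 0)]

lemma QU_nonneg {u : E 2 → ℝ} (g : E 2 → ℝ) {x : E 2} (h : ContDiffAt ℝ 2 u x)
    (hp : ∀ v, 0 ≤ D2 u x v v) : 0 ≤ QU u g x := by
  have := hp (!₂[-pd g x 1, pd g x 0])
  rw [D2_coord h] at this
  simp at this
  rw [QU]
  linarith

lemma LU_nonpos {u ψ : E 2 → ℝ} {x : E 2} (h : ContDiffAt ℝ 2 u x) (hψ : ContDiffAt ℝ 2 ψ x)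
    (hp : ∀ v, 0 ≤ D2 u x v v) (hdet : 0 < (Hess u x).det) (hn : ∀ v, D2 ψ x v v ≤ 0) :
    LU u ψ x ≤ 0 := by
  have h1 := hn (!₂[-pd2 u x 0 1, pd2 u x 0 0])
  have h2 := hn (!₂[1, 0])
  have h3 := hp (!₂[1, 0])
  rw [det_Hess, pd2_symm h 1 0] at hdet
  rw [D2_coord hψ] at h1 h2
  rw [D2_coord h] at h3
  simp at h1 h2 h3
  have h4 : 0 < pd2 u x 0 0 := by
    rcases h3.lt_or_eq with h | h
    · exact h
    · rw [← h] at hdet; nlinarith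
  rw [LU_eq, pd2_symm h 1 0, pd2_symm hψ 1 0]
  by_contra hc
  push Not at hc
  nlinarith [mul_pos h4 hc]

lemma LU_self {u : E 2 → ℝ} {x : E 2} (h : ContDiffAt ℝ 2 u x) :
    LU u u x = 2 * (Hess u x).det := by
  rw [LU_eq, det_Hess, pd2_symm h 1 0]; ring

lemma LU_comp {u w : E 2 → ℝ} {R R' : ℝ → ℝ} {x : E 2} {r'' : ℝ} (hu : ContDiffAt ℝ 2 u x)
    (hw : ContDiffAt ℝ 2 w x)
    (hR : ∀ᶠ r in nhds (w x), HasDerivAt R (R' r) r) (hR' : HasDerivAt R' r'' (w x)) :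
    LU u (fun y => R (w y)) x = R' (w x) * LU u w x + r'' * QU u w x := by
  simp only [LU_eq, QU, pd2_eq (fun y => R (w y)), D2_comp hw hR hR']
  rw [← pd2_eq, ← pd2_eq, ← pd2_eq, ← pd2_eq, pd2_symm hu 1 0]
  simp only [pd]
  ring

lemma LU_mul {u f g : E 2 → ℝ} {x : E 2} (hu : ContDiffAt ℝ 2 u x)
    (hf : ContDiffAt ℝ 2 f x) (hg : ContDiffAt ℝ 2 g x) :
    LU u (fun y => f y * g y) x = LU u f x * g x + f x * LU u g x
      + 2 * (pd2 u x 1 1 * (pd f x 0 * pd g x 0) - pd2 u x 0 1 * (pd f x 0 * pd g x 1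
        + pd f x 1 * pd g x 0) + pd2 u x 0 0 * (pd f x 1 * pd g x 1)) := by
  simp only [LU_eq, pd2_eq (fun y => f y * g y), D2_mul hf hg]
  rw [← pd2_eq, ← pd2_eq, ← pd2_eq, ← pd2_eq, ← pd2_eq, ← pd2_eq, ← pd2_eq, ← pd2_eq,
    pd2_symm hu 1 0]
  simp only [pd]
  ring

lemma LU_sub {u f g : E 2 → ℝ} {x : E 2}
    (hf : ContDiffAt ℝ 2 f x) (hg : ContDiffAt ℝ 2 g x) :
    LU u (fun y => f y - g y) x = LU u f x - LU u g x := by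
  simp only [LU_eq, pd2_eq (fun y => f y - g y), D2_sub hf hg]
  simp only [← pd2_eq]
  ring

lemma LU_congr {u f g : E 2 → ℝ} {x : E 2} (h : f =ᶠ[nhds x] g) : LU u f x = LU u g x := by
  simp only [LU_eq, pd2_eq f, D2_congr h]
  rfl

lemma LU_of_notMem_tsupport {u f : E 2 → ℝ} {x : E 2} (h : x ∉ tsupport f) : LU u f x = 0 := by
  have h0 : f =ᶠ[nhds x] fun _ => 0 := notMem_tsupport_iff_eventuallyEq.mp h
  rw [LU_congr h0, LU_eq]
  simp [pd2]

lemma D2_quadratic {F : Type*} [NormedAddCommGroup F] [NormedSpace ℝ F] (X Y Z : F →L[ℝ] ℝ)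
    (a b c : ℝ) (x v w : F) :
    D2 (fun y => a * X y ^ 2 + b * Y y ^ 2 + Z y + c) x v w
      = 2 * a * (X v * X w) + 2 * b * (Y v * Y w) := by
  have h1 : ∀ y, HasFDerivAt (fun y => a * X y ^ 2 + b * Y y ^ 2 + Z y + c)
      ((2 * a * X y) • X + (2 * b * Y y) • Y + Z) y := by
    intro y
    have hX := ((X.hasFDerivAt (x := y)).pow 2).const_mul a
    have hY := ((Y.hasFDerivAt (x := y)).pow 2).const_mul b
    refine (((hX.add hY).add Z.hasFDerivAt).add_const c).congr_fderiv ?_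
    ext z
    simp
    ring
  have h2 : (fun y => fderiv ℝ (fun y => a * X y ^ 2 + b * Y y ^ 2 + Z y + c) y w)
      = fun y => 2 * a * X w * X y + 2 * b * Y w * Y y + Z w := by
    ext y
    rw [(h1 y).fderiv]
    simp
    ring
  unfold D2
  rw [h2]
  have h3 : HasFDerivAt (fun y => 2 * a * X w * X y + 2 * b * Y w * Y y + Z w)
      ((2 * a * X w) • X + (2 * b * Y w) • Y) x :=
    (((X.hasFDerivAt (x := x)).const_mul _).add ((Y.hasFDerivAt (x := x)).const_mul _)).add_const _
  rw [h3.fderiv]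
  simp
  ring

lemma contDiff_quadratic {F : Type*} [NormedAddCommGroup F] [NormedSpace ℝ F] (X Y Z : F →L[ℝ] ℝ)
    (a b c : ℝ) {n : WithTop ℕ∞} :
    ContDiff ℝ n (fun y => a * X y ^ 2 + b * Y y ^ 2 + Z y + c) := by
  have := X.contDiff (n := n)
  have := Y.contDiff (n := n)
  have := Z.contDiff (n := n)
  fun_prop

lemma exists_isLocalMin_of_lt {f : E 2 → ℝ} {K : Set (E 2)} (hK : IsCompact K)
    (hf : ContinuousOn f K) {z₀ : E 2} (hz₀ : z₀ ∈ K) (hb : ∀ y ∈ frontier K, f z₀ < f y) :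
    ∃ z ∈ interior K, IsLocalMin f z ∧ f z ≤ f z₀ := by
  obtain ⟨z, hzK, hz⟩ := hK.exists_isMinOn ⟨z₀, hz₀⟩ hf
  have hzi : z ∈ interior K := by
    by_contra h
    have := hb z ⟨subset_closure hzK, h⟩
    exact absurd (hz hz₀) (not_le.mpr this)
  exact ⟨z, hzi, hz.isLocalMin (mem_interior_iff_mem_nhds.mp hzi), hz hz₀⟩

/-- If `D²u` dominates a quadratic form that is diagonal in the frame `e, f`. -/
lemma four_mul_le_det {u : E 2 → ℝ} {z e f : E 2} (hu : ContDiffAt ℝ 2 u z) {a b : ℝ}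
    (ha : 0 ≤ a) (hb : 0 ≤ b) (h : ∀ s t : ℝ, 2 * a * s ^ 2 + 2 * b * t ^ 2 ≤
      D2 u z (s • e + t • f) (s • e + t • f)) :
    4 * a * b ≤ om e f ^ 2 * (Hess u z).det := by
  rw [← D2_det hu]
  have key : ∀ s t : ℝ, 2 * a * s ^ 2 + 2 * b * t ^ 2 ≤ s ^ 2 * D2 u z e e
      + 2 * s * t * D2 u z e f + t ^ 2 * D2 u z f f := by
    intro s t
    have := h s t
    rw [D2_add_left hu, D2_add_right hu, D2_add_right hu] at this
    simp only [D2_smul_left hu, D2_smul_right hu, D2_comm hu f e] at this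
    linarith
  have h1 := key 1 0
  have h2 := key 0 1
  simp at h1 h2
  have h3 : D2 u z e f ^ 2 ≤ (D2 u z e e - 2 * a) * (D2 u z f f - 2 * b) := by
    have h3 := key (-D2 u z e f) (D2 u z e e - 2 * a)
    rcases (sub_nonneg.mpr h1).lt_or_eq with h | h
    · by_contra hc
      push Not at hc
      nlinarith [mul_pos h (sub_pos.mpr hc)]
    · have h4 : D2 u z e f = 0 := by
        by_contra hne
        have h5 := key (-(D2 u z f f - 2 * b + 1) / (2 * D2 u z e f)) 1
        have h6 : D2 u z e e = 2 * a := by linarith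
        rw [h6] at h5
        have h7 : 2 * (-(D2 u z f f - 2 * b + 1) / (2 * D2 u z e f)) * 1 * D2 u z e f
          = -(D2 u z f f - 2 * b + 1) := by field_simp
        rw [h7] at h5
        linarith
      rw [h4, ← h]; simp
  nlinarith [mul_nonneg ha (sub_nonneg.mpr h2), mul_nonneg hb (sub_nonneg.mpr h1)]

/-- Symmetric upper comparison. -/
lemma mul_det_le {u : E 2 → ℝ} {z e f : E 2} (hu : ContDiffAt ℝ 2 u z) {a b : ℝ}
    (hee : D2 u z e e ≤ a) (hff : D2 u z f f ≤ b) (he : 0 ≤ D2 u z e e) (hf : 0 ≤ D2 u z f f) :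
    om e f ^ 2 * (Hess u z).det ≤ a * b := by
  rw [← D2_det hu]
  nlinarith [mul_le_mul hee hff hf (he.trans hee), sq_nonneg (D2 u z e f)]

end Algebra

section Green

lemma integral_pd_eq_zero {X : E 2 → ℝ} (hX : ContDiff ℝ 1 X) (hc : HasCompactSupport X)
    (i : Fin 2) : Integrable (fun x => pd X x i) ∧ ∫ x, pd X x i = 0 := by
  have hd : Continuous (fun x => pd X x i) :=
    (hX.continuous_fderiv (by norm_num)).clm_apply continuous_const
  have hcd : HasCompactSupport (fun x => pd X x i) := hc.fderiv_apply ℝ _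
  have hi : Integrable (fun x => pd X x i) := hd.integrable_of_hasCompactSupport hcd
  refine ⟨hi, ?_⟩
  have hXi : Integrable X := hX.continuous.integrable_of_hasCompactSupport hc
  have := integral_mul_fderiv_eq_neg_fderiv_mul_of_integrable (𝕜 := ℝ) (μ := (volume : Measure (E 2)))
    (f := fun _ => (1 : ℝ)) (g := X) (v := EuclideanSpace.single i 1)
    (by simp) (by simpa [pd] using hi) (by simpa using hXi) (by simp)
    (fun x _ => hX.differentiable (by norm_num) x)
  simpa [pd] using this

lemma contDiff_of_tsupport_subset {X : E 2 → ℝ} {n : WithTop ℕ∞} {S : Set (E 2)}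
    (hS : tsupport X ⊆ S) (h : ∀ x ∈ S, ContDiffAt ℝ n X x) : ContDiff ℝ n X := by
  rw [contDiff_iff_contDiffAt]
  intro x
  by_cases hx : x ∈ S
  · exact h x hx
  · have : X =ᶠ[nhds x] fun _ => 0 := notMem_tsupport_iff_eventuallyEq.mp fun h => hx (hS h)
    exact contDiffAt_const.congr_of_eventuallyEq this

lemma contDiffAt_pd {f : E 2 → ℝ} {x : E 2} {n m : WithTop ℕ∞} (h : ContDiffAt ℝ n f x)
    (hm : m + 1 ≤ n) (i : Fin 2) : ContDiffAt ℝ m (fun y => pd f y i) x :=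
  (h.fderiv_right hm).clm_apply contDiffAt_const

lemma contDiffAt_pd2 {f : E 2 → ℝ} {x : E 2} {n m k : WithTop ℕ∞} (h : ContDiffAt ℝ n f x)
    (hk : k + 1 ≤ n) (hm : m + 1 ≤ k) (i j : Fin 2) : ContDiffAt ℝ m (fun y => pd2 f y i j) x :=
  contDiffAt_pd (f := fun y => pd f y j) (contDiffAt_pd h hk j) hm i

lemma pd_mul {f g : E 2 → ℝ} {x : E 2} (hf : ContDiffAt ℝ 1 f x) (hg : ContDiffAt ℝ 1 g x)
    (i : Fin 2) : pd (fun y => f y * g y) x i = pd f x i * g x + f x * pd g x i := by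
  unfold pd
  rw [fderiv_fun_mul (hf.differentiableAt (by norm_num)) (hg.differentiableAt (by norm_num))]
  simp
  ring

lemma pd_sub {f g : E 2 → ℝ} {x : E 2} (hf : ContDiffAt ℝ 1 f x) (hg : ContDiffAt ℝ 1 g x)
    (i : Fin 2) : pd (fun y => f y - g y) x i = pd f x i - pd g x i := by
  unfold pd
  rw [fderiv_fun_sub (hf.differentiableAt (by norm_num)) (hg.differentiableAt (by norm_num))]
  simp

lemma pd_congr {f g : E 2 → ℝ} {x : E 2} (h : f =ᶠ[nhds x] g) (i : Fin 2) :
    pd f x i = pd g x i := by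
  unfold pd; rw [h.fderiv_eq]

/-- The operator `LU u` is in divergence form. -/
lemma divergence_identity {u w ψ : E 2 → ℝ} {x : E 2} (hu : ContDiffAt ℝ 3 u x)
    (hw : ContDiffAt ℝ 2 w x) (hψ : ContDiffAt ℝ 2 ψ x) :
    pd (fun y => pd2 u y 1 1 * (w y * pd ψ y 0 - ψ y * pd w y 0)
        - pd2 u y 0 1 * (w y * pd ψ y 1 - ψ y * pd w y 1)) x 0
      + pd (fun y => pd2 u y 0 0 * (w y * pd ψ y 1 - ψ y * pd w y 1)
        - pd2 u y 0 1 * (w y * pd ψ y 0 - ψ y * pd w y 0)) x 1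
      = w x * LU u ψ x - ψ x * LU u w x := by
  have hu2 : ContDiffAt ℝ 2 u x := hu.of_le (by norm_num)
  have H : ∀ i j, ContDiffAt ℝ 1 (fun y => pd2 u y i j) x := fun i j =>
    contDiffAt_pd2 (k := 2) hu (by norm_num) (by norm_num) i j
  have hw1 := hw.of_le (m := 1) (by norm_num)
  have hψ1 := hψ.of_le (m := 1) (by norm_num)
  have Hw : ∀ i, ContDiffAt ℝ 1 (fun y => pd w y i) x := fun i =>
    contDiffAt_pd hw (by norm_num) i
  have Hψ : ∀ i, ContDiffAt ℝ 1 (fun y => pd ψ y i) x := fun i =>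
    contDiffAt_pd hψ (by norm_num) i
  have HA : ∀ i, ContDiffAt ℝ 1 (fun y => w y * pd ψ y i - ψ y * pd w y i) x := fun i =>
    (hw1.mul (Hψ i)).sub (hψ1.mul (Hw i))
  have dA : ∀ i j, pd (fun y => w y * pd ψ y i - ψ y * pd w y i) x j
      = pd w x j * pd ψ x i + w x * pd2 ψ x j i - (pd ψ x j * pd w x i + ψ x * pd2 w x j i) := by
    intro i j
    rw [pd_sub (hw1.mul (Hψ i)) (hψ1.mul (Hw i)), pd_mul hw1 (Hψ i), pd_mul hψ1 (Hw i)]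
    rfl
  have hs : ∀ i j k, pd (fun y => pd2 u y i j) x k = pd (fun y => pd2 u y k j) x i := by
    intro i j k
    exact pd2_symm (f := fun y => pd u y j) (contDiffAt_pd hu (by norm_num) j) k i
  have hs' : ∀ k, pd (fun y => pd2 u y 1 0) x k = pd (fun y => pd2 u y 0 1) x k := by
    intro k
    refine pd_congr ?_ k
    filter_upwards [eventually_contDiffAt hu2] with y hy using pd2_symm hy 1 0
  rw [pd_sub ((H 1 1).mul (HA 0)) ((H 0 1).mul (HA 1)),
    pd_sub ((H 0 0).mul (HA 1)) ((H 0 1).mul (HA 0)), pd_mul (H 1 1) (HA 0),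
    pd_mul (H 0 1) (HA 1), pd_mul (H 0 0) (HA 1), pd_mul (H 0 1) (HA 0)]
  simp only [dA]
  rw [hs 1 1 0, hs 0 0 1, hs' 0, LU_eq, LU_eq, pd2_symm hu2 1 0]
  ring

lemma continuousAt_LU {u ψ : E 2 → ℝ} {x : E 2} (hu : ContDiffAt ℝ 2 u x)
    (hψ : ContDiffAt ℝ 2 ψ x) : ContinuousAt (LU u ψ) x := by
  have h1 : ∀ i j, ContinuousAt (fun y => pd2 u y i j) x := fun i j =>
    (contDiffAt_pd2 (m := 0) (k := 1) hu (by norm_num) (by norm_num) i j).continuousAt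
  have h2 : ∀ i j, ContinuousAt (fun y => pd2 ψ y i j) x := fun i j =>
    (contDiffAt_pd2 (m := 0) (k := 1) hψ (by norm_num) (by norm_num) i j).continuousAt
  have : LU u ψ = fun x => pd2 u x 1 1 * pd2 ψ x 0 0 - pd2 u x 0 1 * pd2 ψ x 0 1
      - pd2 u x 1 0 * pd2 ψ x 1 0 + pd2 u x 0 0 * pd2 ψ x 1 1 := funext (LU_eq u ψ)
  rw [this]
  exact ((((h1 1 1).mul (h2 0 0)).sub ((h1 0 1).mul (h2 0 1))).sub ((h1 1 0).mul (h2 1 0))).add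
    ((h1 0 0).mul (h2 1 1))

lemma continuousAt_QU {u w : E 2 → ℝ} {x : E 2} (hu : ContDiffAt ℝ 2 u x)
    (hw : ContDiffAt ℝ 1 w x) : ContinuousAt (QU u w) x := by
  have h1 : ∀ i j, ContinuousAt (fun y => pd2 u y i j) x := fun i j =>
    (contDiffAt_pd2 (m := 0) (k := 1) hu (by norm_num) (by norm_num) i j).continuousAt
  have h2 : ∀ i, ContinuousAt (fun y => pd w y i) x := fun i =>
    (contDiffAt_pd (m := 0) hw (by norm_num) i).continuousAt
  exact (((h1 1 1).mul ((h2 0).pow 2)).sub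
    ((continuousAt_const.mul (h1 0 1)).mul ((h2 0).mul (h2 1)))).add ((h1 0 0).mul ((h2 1).pow 2))

lemma continuous_of_tsupport_subset {X : E 2 → ℝ} {S : Set (E 2)}
    (hS : ∀ x, x ∉ S → X =ᶠ[nhds x] fun _ => 0) (h : ∀ x ∈ S, ContinuousAt X x) :
    Continuous X := by
  rw [continuous_iff_continuousAt]
  intro x
  by_cases hx : x ∈ S
  · exact h x hx
  · exact continuousAt_const.congr (hS x hx).symm

/-- Green's second identity. -/
lemma green_identity {u w ψ : E 2 → ℝ}
    (hu : ∀ x ∈ tsupport ψ, ContDiffAt ℝ 3 u x) (hw : ∀ x ∈ tsupport ψ, ContDiffAt ℝ 2 w x)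
    (hψ : ContDiff ℝ 2 ψ) (hc : HasCompactSupport ψ) :
    Integrable (fun x => w x * LU u ψ x) ∧ Integrable (fun x => ψ x * LU u w x) ∧
      ∫ x, w x * LU u ψ x = ∫ x, ψ x * LU u w x := by
  have hz : ∀ x, x ∉ tsupport ψ → ψ =ᶠ[nhds x] fun _ => 0 := fun x hx =>
    notMem_tsupport_iff_eventuallyEq.mp hx
  have hLz : ∀ x, x ∉ tsupport ψ → LU u ψ =ᶠ[nhds x] fun _ => 0 := by
    intro x hx
    have : (tsupport ψ)ᶜ ∈ nhds x := (isClosed_tsupport ψ).isOpen_compl.mem_nhds hx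
    filter_upwards [this] with y hy using LU_of_notMem_tsupport hy
  have cont1 : Continuous (fun x => w x * LU u ψ x) := by
    refine continuous_of_tsupport_subset (S := tsupport ψ) (fun x hx => ?_) fun x hx => ?_
    · filter_upwards [hLz x hx] with y hy
      simp [hy]
    · exact (hw x hx).continuousAt.mul
        (continuousAt_LU ((hu x hx).of_le (by norm_num)) hψ.contDiffAt)
  have cont2 : Continuous (fun x => ψ x * LU u w x) := by
    refine continuous_of_tsupport_subset (S := tsupport ψ) (fun x hx => ?_) fun x hx => ?_
    · filter_upwards [hz x hx] with y hy
      simp [hy]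
    · exact hψ.continuous.continuousAt.mul
        (continuousAt_LU ((hu x hx).of_le (by norm_num)) (hw x hx))
  have hi1 : Integrable (fun x => w x * LU u ψ x) := by
    refine cont1.integrable_of_hasCompactSupport (HasCompactSupport.intro hc fun x hx => ?_)
    simp [LU_of_notMem_tsupport hx]
  have hi2 : Integrable (fun x => ψ x * LU u w x) := by
    refine cont2.integrable_of_hasCompactSupport (HasCompactSupport.intro hc fun x hx => ?_)
    simp [image_eq_zero_of_notMem_tsupport hx]
  refine ⟨hi1, hi2, ?_⟩
  have hX : ∀ i j k l : Fin 2, ∀ a b : Fin 2, (ContDiff ℝ 1 (fun y =>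
      pd2 u y i j * (w y * pd ψ y a - ψ y * pd w y a)
        - pd2 u y k l * (w y * pd ψ y b - ψ y * pd w y b))) ∧ HasCompactSupport (fun y =>
      pd2 u y i j * (w y * pd ψ y a - ψ y * pd w y a)
        - pd2 u y k l * (w y * pd ψ y b - ψ y * pd w y b)) := by
    intro i j k l a b
    have hz' : ∀ x, x ∉ tsupport ψ → pd2 u x i j * (w x * pd ψ x a - ψ x * pd w x a)
        - pd2 u x k l * (w x * pd ψ x b - ψ x * pd w x b) = 0 := by
      intro x hx
      have h1 : ψ x = 0 := image_eq_zero_of_notMem_tsupport hx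
      have h2 : ∀ a, pd ψ x a = 0 := fun a => by rw [pd_congr (hz x hx)]; simp [pd]
      simp [h1, h2]
    refine ⟨contDiff_of_tsupport_subset (S := tsupport ψ) ?_ ?_, HasCompactSupport.intro hc hz'⟩
    · refine closure_minimal (fun x hx => ?_) (isClosed_tsupport ψ)
      by_contra hn
      exact hx (hz' x hn)
    · intro x hx
      have H : ∀ i j, ContDiffAt ℝ 1 (fun y => pd2 u y i j) x := fun i j =>
        contDiffAt_pd2 (k := 2) (hu x hx) (by norm_num) (by norm_num) i j
      have HA : ∀ i, ContDiffAt ℝ 1 (fun y => w y * pd ψ y i - ψ y * pd w y i) x := fun i =>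
        (((hw x hx).of_le (by norm_num)).mul (contDiffAt_pd hψ.contDiffAt (by norm_num) i)).sub
        ((hψ.contDiffAt.of_le (by norm_num)).mul (contDiffAt_pd (hw x hx) (by norm_num) i))
      exact ((H i j).mul (HA a)).sub ((H k l).mul (HA b))
  obtain ⟨i0, e0⟩ := integral_pd_eq_zero (hX 1 1 0 1 0 1).1 (hX 1 1 0 1 0 1).2 0
  obtain ⟨i1, e1⟩ := integral_pd_eq_zero (hX 0 0 0 1 1 0).1 (hX 0 0 0 1 1 0).2 1
  rw [← sub_eq_zero, ← integral_sub hi1 hi2, ← add_zero (0 : ℝ)]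
  nth_rewrite 1 [← e0]
  rw [← e1, ← integral_add i0 i1]
  refine integral_congr_ae (Filter.Eventually.of_forall fun x => ?_)
  by_cases hx : x ∈ tsupport ψ
  · exact (divergence_identity (hu x hx) (hw x hx) hψ.contDiffAt).symm
  · have h1 : ψ x = 0 := image_eq_zero_of_notMem_tsupport hx
    have h3 : ∀ i j k l : Fin 2, ∀ a b c : Fin 2, pd (fun y =>
      pd2 u y i j * (w y * pd ψ y a - ψ y * pd w y a)
        - pd2 u y k l * (w y * pd ψ y b - ψ y * pd w y b)) x c = 0 := by
      intro i j k l a b c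
      have : (fun y => pd2 u y i j * (w y * pd ψ y a - ψ y * pd w y a)
        - pd2 u y k l * (w y * pd ψ y b - ψ y * pd w y b)) =ᶠ[nhds x] fun _ => 0 := by
        have hx' : (tsupport ψ)ᶜ ∈ nhds x := (isClosed_tsupport ψ).isOpen_compl.mem_nhds hx
        filter_upwards [hx'] with y hy
        have h1 : ψ y = 0 := image_eq_zero_of_notMem_tsupport hy
        have h2 : ∀ a, pd ψ y a = 0 := fun a => by rw [pd_congr (hz y hy)]; simp [pd]
        simp [h1, h2]
      rw [pd_congr this]
      simp [pd]
    simp [h1, h3, LU_of_notMem_tsupport hx]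

end Green

section LogPotential

lemma norm_sq_eq_coord (y : E 2) : ‖y‖ ^ 2 = y 0 ^ 2 + y 1 ^ 2 := by
  rw [EuclideanSpace.norm_sq_eq]; simp

/-- The coordinate functionals of the plane. -/
def coordL (i : Fin 2) : E 2 →L[ℝ] ℝ := EuclideanSpace.proj i

@[simp] lemma coordL_apply (i : Fin 2) (x : E 2) : coordL i x = x i := rfl

/-- The quadratic polynomial with Hessian `[[a, b], [b, c]]` centered at `x₀`. -/
def quadPoly (a b c : ℝ) (x₀ x : E 2) : ℝ :=
  a / 2 * (x 0 - x₀ 0) ^ 2 + b * ((x 0 - x₀ 0) * (x 1 - x₀ 1)) + c / 2 * (x 1 - x₀ 1) ^ 2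

lemma hasFDerivAt_quadPoly (a b c : ℝ) (x₀ x : E 2) : HasFDerivAt (quadPoly a b c x₀)
    ((a * (x 0 - x₀ 0) + b * (x 1 - x₀ 1)) • coordL 0
      + (b * (x 0 - x₀ 0) + c * (x 1 - x₀ 1)) • coordL 1) x := by
  have h : ∀ i : Fin 2, HasFDerivAt (fun x : E 2 => x i - x₀ i)
      (coordL i) x := fun i =>
    (coordL i).hasFDerivAt.sub_const _
  have := ((((h 0).pow 2).const_mul (a / 2)).add (((h 0).mul (h 1)).const_mul b)).add
    (((h 1).pow 2).const_mul (c / 2))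
  refine this.congr_fderiv ?_
  ext z
  simp
  ring

lemma contDiff_quadPoly (a b c : ℝ) (x₀ : E 2) {n : WithTop ℕ∞} :
    ContDiff ℝ n (quadPoly a b c x₀) := by
  have h : ∀ i : Fin 2, ContDiff ℝ n (fun x : E 2 => x i - x₀ i) := fun i =>
    (coordL i).contDiff.sub contDiff_const
  exact ((contDiff_const.mul ((h 0).pow 2)).add (contDiff_const.mul ((h 0).mul (h 1)))).add
    (contDiff_const.mul ((h 1).pow 2))

lemma pd_quadPoly_zero (a b c : ℝ) (x₀ x : E 2) :
    pd (quadPoly a b c x₀) x 0 = a * (x 0 - x₀ 0) + b * (x 1 - x₀ 1) := by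
  rw [pd, (hasFDerivAt_quadPoly a b c x₀ x).fderiv]; simp

lemma pd_quadPoly_one (a b c : ℝ) (x₀ x : E 2) :
    pd (quadPoly a b c x₀) x 1 = b * (x 0 - x₀ 0) + c * (x 1 - x₀ 1) := by
  rw [pd, (hasFDerivAt_quadPoly a b c x₀ x).fderiv]; simp

lemma fderiv_linear_coord (a b : ℝ) (x₀ x v : E 2) :
    fderiv ℝ (fun x : E 2 => a * (x 0 - x₀ 0) + b * (x 1 - x₀ 1)) x v = a * v 0 + b * v 1 := by
  have h : ∀ i : Fin 2, HasFDerivAt (fun x : E 2 => x i - x₀ i)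
      (coordL i) x := fun i =>
    (coordL i).hasFDerivAt.sub_const _
  have := ((h 0).const_mul a).add ((h 1).const_mul b)
  erw [this.fderiv]; simp

lemma pd2_quadPoly (a b c : ℝ) (x₀ x : E 2) :
    pd2 (quadPoly a b c x₀) x 0 0 = a ∧ pd2 (quadPoly a b c x₀) x 0 1 = b ∧
      pd2 (quadPoly a b c x₀) x 1 0 = b ∧ pd2 (quadPoly a b c x₀) x 1 1 = c := by
  have h0 : (fun y => pd (quadPoly a b c x₀) y 0)
      = fun x : E 2 => a * (x 0 - x₀ 0) + b * (x 1 - x₀ 1) :=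
    funext (pd_quadPoly_zero a b c x₀)
  have h1 : (fun y => pd (quadPoly a b c x₀) y 1)
      = fun x : E 2 => b * (x 0 - x₀ 0) + c * (x 1 - x₀ 1) :=
    funext (pd_quadPoly_one a b c x₀)
  have e0 : ∀ i, pd2 (quadPoly a b c x₀) x i 0
      = fderiv ℝ (fun y => pd (quadPoly a b c x₀) y 0) x (EuclideanSpace.single i 1) :=
    fun i => rfl
  have e1 : ∀ i, pd2 (quadPoly a b c x₀) x i 1
      = fderiv ℝ (fun y => pd (quadPoly a b c x₀) y 1) x (EuclideanSpace.single i 1) :=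
    fun i => rfl
  rw [e0, e0, e1, e1, h0, h1]
  simp only [fderiv_linear_coord]
  simp

lemma abs_quadratic_form_le {A B C t p q : ℝ} (hA : |A| ≤ t) (hB : |B| ≤ t) (hC : |C| ≤ t) :
    |A * p ^ 2 - 2 * B * (p * q) + C * q ^ 2| ≤ 2 * t * (p ^ 2 + q ^ 2) := by
  have h2 : |p * q| ≤ (p ^ 2 + q ^ 2) / 2 := by
    rw [abs_le]; constructor <;> nlinarith [sq_nonneg (p + q), sq_nonneg (p - q)]
  have ht : 0 ≤ t := (abs_nonneg _).trans hA
  have e1 : |A * p ^ 2| ≤ t * p ^ 2 := by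
    rw [abs_mul, abs_of_nonneg (sq_nonneg p)]; gcongr
  have e2 : |C * q ^ 2| ≤ t * q ^ 2 := by
    rw [abs_mul, abs_of_nonneg (sq_nonneg q)]; gcongr
  have e3 : |2 * B * (p * q)| ≤ t * (p ^ 2 + q ^ 2) := by
    rw [abs_mul, abs_mul, abs_two]
    calc 2 * |B| * |p * q| ≤ 2 * t * ((p ^ 2 + q ^ 2) / 2) := by gcongr
      _ = _ := by ring
  calc _ ≤ |A * p ^ 2 - 2 * B * (p * q)| + |C * q ^ 2| := abs_add_le _ _
    _ ≤ |A * p ^ 2| + |2 * B * (p * q)| + |C * q ^ 2| := by gcongr; exact abs_sub _ _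
    _ ≤ _ := by linarith

set_option maxHeartbeats 800000 in
/-- Near a point where the coefficients are elliptic there is an approximate solution with
a logarithmic singularity. -/
lemma exists_log_potential {u : E 2 → ℝ} {x₀ : E 2} (hu : ContDiffAt ℝ 3 u x₀)
    (hp : ∀ v, 0 ≤ D2 u x₀ v v) (hdet : 0 < (Hess u x₀).det) :
    ∃ l : E 2 → ℝ, ∃ C κ r₀ : ℝ, 0 < C ∧ 0 < r₀ ∧ ∀ x, x ≠ x₀ → ‖x - x₀‖ < r₀ →
      ContDiffAt ℝ 2 l x ∧ |l x - 2 * Real.log ‖x - x₀‖| ≤ κ ∧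
      (∀ i, |pd l x i| ≤ C / ‖x - x₀‖) ∧ |LU u l x| ≤ C / ‖x - x₀‖ := by
  have hu2 : ContDiffAt ℝ 2 u x₀ := hu.of_le (by norm_num)
  set a := pd2 u x₀ 0 0 with ha
  set b := pd2 u x₀ 0 1 with hb
  set c := pd2 u x₀ 1 1 with hc
  have hΔ : 0 < a * c - b ^ 2 := by
    rw [det_Hess, pd2_symm hu2 1 0] at hdet; nlinarith
  have ha0 : 0 ≤ a := by
    have := hp (!₂[1, 0]); rw [D2_coord hu2] at this; simpa using this
  have hc0 : 0 ≤ c := by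
    have := hp (!₂[0, 1]); rw [D2_coord hu2] at this; simpa using this
  have hac : 0 < a * c := by nlinarith [sq_nonneg b]
  have ha1 : 0 < a := pos_of_mul_pos_left hac hc0
  have hc1 : 0 < c := pos_of_mul_pos_right hac ha0
  set S := a + c with hS
  have hS0 : 0 < S := by positivity
  have hbS : |b| ≤ S := by
    apply abs_le_of_sq_le_sq _ hS0.le; nlinarith
  set m := (a * c - b ^ 2) / (2 * S) with hm
  have hm0 : 0 < m := by positivity
  set q := quadPoly a b c x₀ with hq
  have id1 : ∀ x, 2 * S * q x = pd q x 0 ^ 2 + pd q x 1 ^ 2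
      + (a * c - b ^ 2) * ‖x - x₀‖ ^ 2 := by
    intro x
    rw [hq, pd_quadPoly_zero, pd_quadPoly_one, quadPoly, norm_sq_eq_coord]
    simp only [PiLp.sub_apply]
    ring
  have hqm : ∀ x, m * ‖x - x₀‖ ^ 2 ≤ q x := by
    intro x
    have := id1 x
    have h2 : (a * c - b ^ 2) * ‖x - x₀‖ ^ 2 ≤ 2 * S * q x := by nlinarith [sq_nonneg (pd q x 0), sq_nonneg (pd q x 1)]
    rw [hm, div_mul_eq_mul_div, div_le_iff₀ (by positivity)]
    linarith
  have hqM : ∀ x, q x ≤ S * ‖x - x₀‖ ^ 2 := by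
    intro x
    rw [hq, quadPoly, norm_sq_eq_coord]
    simp only [PiLp.sub_apply]
    have h1 := abs_quadratic_form_le (p := x 0 - x₀ 0) (q := x 1 - x₀ 1) (A := 0) (B := b) (C := 0)
      (t := S) (by simp [hS0.le]) hbS (by simp [hS0.le])
    have h2 : b * ((x 0 - x₀ 0) * (x 1 - x₀ 1)) ≤ S / 2 * ((x 0 - x₀ 0) ^ 2 + (x 1 - x₀ 1) ^ 2) := by
      have h3 := abs_le.mp hbS
      rcases le_total 0 ((x 0 - x₀ 0) * (x 1 - x₀ 1)) with h | h
      · nlinarith [sq_nonneg ((x 0 - x₀ 0) - (x 1 - x₀ 1))]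
      · nlinarith [sq_nonneg ((x 0 - x₀ 0) + (x 1 - x₀ 1))]
    nlinarith [sq_nonneg (x 0 - x₀ 0), sq_nonneg (x 1 - x₀ 1)]
  have hpS : ∀ x, pd q x 0 ^ 2 + pd q x 1 ^ 2 ≤ 2 * S * q x := by
    intro x; have := id1 x; nlinarith [sq_nonneg ‖x - x₀‖]
  have H : ∀ i j, (fun x => pd2 u x i j - pd2 u x₀ i j) =O[nhds x₀] fun x => x - x₀ := by
    intro i j
    have h1 : ContDiffAt ℝ 1 (fun y => pd2 u y i j) x₀ :=
      contDiffAt_pd2 (k := 2) hu (by norm_num) (by norm_num) i j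
    exact (h1.differentiableAt (by norm_num)).isBigO_sub
  obtain ⟨K0, hK0⟩ := (H 0 0).bound
  obtain ⟨K1, hK1⟩ := (H 0 1).bound
  obtain ⟨K2, hK2⟩ := (H 1 1).bound
  set K := max (max K0 K1) (max K2 1) with hK
  have hKp : 0 < K := lt_of_lt_of_le one_pos ((le_max_right _ _).trans (le_max_right _ _))
  obtain ⟨r₀, hr₀, hball⟩ := Metric.eventually_nhds_iff.mp
    (hK0.and (hK1.and (hK2.and (eventually_contDiffAt hu2))))
  refine ⟨fun x => Real.log (q x), max (8 * K * S / m) (2 * S / m), max (Real.log S) (-Real.log m),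
    r₀, ?_, hr₀, ?_⟩
  · exact lt_of_lt_of_le (by positivity) (le_max_left _ _)
  intro x hx hxr
  obtain ⟨k0, k1, k2, hux⟩ := hball (y := x) (by rwa [dist_eq_norm])
  have hy : 0 < ‖x - x₀‖ := norm_pos_iff.mpr (sub_ne_zero.mpr hx)
  have hqx : 0 < q x := lt_of_lt_of_le (by positivity) (hqm x)
  set y := ‖x - x₀‖ with hyd
  have hqc : ContDiffAt ℝ 2 q x := (contDiff_quadPoly a b c x₀).contDiffAt
  have hR : ∀ᶠ r in nhds (q x), HasDerivAt Real.log (r⁻¹) r := by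
    filter_upwards [eventually_ne_nhds hqx.ne'] with r hr using Real.hasDerivAt_log hr
  have hR' : HasDerivAt (fun r : ℝ => r⁻¹) (-(q x ^ 2)⁻¹) (q x) := hasDerivAt_inv hqx.ne'
  have hpd : ∀ i, pd (fun x => Real.log (q x)) x i = pd q x i / q x := by
    intro i
    have := (Real.hasDerivAt_log hqx.ne').comp_hasFDerivAt x
      (hqc.differentiableAt (by norm_num)).hasFDerivAt
    unfold pd
    erw [this.fderiv]
    simp; ring
  refine ⟨hqc.log hqx.ne', ?_, ?_, ?_⟩
  · have h1 := Real.log_le_log (by positivity) (hqm x)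
    have h2 := Real.log_le_log hqx (hqM x)
    rw [Real.log_mul (by positivity) (by positivity), Real.log_pow] at h1 h2
    push_cast at h1 h2
    rw [abs_le]
    constructor
    · have := le_max_right (Real.log S) (-Real.log m); linarith
    · have := le_max_left (Real.log S) (-Real.log m); linarith
  · intro i
    rw [hpd, abs_div, abs_of_pos hqx]
    have h1 : |pd q x i| ≤ 2 * S * y := by
      apply abs_le_of_sq_le_sq _ (by positivity)
      have h3 := hpS x
      have h4 := hqM x
      have : pd q x i ^ 2 ≤ pd q x 0 ^ 2 + pd q x 1 ^ 2 := by
        fin_cases i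
        · simpa using sq_nonneg (pd q x 1)
        · simpa using sq_nonneg (pd q x 0)
      nlinarith [mul_pos hS0 hS0, mul_le_mul_of_nonneg_left h4 hS0.le, sq_nonneg (S * y)]
    calc |pd q x i| / q x ≤ 2 * S * y / (m * y ^ 2) := by
          gcongr; exact hqm x
      _ = 2 * S / m / y := by field_simp
      _ ≤ _ := by gcongr; exact le_max_right _ _
  · rw [LU_comp (w := q) hux hqc hR hR']
    obtain ⟨q00, q01, q10, q11⟩ := pd2_quadPoly a b c x₀ x
    rw [LU_eq, q00, q01, q10, q11, QU, pd2_symm hux 1 0]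
    have d0 : |pd2 u x 0 0 - a| ≤ K * y := by
      refine (Real.norm_eq_abs _ ▸ k0).trans ?_
      gcongr; exact (le_max_left _ _).trans (le_max_left _ _)
    have d1 : |pd2 u x 0 1 - b| ≤ K * y := by
      refine (Real.norm_eq_abs _ ▸ k1).trans ?_
      gcongr; exact (le_max_right _ _).trans (le_max_left _ _)
    have d2 : |pd2 u x 1 1 - c| ≤ K * y := by
      refine (Real.norm_eq_abs _ ▸ k2).trans ?_
      gcongr; exact (le_max_left _ _).trans (le_max_right _ _)
    set A := pd2 u x 0 0 - a with hA
    set B := pd2 u x 0 1 - b with hB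
    set D := pd2 u x 1 1 - c with hD
    have eA : pd2 u x 0 0 = a + A := by rw [hA]; ring
    have eB : pd2 u x 0 1 = b + B := by rw [hB]; ring
    have eD : pd2 u x 1 1 = c + D := by rw [hD]; ring
    rw [eA, eB, eD]
    clear_value A B D
    have id2 : c * pd q x 0 ^ 2 - 2 * b * (pd q x 0 * pd q x 1) + a * pd q x 1 ^ 2
        = 2 * (a * c - b ^ 2) * q x := by
      rw [hq, pd_quadPoly_zero, pd_quadPoly_one, quadPoly]; ring
    have h1 := abs_quadratic_form_le (p := pd q x 0) (q := pd q x 1) d2 d1 d0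
    have h2 : |D * a - 2 * B * b + A * c| ≤ 4 * (K * y * S) := by
      have e1 : |D * a| ≤ K * y * S := by
        rw [abs_mul, abs_of_pos ha1]; gcongr; linarith
      have e2 : |A * c| ≤ K * y * S := by
        rw [abs_mul, abs_of_pos hc1]; gcongr; linarith
      have e3 : |2 * B * b| ≤ 2 * (K * y * S) := by
        rw [abs_mul, abs_mul, abs_two, mul_assoc]; gcongr
      calc _ ≤ |D * a - 2 * B * b| + |A * c| := abs_add_le _ _
        _ ≤ |D * a| + |2 * B * b| + |A * c| := by gcongr; exact abs_sub _ _
        _ ≤ _ := by linarith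
    have id3 : (q x)⁻¹ * ((c + D) * a - (b + B) * b - (b + B) * b + (a + A) * c)
        + -(q x ^ 2)⁻¹ * ((c + D) * pd q x 0 ^ 2 - 2 * (b + B) * (pd q x 0 * pd q x 1)
          + (a + A) * pd q x 1 ^ 2)
        = (D * a - 2 * B * b + A * c) / q x
          - (D * pd q x 0 ^ 2 - 2 * B * (pd q x 0 * pd q x 1) + A * pd q x 1 ^ 2) / q x ^ 2 := by
      have : (c + D) * pd q x 0 ^ 2 - 2 * (b + B) * (pd q x 0 * pd q x 1) + (a + A) * pd q x 1 ^ 2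
          = 2 * (a * c - b ^ 2) * q x
            + (D * pd q x 0 ^ 2 - 2 * B * (pd q x 0 * pd q x 1) + A * pd q x 1 ^ 2) := by
        rw [← id2]; ring
      rw [this]
      field_simp
      ring
    rw [id3]
    calc _ ≤ |(D * a - 2 * B * b + A * c) / q x|
          + |(D * pd q x 0 ^ 2 - 2 * B * (pd q x 0 * pd q x 1) + A * pd q x 1 ^ 2) / q x ^ 2| :=
          abs_sub _ _
      _ ≤ 4 * (K * y * S) / q x + 2 * (K * y) * (2 * S * q x) / q x ^ 2 := by
          rw [abs_div, abs_div, abs_of_pos hqx, abs_of_pos (pow_pos hqx 2)]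
          gcongr
          exact h1.trans (by gcongr; exact hpS x)
      _ = 8 * (K * y * S) / q x := by field_simp; ring
      _ ≤ 8 * (K * y * S) / (m * y ^ 2) := by gcongr; exact hqm x
      _ = 8 * K * S / m / y := by field_simp
      _ ≤ _ := by gcongr; exact le_max_left _ _

end LogPotential

section Cutoff

/-- The function `r⁻²` cut off to an annulus. -/
def annulusWeight (r₁ r₂ r : ℝ) : ℝ := (Set.Icc r₁ r₂).indicator (fun r => (r ^ 2)⁻¹) r

lemma annulusWeight_integral {r₁ r₂ : ℝ} (h₁ : 0 < r₁) (h : r₁ ≤ r₂) (x₀ : E 2) :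
    Integrable (fun x : E 2 => annulusWeight r₁ r₂ ‖x - x₀‖) ∧
    ∫ x : E 2, annulusWeight r₁ r₂ ‖x - x₀‖
      = 2 * (volume.real (Metric.ball (0 : E 2) 1) * Real.log (r₂ / r₁)) := by
  have hsub : Set.Icc r₁ r₂ ⊆ Set.Ioi 0 := fun r hr => h₁.trans_le hr.1
  have heq : (fun y : ℝ => y ^ (Module.finrank ℝ (E 2) - 1) • annulusWeight r₁ r₂ y)
      = (Set.Icc r₁ r₂).indicator (fun y => y⁻¹) := by
    ext y
    simp only [finrank_euclideanSpace, Fintype.card_fin, annulusWeight, Set.indicator, smul_eq_mul]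
    split_ifs with hy
    · have : y ≠ 0 := (hsub hy).ne'
      field_simp
      norm_num
    · simp
  have hint : IntegrableOn (fun y : ℝ => y⁻¹) (Set.Icc r₁ r₂) := by
    apply ContinuousOn.integrableOn_Icc
    exact continuousOn_inv₀.mono fun y hy => (hsub hy).ne'
  have h1 : Integrable (fun x : E 2 => annulusWeight r₁ r₂ ‖x‖) := by
    rw [integrable_fun_norm_addHaar, heq]
    exact ((integrable_indicator_iff measurableSet_Icc).mpr hint).integrableOn
  refine ⟨h1.comp_sub_right x₀, ?_⟩
  rw [integral_sub_right_eq_self (fun x : E 2 => annulusWeight r₁ r₂ ‖x‖),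
    integral_fun_norm_addHaar, heq]
  simp only [finrank_euclideanSpace, Fintype.card_fin]
  rw [setIntegral_indicator measurableSet_Icc, Set.inter_eq_right.mpr hsub,
    integral_Icc_eq_integral_Ioc, ← intervalIntegral.integral_of_le h,
    integral_inv_of_pos h₁ (h₁.trans_le h)]
  simp

set_option maxHeartbeats 1600000 in
lemma exists_cutoff {u φ : E 2 → ℝ} {x₀ : E 2} (hu : ContDiffAt ℝ 3 u x₀)
    (hp : ∀ v, 0 ≤ D2 u x₀ v v) (hdet : 0 < (Hess u x₀).det) (hφ : ContDiff ℝ 2 φ)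
    {ε ρ : ℝ} (hε : 0 < ε) (hρ : 0 < ρ) :
    ∃ χ : E 2 → ℝ, ContDiff ℝ 2 χ ∧ (∀ᶠ x in nhds x₀, χ x = 1) ∧ (∀ x, 0 ≤ χ x ∧ χ x ≤ 1) ∧
      tsupport χ ⊆ Metric.ball x₀ ρ ∧ ∫ x, |LU u (fun y => χ y * φ y) x| ≤ ε := by
  obtain ⟨l, C, κ₀, r₀, hC, hr₀, hl⟩ := exists_log_potential hu hp hdet
  have hu2 : ContDiffAt ℝ 2 u x₀ := hu.of_le (by norm_num)
  set κ := max κ₀ 0 with hκ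
  have hκ0 : 0 ≤ κ := le_max_right _ _
  have hbd : ∀ f : E 2 → ℝ, ContinuousAt f x₀ → ∃ B, ∀ᶠ x in nhds x₀, |f x| ≤ B := by
    intro f hf
    refine ⟨|f x₀| + 1, ?_⟩
    filter_upwards [hf.abs.eventually_lt_const (lt_add_one _)] with x hx using hx.le
  have hcu : ∀ i j, ContinuousAt (fun y => pd2 u y i j) x₀ := fun i j =>
    (contDiffAt_pd2 (m := 0) (k := 1) hu2 (by norm_num) (by norm_num) i j).continuousAt
  have hcφ : ∀ i, ContinuousAt (fun y => pd φ y i) x₀ := fun i =>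
    (contDiffAt_pd (m := 0) (n := 2) hφ.contDiffAt (by norm_num) i).continuousAt
  obtain ⟨b0, hb0⟩ := hbd _ (hcu 0 0)
  obtain ⟨b1, hb1⟩ := hbd _ (hcu 0 1)
  obtain ⟨b2, hb2⟩ := hbd _ (hcu 1 1)
  obtain ⟨c0, hc0⟩ := hbd _ (hcφ 0)
  obtain ⟨c1, hc1⟩ := hbd _ (hcφ 1)
  obtain ⟨c2, hc2⟩ := hbd _ (continuousAt_LU hu2 hφ.contDiffAt)
  obtain ⟨c3, hc3⟩ := hbd _ hφ.continuous.continuousAt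
  set B0 := max (max b0 b1) b2 with hB0
  set B1 := max (max c0 c1) (max c2 c3) with hB1
  obtain ⟨r₃, hr₃, hball⟩ := Metric.eventually_nhds_iff.mp
    (hb0.and (hb1.and (hb2.and (hc0.and (hc1.and (hc2.and (hc3.and
      ((eventually_contDiffAt hu2).and (hu.eventually (by simp))))))))))
  have hST : ContDiff ℝ 2 Real.smoothTransition := Real.smoothTransition.contDiff
  have hST1 : Continuous (deriv Real.smoothTransition) := hST.continuous_deriv (by norm_num)
  have hSTd : ContDiff ℝ 1 (deriv Real.smoothTransition) :=
    (contDiff_succ_iff_deriv (n := 1)).mp hST |>.2.2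
  have hST2 : Continuous (deriv (deriv Real.smoothTransition)) :=
    hSTd.continuous_deriv (by norm_num)
  obtain ⟨B2, hB2⟩ := (isCompact_Icc (a := -2 * κ) (b := 1 + 2 * κ)).exists_bound_of_continuousOn
    hST1.continuousOn
  obtain ⟨B3, hB3⟩ := (isCompact_Icc (a := -2 * κ) (b := 1 + 2 * κ)).exists_bound_of_continuousOn
    hST2.continuousOn
  set B := max (max B2 B3) 0 with hB
  have hB00 : 0 ≤ B0 := by
    have := (hball (y := x₀) (by simpa using hr₃)).1
    exact (abs_nonneg _).trans (this.trans ((le_max_left _ _).trans (le_max_left _ _)))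
  have hB10 : 0 ≤ B1 := by
    have := (hball (y := x₀) (by simpa using hr₃)).2.2.2.1
    exact (abs_nonneg _).trans (this.trans ((le_max_left _ _).trans (le_max_left _ _)))
  have hBn : 0 ≤ B := le_max_right _ _
  set Cb := B1 * B * (C + 4 * B0 * C ^ 2) + 8 * B0 * B1 * B * C with hCb
  have hCb0 : 0 ≤ Cb := by positivity
  set vb := volume.real (Metric.ball (0 : E 2) 1) with hvb
  have hvb0 : 0 ≤ vb := measureReal_nonneg
  -- choice of the scale
  obtain ⟨N, hN1, hNr, hNr', hNε⟩ : ∃ N : ℝ, 1 ≤ N ∧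
      Real.exp (κ / 2 - N) < min (min r₀ r₃) ρ ∧ Real.exp (κ / 2 - N) ≤ 1 / N ∧
      Cb / N ^ 2 * (2 * (vb * ((N + 2 * κ) / 2))) + B1 * ((1 / N) ^ 2 * vb) ≤ ε := by
    have t0 : Filter.Tendsto (fun N : ℝ => 1 / N) Filter.atTop (nhds 0) := by
      simpa using tendsto_inv_atTop_zero (𝕜 := ℝ)
    have t1 : Filter.Tendsto (fun N : ℝ => Cb * vb * (1 / N + 2 * κ * (1 / N) ^ 2)
        + B1 * ((1 / N) ^ 2 * vb)) Filter.atTop (nhds 0) := by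
      have := ((t0.add ((t0.pow 2).const_mul (2 * κ))).const_mul (Cb * vb)).add
        (((t0.pow 2).mul_const vb).const_mul B1)
      simpa using this
    have t2 : Filter.Tendsto (fun N : ℝ => Real.exp (κ / 2) * (N ^ 1 * Real.exp (-N)))
        Filter.atTop (nhds 0) := by
      simpa using (Real.tendsto_pow_mul_exp_neg_atTop_nhds_zero 1).const_mul (Real.exp (κ / 2))
    have hmin : 0 < min (min r₀ r₃) ρ := by positivity
    obtain ⟨N, h1, h2, h3, h4⟩ := (((Filter.eventually_ge_atTop (1 : ℝ)).and
      ((t2.eventually_lt_const one_pos).and ((t2.eventually_lt_const hmin).and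
        (t1.eventually_lt_const hε))))).exists
    have hN0 : 0 < N := by linarith
    have e : Real.exp (κ / 2 - N) = Real.exp (κ / 2) * Real.exp (-N) := by
      rw [← Real.exp_add]; ring_nf
    have hpos : 0 < Real.exp (κ / 2) * Real.exp (-N) := by positivity
    refine ⟨N, h1, ?_, ?_, ?_⟩
    · rw [e]; rw [pow_one] at h3; nlinarith
    · rw [e, le_div_iff₀ hN0]; rw [pow_one] at h2; nlinarith
    · refine le_trans (le_of_eq ?_) h4.le
      field_simp
  have hN0 : 0 < N := by linarith
  set r₂ := Real.exp (κ / 2 - N) with hr₂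
  set r₁ := Real.exp ((-3 * N - κ) / 2) with hr₁
  have hr₂0 : 0 < r₂ := Real.exp_pos _
  have hr₁0 : 0 < r₁ := Real.exp_pos _
  have hr₁₂ : r₁ < r₂ := by rw [hr₁, hr₂, Real.exp_lt_exp]; linarith
  have hlog : Real.log (r₂ / r₁) = (N + 2 * κ) / 2 := by
    rw [Real.log_div hr₂0.ne' hr₁0.ne', hr₁, hr₂, Real.log_exp, Real.log_exp]; ring
  have hr20 : r₂ < r₀ := hNr.trans_le ((min_le_left _ _).trans (min_le_left _ _))
  have hr23 : r₂ < r₃ := hNr.trans_le ((min_le_left _ _).trans (min_le_right _ _))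
  have hr2ρ : r₂ < ρ := hNr.trans_le (min_le_right _ _)
  have hld : ∀ x, x ≠ x₀ → ‖x - x₀‖ < r₀ → |l x - 2 * Real.log ‖x - x₀‖| ≤ κ := fun x h1 h2 =>
    (hl x h1 h2).2.1.trans (le_max_left _ _)
  classical
  set F : ℝ → ℝ := fun r => 1 - Real.smoothTransition (r / N + 3) with hF
  set χ : E 2 → ℝ := fun x => if x = x₀ then 1 else if ‖x - x₀‖ < r₀ then F (l x) else 0 with hχ
  have hnorm : Continuous fun x : E 2 => ‖x - x₀‖ := by fun_prop
  have hin : ∀ x, ‖x - x₀‖ < r₁ → χ x = 1 := by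
    intro x hx
    by_cases h : x = x₀
    · simp [hχ, h]
    · have hy : 0 < ‖x - x₀‖ := norm_pos_iff.mpr (sub_ne_zero.mpr h)
      have h2 := hld x h (hx.trans (hr₁₂.trans hr20))
      have h3 : Real.log ‖x - x₀‖ < (-3 * N - κ) / 2 := by
        rw [Real.log_lt_iff_lt_exp hy]; exact hx
      have h4 : l x / N + 3 ≤ 0 := by
        have : l x ≤ -3 * N := by have := (abs_le.mp h2).2; linarith
        have : l x / N ≤ -3 := by rw [div_le_iff₀ hN0]; exact this
        linarith
      simp [hχ, h, hx.trans (hr₁₂.trans hr20), hF, Real.smoothTransition.zero_of_nonpos h4]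
  have hout : ∀ x, r₂ < ‖x - x₀‖ → χ x = 0 := by
    intro x hx
    have hy : 0 < ‖x - x₀‖ := hr₂0.trans hx
    have h : x ≠ x₀ := fun h => by simp [h] at hy
    by_cases hxr : ‖x - x₀‖ < r₀
    · have h2 := hld x h hxr
      have h3 : κ / 2 - N < Real.log ‖x - x₀‖ := by
        rw [Real.lt_log_iff_exp_lt hy]; exact hx
      have h4 : 1 ≤ l x / N + 3 := by
        have : -2 * N ≤ l x := by have := (abs_le.mp h2).1; linarith
        have : -2 ≤ l x / N := by rw [le_div_iff₀ hN0]; exact this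
        linarith
      simp [hχ, h, hxr, hF, Real.smoothTransition.one_of_one_le h4]
    · simp [hχ, h, hxr]
  have hmid : ∀ x, x ≠ x₀ → ‖x - x₀‖ < r₀ → χ =ᶠ[nhds x] fun y => F (l y) := by
    intro x hx hxr
    filter_upwards [eventually_ne_nhds hx, hnorm.continuousAt.eventually_lt_const hxr] with y h1 h2
    simp [hχ, h1, h2]
  have hin' : ∀ x, ‖x - x₀‖ < r₁ → χ =ᶠ[nhds x] fun _ => 1 := fun x hx => by
    filter_upwards [hnorm.continuousAt.eventually_lt_const hx] with y hy using hin y hy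
  have hout' : ∀ x, r₂ < ‖x - x₀‖ → χ =ᶠ[nhds x] fun _ => 0 := fun x hx => by
    filter_upwards [hnorm.continuousAt.eventually_const_lt hx] with y hy using hout y hy
  have hFc : ContDiff ℝ 2 F :=
    contDiff_const.sub (hST.comp ((contDiff_id.div_const N).add contDiff_const))
  have hχc : ContDiff ℝ 2 χ := by
    rw [contDiff_iff_contDiffAt]
    intro x
    rcases lt_or_ge ‖x - x₀‖ r₁ with h | h
    · exact contDiffAt_const.congr_of_eventuallyEq (hin' x h)
    · rcases lt_or_ge r₂ ‖x - x₀‖ with h' | h'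
      · exact contDiffAt_const.congr_of_eventuallyEq (hout' x h')
      · have hx : x ≠ x₀ := fun e => by simp [e] at h; linarith
        have hxr := h'.trans_lt hr20
        exact ((hFc.contDiffAt).comp x (hl x hx hxr).1).congr_of_eventuallyEq (hmid x hx hxr)
  have hsupp : tsupport χ ⊆ Metric.closedBall x₀ r₂ := by
    refine closure_minimal (fun x hx => ?_) Metric.isClosed_closedBall
    by_contra hn
    rw [Metric.mem_closedBall, dist_eq_norm, not_le] at hn
    exact hx (hout x hn)
  have hχ01 : ∀ x, 0 ≤ χ x ∧ χ x ≤ 1 := by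
    intro x
    have h1 := Real.smoothTransition.nonneg (l x / N + 3)
    have h2 := Real.smoothTransition.le_one (l x / N + 3)
    simp only [hχ, hF]
    split_ifs <;> constructor <;> linarith
  have hderF : ∀ r, HasDerivAt F (-(deriv Real.smoothTransition (r / N + 3) / N)) r := by
    intro r
    have h1 : HasDerivAt (fun r : ℝ => r / N + 3) (1 / N) r :=
      ((hasDerivAt_id r).div_const N).add_const 3
    have := (((hST.differentiable (by norm_num)) (r / N + 3)).hasDerivAt.comp r h1).const_sub 1
    refine this.congr_deriv ?_
    ring
  have hderF' : ∀ r, HasDerivAt (fun r => -(deriv Real.smoothTransition (r / N + 3) / N))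
      (-(deriv (deriv Real.smoothTransition) (r / N + 3) / N ^ 2)) r := by
    intro r
    have h1 : HasDerivAt (fun r : ℝ => r / N + 3) (1 / N) r :=
      ((hasDerivAt_id r).div_const N).add_const 3
    have := ((((hSTd.differentiable (by norm_num)) (r / N + 3)).hasDerivAt.comp r h1).div_const
      N).neg
    refine this.congr_deriv ?_
    field_simp
  refine ⟨χ, hχc, ?_, hχ01, fun x hx => (hsupp hx).trans_lt hr2ρ, ?_⟩
  · exact hin' x₀ (by simpa using hr₁0)
  have hpt : ∀ x, |LU u (fun y => χ y * φ y) x| ≤ Cb / N ^ 2 * annulusWeight r₁ r₂ ‖x - x₀‖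
      + B1 * (Metric.closedBall x₀ r₂).indicator (fun _ => (1 : ℝ)) x := by
    intro x
    have hwn : 0 ≤ annulusWeight r₁ r₂ ‖x - x₀‖ :=
      Set.indicator_nonneg (fun _ _ => by positivity) _
    have hin0 : 0 ≤ (Metric.closedBall x₀ r₂).indicator (fun _ => (1 : ℝ)) x :=
      Set.indicator_nonneg (fun _ _ => by positivity) _
    rcases lt_or_ge r₂ ‖x - x₀‖ with h' | h'
    · have : (fun y => χ y * φ y) =ᶠ[nhds x] fun _ => 0 := by
        filter_upwards [hout' x h'] with y hy
        simp [hy]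
      rw [LU_congr this, LU_eq]
      simp only [pd2_eq, D2]
      simp
      positivity
    have hmem : x ∈ Metric.closedBall x₀ r₂ := by rwa [Metric.mem_closedBall, dist_eq_norm]
    obtain ⟨k0, k1, k2, k3, k4, k5, k6, k7, -⟩ := hball (y := x)
      (by rw [dist_eq_norm]; exact h'.trans_lt hr23)
    have k5' : |LU u φ x| ≤ B1 := k5.trans ((le_max_left _ _).trans (le_max_right _ _))
    have k6' : |φ x| ≤ B1 := k6.trans ((le_max_right _ _).trans (le_max_right _ _))
    rw [Set.indicator_of_mem hmem, mul_one]
    rcases lt_or_ge ‖x - x₀‖ r₁ with h | h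
    · have : (fun y => χ y * φ y) =ᶠ[nhds x] φ := by
        filter_upwards [hin' x h] with y hy
        simp [hy]
      rw [LU_congr this]
      have : 0 ≤ Cb / N ^ 2 * annulusWeight r₁ r₂ ‖x - x₀‖ := by positivity
      linarith
    have k0' : |pd2 u x 0 0| ≤ B0 := k0.trans ((le_max_left _ _).trans (le_max_left _ _))
    have k1' : |pd2 u x 0 1| ≤ B0 := k1.trans ((le_max_right _ _).trans (le_max_left _ _))
    have k2' : |pd2 u x 1 1| ≤ B0 := k2.trans (le_max_right _ _)
    have k3' : |pd φ x 0| ≤ B1 := k3.trans ((le_max_left _ _).trans (le_max_left _ _))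
    have k4' : |pd φ x 1| ≤ B1 := k4.trans ((le_max_right _ _).trans (le_max_left _ _))
    have hx : x ≠ x₀ := fun e => by simp [e] at h; linarith
    have hxr := h'.trans_lt hr20
    obtain ⟨l1, -, l3, l4⟩ := hl x hx hxr
    have l2 := hld x hx hxr
    have hy : 0 < ‖x - x₀‖ := hr₁0.trans_le h
    rw [show annulusWeight r₁ r₂ ‖x - x₀‖ = (‖x - x₀‖ ^ 2)⁻¹ from
      Set.indicator_of_mem (show ‖x - x₀‖ ∈ Set.Icc r₁ r₂ from ⟨h, h'⟩) _]
    set y := ‖x - x₀‖ with hyd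
    have harg : l x / N + 3 ∈ Set.Icc (-2 * κ) (1 + 2 * κ) := by
      have h3 : (-3 * N - κ) / 2 ≤ Real.log y := by
        rw [Real.le_log_iff_exp_le hy]; exact h
      have h4 : Real.log y ≤ κ / 2 - N := by
        rw [Real.log_le_iff_le_exp hy]; exact h'
      obtain ⟨h5, h6⟩ := abs_le.mp l2
      constructor
      · have : -2 * κ - 3 ≤ l x / N := by rw [le_div_iff₀ hN0]; nlinarith
        linarith
      · have : l x / N ≤ 2 * κ - 2 := by rw [div_le_iff₀ hN0]; nlinarith
        linarith
    have hT1 : |deriv Real.smoothTransition (l x / N + 3)| ≤ B :=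
      (hB2 _ harg).trans ((le_max_left _ _).trans (le_max_left _ _))
    have hT2 : |deriv (deriv Real.smoothTransition) (l x / N + 3)| ≤ B :=
      (hB3 _ harg).trans ((le_max_right _ _).trans (le_max_left _ _))
    set T1 := deriv Real.smoothTransition (l x / N + 3)
    set T2 := deriv (deriv Real.smoothTransition) (l x / N + 3)
    have hyN : y ≤ 1 / N := h'.trans hNr'
    have hscale : 1 / (N * y) ≤ 1 / (N ^ 2 * y ^ 2) := by
      have : N * y ≤ 1 := by rw [le_div_iff₀ hN0] at hyN; linarith
      apply one_div_le_one_div_of_le (by positivity)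
      have hNy : 0 < N * y := by positivity
      nlinarith
    have hLχ : LU u χ x = -(T1 / N) * LU u l x + -(T2 / N ^ 2) * QU u l x := by
      rw [LU_congr (hmid x hx hxr)]
      exact LU_comp k7 l1 (Filter.Eventually.of_forall hderF) (hderF' _)
    have hpχ : ∀ i, pd χ x i = -(T1 / N) * pd l x i := by
      intro i
      rw [pd_congr (hmid x hx hxr)]
      have := (hderF (l x)).comp_hasFDerivAt x (l1.differentiableAt (by norm_num)).hasFDerivAt
      unfold pd
      erw [this.fderiv]
      simp
      exact Or.inl rfl
    have hQ : |QU u l x| ≤ 4 * B0 * C ^ 2 / y ^ 2 := by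
      refine (abs_quadratic_form_le k2' k1' k0').trans ?_
      have e : ∀ i, pd l x i ^ 2 ≤ (C / y) ^ 2 := fun i => by
        rw [← sq_abs (pd l x i)]; gcongr; exact l3 i
      calc 2 * B0 * (pd l x 0 ^ 2 + pd l x 1 ^ 2) ≤ 2 * B0 * ((C / y) ^ 2 + (C / y) ^ 2) := by
            exact mul_le_mul_of_nonneg_left (add_le_add (e 0) (e 1)) (by positivity)
        _ = _ := by field_simp; ring
    have hLχ' : |LU u χ x| ≤ B * (C + 4 * B0 * C ^ 2) * (1 / (N ^ 2 * y ^ 2)) := by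
      rw [hLχ]
      calc _ ≤ |-(T1 / N) * LU u l x| + |-(T2 / N ^ 2) * QU u l x| := abs_add_le _ _
        _ = |T1| / N * |LU u l x| + |T2| / N ^ 2 * |QU u l x| := by
          rw [abs_mul, abs_mul, abs_neg, abs_neg, abs_div, abs_div, abs_of_pos hN0,
            abs_of_pos (pow_pos hN0 2)]
        _ ≤ B / N * (C / y) + B / N ^ 2 * (4 * B0 * C ^ 2 / y ^ 2) := by gcongr
        _ = B * C * (1 / (N * y)) + B * (4 * B0 * C ^ 2) * (1 / (N ^ 2 * y ^ 2)) := by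
          field_simp
        _ ≤ B * C * (1 / (N ^ 2 * y ^ 2)) + B * (4 * B0 * C ^ 2) * (1 / (N ^ 2 * y ^ 2)) := by
          gcongr
        _ = _ := by ring
    have hpχ' : ∀ i, |pd χ x i| ≤ B * C * (1 / (N ^ 2 * y ^ 2)) := by
      intro i
      rw [hpχ, abs_mul, abs_neg, abs_div, abs_of_pos hN0]
      calc |T1| / N * |pd l x i| ≤ B / N * (C / y) := by gcongr; exact l3 i
        _ = B * C * (1 / (N * y)) := by field_simp
        _ ≤ _ := by gcongr
    set P := B * C * (1 / (N ^ 2 * y ^ 2)) with hP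
    have hcross : |pd2 u x 1 1 * (pd χ x 0 * pd φ x 0) - pd2 u x 0 1 * (pd χ x 0 * pd φ x 1
        + pd χ x 1 * pd φ x 0) + pd2 u x 0 0 * (pd χ x 1 * pd φ x 1)| ≤ 4 * (B0 * (P * B1)) := by
      have m : ∀ a b c : ℝ, |a| ≤ B0 → |b| ≤ P → |c| ≤ B1 → |a * (b * c)| ≤ B0 * (P * B1) := by
        intro a b c ha hb hc
        rw [abs_mul, abs_mul]
        have := (abs_nonneg b).trans hb
        gcongr
      have m1 := m _ _ _ k2' (hpχ' 0) k3'
      have m2 := m _ _ _ k1' (hpχ' 0) k4'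
      have m3 := m _ _ _ k1' (hpχ' 1) k3'
      have m4 := m _ _ _ k0' (hpχ' 1) k4'
      rw [abs_le] at m1 m2 m3 m4 ⊢
      constructor <;> linarith [m1.1, m1.2, m2.1, m2.2, m3.1, m3.2, m4.1, m4.2]
    rw [LU_mul k7 hχc.contDiffAt hφ.contDiffAt]
    set X := pd2 u x 1 1 * (pd χ x 0 * pd φ x 0) - pd2 u x 0 1 * (pd χ x 0 * pd φ x 1
        + pd χ x 1 * pd φ x 0) + pd2 u x 0 0 * (pd χ x 1 * pd φ x 1)
    calc |LU u χ x * φ x + χ x * LU u φ x + 2 * X|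
        ≤ |LU u χ x * φ x + χ x * LU u φ x| + |2 * X| := abs_add_le _ _
      _ ≤ |LU u χ x * φ x| + |χ x * LU u φ x| + |2 * X| := by gcongr; exact abs_add_le _ _
      _ = |LU u χ x| * |φ x| + χ x * |LU u φ x| + 2 * |X| := by
        rw [abs_mul, abs_mul, abs_mul, abs_two, abs_of_nonneg (hχ01 x).1]
      _ ≤ B * (C + 4 * B0 * C ^ 2) * (1 / (N ^ 2 * y ^ 2)) * B1 + 1 * B1
          + 2 * (4 * (B0 * (P * B1))) := by
        gcongr
        exact (hχ01 x).2
      _ = _ := by rw [hCb, hP]; field_simp; ring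
  obtain ⟨w1, w2⟩ := annulusWeight_integral hr₁0 hr₁₂.le x₀
  have hmeas : MeasurableSet (Metric.closedBall x₀ r₂) := Metric.isClosed_closedBall.measurableSet
  have hfin : volume (Metric.closedBall x₀ r₂) ≠ ⊤ := measure_closedBall_lt_top.ne
  have w3 : Integrable ((Metric.closedBall x₀ r₂).indicator (fun _ => (1 : ℝ))) :=
    (integrable_indicator_iff hmeas).mpr (integrableOn_const hfin)
  have w4 : ∫ x, (Metric.closedBall x₀ r₂).indicator (fun _ => (1 : ℝ)) x = r₂ ^ 2 * vb := by
    rw [integral_indicator hmeas, setIntegral_const, smul_eq_mul, mul_one,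
      Measure.addHaar_real_closedBall _ _ hr₂0.le]
    simp [hvb]
  calc ∫ x, |LU u (fun y => χ y * φ y) x| ≤ ∫ x, (Cb / N ^ 2 * annulusWeight r₁ r₂ ‖x - x₀‖
      + B1 * (Metric.closedBall x₀ r₂).indicator (fun _ => (1 : ℝ)) x) := by
        apply integral_mono_of_nonneg (Filter.Eventually.of_forall fun x => abs_nonneg _)
          ((w1.const_mul _).add (w3.const_mul _)) (Filter.Eventually.of_forall hpt)
    _ = Cb / N ^ 2 * (2 * (vb * ((N + 2 * κ) / 2))) + B1 * (r₂ ^ 2 * vb) := by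
        rw [integral_add (w1.const_mul _) (w3.const_mul _), integral_const_mul,
          integral_const_mul, w2, w4, hlog]
    _ ≤ Cb / N ^ 2 * (2 * (vb * ((N + 2 * κ) / 2))) + B1 * ((1 / N) ^ 2 * vb) := by gcongr
    _ ≤ ε := hNε

end Cutoff

/-- `g` is a positive solution of the linearized equation in `V`, punctured at `x₀`. -/
structure PunctureSol (u g : E 2 → ℝ) (V : Set (E 2)) (x₀ : E 2) : Prop where
  isOpen : IsOpen V
  mem : x₀ ∈ V
  smooth : ∀ x ∈ V, ContDiffAt ℝ 3 u x
  psd : ∀ x ∈ V, ∀ v, 0 ≤ D2 u x v v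
  det_pos : ∀ x ∈ V, 0 < (Hess u x).det
  pos : ∀ x ∈ V \ {x₀}, 0 < g x
  smooth_sol : ∀ x ∈ V \ {x₀}, ContDiffAt ℝ 2 g x
  harmonic : ∀ x ∈ V \ {x₀}, LU u g x = 0

lemma contDiff_two_of_hasDerivAt {R R' f : ℝ → ℝ} (hR : ∀ r, HasDerivAt R (R' r) r)
    (hR' : ∀ r, HasDerivAt R' (f r) r) (hf : Continuous f) : ContDiff ℝ 2 R := by
  have h1 : deriv R = R' := funext fun r => (hR r).deriv
  have h2 : deriv R' = f := funext fun r => (hR' r).deriv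
  have : ContDiff ℝ (1 + 1) R := by
    refine contDiff_succ_iff_deriv.2 ⟨fun r => (hR r).differentiableAt, by simp, ?_⟩
    rw [h1]
    exact contDiff_one_iff_deriv.2 ⟨fun r => (hR' r).differentiableAt, by rwa [h2]⟩
  exact_mod_cast this

section

variable {u g : E 2 → ℝ} {V : Set (E 2)} {x₀ : E 2}

lemma PunctureSol.aestronglyMeasurable_comp (P : PunctureSol u g V x₀) {R : ℝ → ℝ}
    (hR : Continuous R) : AEStronglyMeasurable (fun x => R (g x)) (volume.restrict V) := by
  have h0 : (V \ {x₀} : Set (E 2)) =ᵐ[volume] V :=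
    sdiff_null_ae_eq_self (measure_singleton x₀)
  rw [← Measure.restrict_congr_set h0]
  refine ContinuousOn.aestronglyMeasurable ?_ (P.isOpen.measurableSet.diff (measurableSet_singleton _))
  intro x hx
  exact (hR.continuousAt.comp (P.smooth_sol x hx).continuousAt).continuousWithinAt

lemma PunctureSol.ae_ne (x₀ : E 2) : ∀ᵐ x ∂(volume.restrict V), x ≠ x₀ := by
  refine ae_restrict_of_ae ?_
  exact Measure.ae_ne volume x₀

lemma PunctureSol.energy_le (P : PunctureSol u g V x₀) {R R' f : ℝ → ℝ} {M : ℝ}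
    (hR : ∀ r, HasDerivAt R (R' r) r) (hR' : ∀ r, HasDerivAt R' (-f r) r)
    (hfc : Continuous f) (hf : ∀ r, 0 ≤ f r) (hM : ∀ r, 0 < r → |R r| ≤ M)
    {φ : E 2 → ℝ} (hφ : ContDiff ℝ 2 φ) (hφ0 : ∀ x, 0 ≤ φ x) (hc : HasCompactSupport φ)
    (hs : tsupport φ ⊆ V) {A : Set (E 2)} (hA : MeasurableSet A) {ρ : ℝ}
    (hρ : 0 < ρ) (hAρ : Disjoint A (Metric.ball x₀ ρ)) :
    IntegrableOn (fun x => φ x * (f (g x) * QU u g x)) A ∧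
    IntegrableOn (fun x => R (g x) * LU u φ x) V ∧
    ∫ x in A, φ x * (f (g x) * QU u g x) ≤ - ∫ x in V, R (g x) * LU u φ x := by
  have hRc : ContDiff ℝ 2 R := contDiff_two_of_hasDerivAt hR hR' hfc.neg
  have hM0 : 0 ≤ M := (abs_nonneg _).trans (hM 1 one_pos)
  have key : ∀ ε : ℝ, 0 < ε → IntegrableOn (fun x => φ x * (f (g x) * QU u g x)) A ∧
      IntegrableOn (fun x => R (g x) * LU u φ x) V ∧
      ∫ x in A, φ x * (f (g x) * QU u g x) ≤ - (∫ x in V, R (g x) * LU u φ x) + M * ε := by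
    intro ε hε
    obtain ⟨χ, hχ, hχ1, hχ01, hχs, hχε⟩ := exists_cutoff (P.smooth x₀ P.mem) (P.psd x₀ P.mem)
      (P.det_pos x₀ P.mem) hφ hε hρ
    have hχφ : ContDiff ℝ 2 (fun y => χ y * φ y) := hχ.mul hφ
    set ψ : E 2 → ℝ := fun y => φ y - χ y * φ y with hψdef
    have hψ : ContDiff ℝ 2 ψ := hφ.sub hχφ
    have hψφ : tsupport ψ ⊆ tsupport φ := by
      refine closure_mono fun x hx => ?_
      simp only [Function.mem_support, hψdef] at hx ⊢
      intro h; apply hx; simp [h]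
    have hχφs : tsupport (fun y => χ y * φ y) ⊆ tsupport φ :=
      tsupport_mul_subset_right (f := χ) (g := φ)
    have hψ0 : x₀ ∉ tsupport ψ := by
      rw [notMem_tsupport_iff_eventuallyEq]
      filter_upwards [hχ1] with x hx
      simp [hψdef, hx]
    have hsub : ∀ x ∈ tsupport ψ, x ∈ V \ {x₀} := fun x hx =>
      ⟨hs (hψφ hx), fun h => hψ0 (h ▸ hx)⟩
    have hψc : HasCompactSupport ψ := hc.of_isClosed_subset (isClosed_tsupport _) hψφ
    obtain ⟨I1, I2, I3⟩ := green_identity (u := u) (w := fun x => R (g x)) (ψ := ψ)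
      (fun x hx => P.smooth x (hsub x hx).1)
      (fun x hx => (hRc.contDiffAt).comp x (P.smooth_sol x (hsub x hx))) hψ hψc
    have hLw : (fun x => ψ x * LU u (fun y => R (g y)) x)
        = fun x => -(ψ x * (f (g x) * QU u g x)) := by
      funext x
      by_cases hx : x ∈ tsupport ψ
      · have := hsub x hx
        rw [LU_comp ((P.smooth x this.1).of_le (by norm_num)) (P.smooth_sol x this)
          (Filter.Eventually.of_forall hR) (hR' _), P.harmonic x this]
        ring
      · rw [image_eq_zero_of_notMem_tsupport hx]; ring
    rw [hLw] at I2 I3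
    have I2' : Integrable (fun x => ψ x * (f (g x) * QU u g x)) := by simpa using I2.neg
    have hnn : ∀ x, 0 ≤ ψ x * (f (g x) * QU u g x) := by
      intro x
      by_cases hx : x ∈ tsupport ψ
      · have h1 : 0 ≤ ψ x := by
          have := mul_nonneg (sub_nonneg.2 (hχ01 x).2) (hφ0 x)
          simp only [hψdef]; linarith
        exact mul_nonneg h1 (mul_nonneg (hf _)
          (QU_nonneg g ((P.smooth x (hsub x hx).1).of_le (by norm_num)) (P.psd x (hsub x hx).1)))
      · rw [image_eq_zero_of_notMem_tsupport hx]; simp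
    have hAeq : Set.EqOn (fun x => ψ x * (f (g x) * QU u g x))
        (fun x => φ x * (f (g x) * QU u g x)) A := by
      intro x hx
      have : χ x = 0 := image_eq_zero_of_notMem_tsupport fun h =>
        Set.disjoint_left.1 hAρ hx (hχs h)
      simp [hψdef, this]
    have J1 : IntegrableOn (fun x => φ x * (f (g x) * QU u g x)) A :=
      (I2'.integrableOn).congr_fun hAeq hA
    obtain ⟨I4, -, -⟩ := green_identity (u := u) (w := fun _ => 1) (ψ := fun y => χ y * φ y)
      (fun x hx => P.smooth x (hs (hχφs hx))) (fun x _ => contDiffAt_const) hχφ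
      (hc.of_isClosed_subset (isClosed_tsupport _) hχφs)
    simp only [one_mul] at I4
    have hbd : ∀ᵐ x ∂(volume.restrict V), ‖R (g x)‖ ≤ M := by
      filter_upwards [PunctureSol.ae_ne (V := V) x₀, ae_restrict_mem P.isOpen.measurableSet]
        with x hx hxV
      exact hM _ (P.pos x ⟨hxV, hx⟩)
    have I5 : IntegrableOn (fun x => R (g x) * LU u (fun y => χ y * φ y) x) V :=
      (I4.integrableOn (s := V)).bdd_mul (P.aestronglyMeasurable_comp hRc.continuous) hbd
    have hadd : (fun x => R (g x) * LU u φ x) =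
        fun x => R (g x) * LU u ψ x + R (g x) * LU u (fun y => χ y * φ y) x := by
      funext x
      have := LU_sub (u := u) (x := x) hφ.contDiffAt hχφ.contDiffAt
      simp only [hψdef]
      rw [this]; ring
    have J2 : IntegrableOn (fun x => R (g x) * LU u φ x) V := by
      rw [hadd]; exact I1.integrableOn.add I5
    refine ⟨J1, J2, ?_⟩
    have E1 : ∫ x in A, φ x * (f (g x) * QU u g x) ≤ ∫ x, ψ x * (f (g x) * QU u g x) := by
      rw [← setIntegral_congr_fun hA hAeq]
      exact setIntegral_le_integral I2' (Filter.Eventually.of_forall hnn)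
    have E2 : ∫ x in V, R (g x) * LU u ψ x = ∫ x, R (g x) * LU u ψ x := by
      refine setIntegral_eq_integral_of_forall_compl_eq_zero fun x hx => ?_
      rw [LU_of_notMem_tsupport fun h => hx (hs (hψφ h)), mul_zero]
    have E3 : ∫ x in V, R (g x) * LU u φ x = (∫ x in V, R (g x) * LU u ψ x)
        + ∫ x in V, R (g x) * LU u (fun y => χ y * φ y) x := by
      rw [hadd]; exact integral_add I1.integrableOn I5
    have E4 : ∫ x in V, R (g x) * LU u (fun y => χ y * φ y) x ≤ M * ε := by
      calc _ ≤ ∫ x in V, M * |LU u (fun y => χ y * φ y) x| := by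
            refine integral_mono_ae I5 ((I4.abs.const_mul M).integrableOn) ?_
            filter_upwards [hbd] with x hx
            refine (le_abs_self _).trans ?_
            rw [abs_mul]
            exact mul_le_mul_of_nonneg_right hx (abs_nonneg _)
        _ ≤ ∫ x, M * |LU u (fun y => χ y * φ y) x| :=
            setIntegral_le_integral (I4.abs.const_mul M)
              (Filter.Eventually.of_forall fun x => mul_nonneg hM0 (abs_nonneg _))
        _ ≤ M * ε := by
            rw [integral_const_mul]; exact mul_le_mul_of_nonneg_left hχε hM0
    rw [integral_neg] at I3
    linarith
  refine ⟨(key 1 one_pos).1, (key 1 one_pos).2.1, le_of_forall_pos_le_add fun ε hε => ?_⟩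
  refine (key (ε / (M + 1)) (by positivity)).2.2.trans ?_
  have : M * (ε / (M + 1)) ≤ ε := by
    rw [mul_div_assoc', div_le_iff₀ (by positivity)]; nlinarith
  linarith

end

/-- A twice integrated bump: `h' = f` and `H' = h`, where `f` is supported in `[k, k₂]`. -/
structure Profile (k k₂ : ℝ) (f h H : ℝ → ℝ) (hI M : ℝ) : Prop where
  cont : Continuous f
  nonneg : ∀ r, 0 ≤ f r
  le_one : ∀ r, f r ≤ 1
  deriv_h : ∀ r, HasDerivAt h (f r) r
  deriv_H : ∀ r, HasDerivAt H (h r) r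
  f_eq : ∀ r, r ≤ k → f r = 0
  h_eq : ∀ r, r ≤ k → h r = 0
  H_eq : ∀ r, r ≤ k → H r = 0
  h_eq' : ∀ r, k₂ ≤ r → h r = hI
  h_nonneg : ∀ r, 0 ≤ h r
  h_le : ∀ r, h r ≤ hI
  sq_le : ∀ r, h r ^ 2 ≤ 2 * H r
  bdd : ∀ r, 0 < r → |hI * r - H r| ≤ M
  le_hI : (k₂ - k) / 2 ≤ hI

lemma exists_profile {k k₂ : ℝ} (hk : 0 ≤ k) (hkk : k < k₂) :
    ∃ f h H hI M, Profile k k₂ f h H hI M := by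
  have hd : 0 < k₂ - k := sub_pos.2 hkk
  set f : ℝ → ℝ := fun r => 4 / (k₂ - k) ^ 2 * max 0 ((r - k) * (k₂ - r)) with hf
  set h : ℝ → ℝ := fun r => ∫ s in k..r, f s with hh
  set H : ℝ → ℝ := fun r => ∫ s in k..r, h s with hH
  have fc : Continuous f := by fun_prop
  have f0 : ∀ r, 0 ≤ f r := fun r => by positivity
  have f1 : ∀ r, f r ≤ 1 := by
    intro r
    simp only [hf]
    rw [div_mul_eq_mul_div, div_le_one (by positivity)]
    rcases max_choice 0 ((r - k) * (k₂ - r)) with h1 | h1 <;> rw [h1]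
    · simpa using sq_nonneg (k₂ - k)
    · nlinarith [sq_nonneg (r - k - (k₂ - r))]
  have fz : ∀ r, r ≤ k ∨ k₂ ≤ r → f r = 0 := by
    intro r hr
    have : (r - k) * (k₂ - r) ≤ 0 := by
      rcases hr with hr | hr
      · exact mul_nonpos_of_nonpos_of_nonneg (by linarith) (by linarith)
      · exact mul_nonpos_of_nonneg_of_nonpos (by linarith) (by linarith)
    simp only [hf, max_eq_left this, mul_zero]
  have dh : ∀ r, HasDerivAt h (f r) r := fun r => (fc.integral_hasStrictDerivAt k r).hasDerivAt
  have hc : Continuous h := continuous_iff_continuousAt.2 fun r => (dh r).continuousAt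
  have dH : ∀ r, HasDerivAt H (h r) r := fun r => (hc.integral_hasStrictDerivAt k r).hasDerivAt
  have hm : Monotone h := monotone_of_hasDerivAt_nonneg dh f0
  have hz : ∀ r, r ≤ k → h r = 0 := by
    intro r hr
    simp only [hh]
    rw [intervalIntegral.integral_congr (g := fun _ => (0 : ℝ))]
    · simp
    · intro s hs
      rw [Set.uIcc_of_ge hr] at hs
      exact fz s (Or.inl hs.2)
  have Hz : ∀ r, r ≤ k → H r = 0 := by
    intro r hr
    simp only [hH]
    rw [intervalIntegral.integral_congr (g := fun _ => (0 : ℝ))]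
    · simp
    · intro s hs
      rw [Set.uIcc_of_ge hr] at hs
      exact hz s hs.2
  have h0 : ∀ r, 0 ≤ h r := by
    intro r
    rcases le_total r k with hr | hr
    · rw [hz r hr]
    · rw [← hz k le_rfl]; exact hm hr
  have hI : ∀ r, k₂ ≤ r → h r = h k₂ := by
    intro r hr
    have : h r = h k₂ + ∫ s in k₂..r, f s :=
      (intervalIntegral.integral_add_adjacent_intervals (fc.intervalIntegrable _ _)
        (fc.intervalIntegrable _ _)).symm
    rw [this, intervalIntegral.integral_congr (g := fun _ => (0 : ℝ))]
    · simp
    · intro s hs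
      rw [Set.uIcc_of_le hr] at hs
      exact fz s (Or.inr hs.1)
  have hle : ∀ r, h r ≤ h k₂ := by
    intro r
    rcases le_total r k₂ with hr | hr
    · exact hm hr
    · rw [hI r hr]
  have hsq : ∀ r, h r ^ 2 ≤ 2 * H r := by
    intro r
    have hmono : Monotone fun r => 2 * H r - h r ^ 2 := by
      refine monotone_of_hasDerivAt_nonneg (f' := fun r => 2 * h r - 2 * h r * f r)
        (fun r => ?_) fun r => ?_
      · simpa using ((dH r).const_mul 2).fun_sub ((dh r).fun_pow 2)
      · have := mul_nonneg (h0 r) (sub_nonneg.2 (f1 r))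
        simp only [Pi.zero_apply]; linarith
    rcases le_total r k with hr | hr
    · rw [hz r hr, Hz r hr]; simp
    · have := hmono hr
      simp only [hz k le_rfl, Hz k le_rfl] at this
      linarith
  have hRm : Monotone fun r => h k₂ * r - H r := by
    refine monotone_of_hasDerivAt_nonneg (f' := fun r => h k₂ - h r) (fun r => ?_)
      fun r => sub_nonneg.2 (hle r)
    simpa using ((hasDerivAt_id r).const_mul (h k₂)).fun_sub (dH r)
  have hRc : ∀ r, k₂ ≤ r → h k₂ * r - H r = h k₂ * k₂ - H k₂ := by
    intro r hr
    have : H r = H k₂ + ∫ s in k₂..r, h s :=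
      (intervalIntegral.integral_add_adjacent_intervals (hc.intervalIntegrable _ _)
        (hc.intervalIntegrable _ _)).symm
    rw [this, intervalIntegral.integral_congr (g := fun _ => h k₂)]
    · simp; ring
    · intro s hs
      rw [Set.uIcc_of_le hr] at hs
      exact hI s hs.1
  have hval : h k₂ = 2 / 3 * (k₂ - k) := by
    have e1 : h k₂ = ∫ s in k..k₂, 4 / (k₂ - k) ^ 2 * ((s - k) * (k₂ - s)) := by
      refine intervalIntegral.integral_congr fun s hs => ?_
      rw [Set.uIcc_of_le hkk.le] at hs
      simp only [hf]
      rw [max_eq_right (mul_nonneg (by linarith [hs.1]) (by linarith [hs.2]))]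
    rw [e1, intervalIntegral.integral_eq_sub_of_hasDerivAt
      (f := fun s => 4 / (k₂ - k) ^ 2 * ((k₂ - k) * (s - k) ^ 2 / 2 - (s - k) ^ 3 / 3))]
    · field_simp
      ring
    · intro s _
      have h1 : HasDerivAt (fun s : ℝ => s - k) 1 s := (hasDerivAt_id s).sub_const k
      have := (((h1.fun_pow 2).const_mul (k₂ - k)).div_const 2).fun_sub ((h1.fun_pow 3).div_const 3)
      refine (this.const_mul (4 / (k₂ - k) ^ 2)).congr_deriv ?_
      push_cast; ring
    · exact (by fun_prop : Continuous fun s => 4 / (k₂ - k) ^ 2 * ((s - k) * (k₂ - s))).intervalIntegrable _ _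
  refine ⟨f, h, H, h k₂, h k₂ * k₂ - H k₂, fc, f0, f1, dh, dH, fun r hr => fz r (Or.inl hr), hz, Hz,
    hI, h0, hle, hsq, fun r hr => ?_, by linarith⟩
  have e0 : 0 ≤ h k₂ * r - H r := by
    have := hRm hr.le
    simpa [Hz 0 hk] using this
  rw [abs_of_nonneg e0]
  rcases le_total r k₂ with hr' | hr'
  · exact hRm hr'
  · exact (hRc r hr').le

lemma exists_smooth_cutoff {K W : Set (E 2)} (hK : IsCompact K) (hW : IsOpen W) (hKW : K ⊆ W) :
    ∃ ζ : E 2 → ℝ, ContDiff ℝ (⊤ : ℕ∞) ζ ∧ HasCompactSupport ζ ∧ tsupport ζ ⊆ W ∧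
      (∀ x, 0 ≤ ζ x ∧ ζ x ≤ 1) ∧ ∀ x ∈ K, ζ x = 1 := by
  obtain ⟨L, hL, hKL, hLW⟩ := exists_compact_between hK hW hKW
  obtain ⟨ζ, h0, h1, h01⟩ := exists_contMDiffMap_zero_one_of_isClosed (n := (⊤ : ℕ∞))
    (modelWithCornersSelf ℝ (E 2)) (s := (interior L)ᶜ) (t := K) isOpen_interior.isClosed_compl
    hK.isClosed (Set.disjoint_left.2 fun x hx hxK => hx (hKL hxK))
  have hs : tsupport ζ ⊆ L := by
    refine closure_minimal (fun x hx => ?_) hL.isClosed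
    by_contra hxL
    exact hx (h0 fun h => hxL (interior_subset h))
  exact ⟨ζ, ζ.contMDiff.contDiff, hL.of_isClosed_subset (isClosed_tsupport _) hs, hs.trans hLW,
    h01, fun x hx => h1 hx⟩

/-- A Green's function with pole `x₀`, together with the regularity of the potential, normalized
by `u x₀ = 0`. -/
structure GreenData (u g : E 2 → ℝ) (V : Set (E 2)) (x₀ : E 2) (lam : ℝ) : Prop where
  isOpen : IsOpen V
  bounded : Bornology.IsBounded V
  mem : x₀ ∈ V
  smooth : ∀ x ∈ V, ContDiffAt ℝ (⊤ : ℕ∞) u x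
  psd : ∀ x ∈ V, ∀ v, 0 ≤ D2 u x v v
  lam_pos : 0 < lam
  le_det : ∀ x ∈ V, lam ≤ (Hess u x).det
  u_pole : u x₀ = 0
  green : IsGreen u V x₀ g

lemma LU_const (u : E 2 → ℝ) (c : ℝ) (x : E 2) : LU u (fun _ => c) x = 0 := by
  simp [LU_eq, pd2]

section

variable {u g : E 2 → ℝ} {V : Set (E 2)} {x₀ : E 2} {lam : ℝ}

lemma GreenData.punctureSol (G : GreenData u g V x₀ lam) : PunctureSol u g V x₀ where
  isOpen := G.isOpen
  mem := G.mem
  smooth x hx := (G.smooth x hx).of_le (by norm_cast)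
  psd := G.psd
  det_pos x hx := G.lam_pos.trans_le (G.le_det x hx)
  pos := G.green.1
  smooth_sol x hx := (G.green.2.1.contDiffAt
    ((G.isOpen.sdiff isClosed_singleton).mem_nhds hx)).of_le (by norm_cast)
  harmonic := G.green.2.2.1

lemma GreenData.integral_eq (G : GreenData u g V x₀ lam) {φ : E 2 → ℝ}
    (hφ : ContDiff ℝ (⊤ : ℕ∞) φ) (hc : HasCompactSupport φ) (hs : tsupport φ ⊆ V) :
    ∫ x in V, g x * LU u φ x = -φ x₀ :=
  G.green.2.2.2.2.2 φ hφ hc hs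

lemma GreenData.isCompact_superlevel (G : GreenData u g V x₀ lam) (k : ℝ) :
    IsCompact {x ∈ closure V | x = x₀ ∨ k ≤ g x} := by
  refine G.bounded.isCompact_closure.of_isClosed_subset ?_ fun x hx => hx.1
  refine isClosed_of_closure_subset fun x hx => ?_
  have hxV : x ∈ closure V := by
    have := closure_mono (fun y (hy : y ∈ {x ∈ closure V | x = x₀ ∨ k ≤ g x}) => hy.1) hx
    rwa [closure_closure] at this
  refine ⟨hxV, ?_⟩
  by_cases hx0 : x = x₀
  · exact Or.inl hx0
  refine Or.inr ?_
  obtain ⟨y, hy, hlim⟩ := mem_closure_iff_seq_limit.1 hx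
  have hne : ∀ᶠ n in Filter.atTop, y n ≠ x₀ := hlim.eventually_ne hx0
  have hg := G.green.2.2.2.1 x ⟨hxV, hx0⟩
  have hlim' : Filter.Tendsto y Filter.atTop (nhdsWithin x (closure V \ {x₀})) := by
    refine tendsto_nhdsWithin_iff.2 ⟨hlim, ?_⟩
    filter_upwards [hne] with n hn
    exact ⟨(hy n).1, hn⟩
  refine ge_of_tendsto (hg.tendsto.comp hlim') ?_
  filter_upwards [hne] with n hn
  exact (hy n).2.resolve_left hn

lemma GreenData.energy_bounds (G : GreenData u g V x₀ lam) {k₁ s₁ k₂ hI M : ℝ}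
    {f h H : ℝ → ℝ} (hk₁ : 0 ≤ k₁) (hs₁ : 0 < s₁) (hle : ∀ x ∈ V, s₁ ≤ u x → g x ≤ k₁)
    (hk₂ : k₁ + 1 < k₂) (P : Profile (k₁ + 1) k₂ f h H hI M) :
    (∀ A : Set (E 2), MeasurableSet A → A ⊆ V → ∀ ρ > 0, Disjoint A (Metric.ball x₀ ρ) →
      IntegrableOn (fun x => f (g x) * QU u g x) A ∧ ∫ x in A, f (g x) * QU u g x ≤ hI) ∧
    IntegrableOn (fun x => h (g x) ^ 2) V ∧ lam * ∫ x in V, h (g x) ^ 2 ≤ hI * s₁ := by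
  have Q := G.punctureSol
  have hI0 : 0 < hI := by linarith [P.le_hI]
  set W : Set (E 2) := V ∩ {x | u x < s₁} with hWdef
  have hW : IsOpen W := by
    have hc : ContinuousOn u V := fun x hx => (G.smooth x hx).continuousAt.continuousWithinAt
    exact hc.isOpen_inter_preimage G.isOpen isOpen_Iio
  have hx₀W : x₀ ∈ W := ⟨G.mem, by simpa [G.u_pole] using hs₁⟩
  have hKW : {x ∈ closure V | x = x₀ ∨ k₁ + 1 ≤ g x} ⊆ W := by
    rintro x ⟨hxV, hx | hx⟩
    · rwa [hx]
    · have hV : x ∈ V := by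
        by_contra hV
        have := G.green.2.2.2.2.1 x (by rw [G.isOpen.frontier_eq]; exact ⟨hxV, hV⟩)
        linarith
      refine ⟨hV, ?_⟩
      by_contra hu
      have := hle x hV (not_lt.1 hu)
      linarith
  obtain ⟨ζ, hζ, hζc, hζs, hζ01, hζ1⟩ := exists_smooth_cutoff (G.isCompact_superlevel (k₁ + 1)) hW hKW
  have hζV : tsupport ζ ⊆ V := hζs.trans Set.inter_subset_left
  have hζx₀ : ζ x₀ = 1 := hζ1 x₀ ⟨subset_closure G.mem, Or.inl rfl⟩
  have hζev : ∀ x ∈ V, x ≠ x₀ → k₁ + 1 < g x → ∀ᶠ y in nhds x, ζ y = 1 := by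
    intro x hx hx0 hgx
    have hgc := (Q.smooth_sol x ⟨hx, hx0⟩).continuousAt
    filter_upwards [hgc.eventually (lt_mem_nhds hgx), G.isOpen.mem_nhds hx] with y hy hyV
    exact hζ1 y ⟨subset_closure hyV, Or.inr hy.le⟩
  have hR : ∀ r, HasDerivAt (fun r => hI * r - H r) (hI - h r) r := fun r => by
    simpa using ((hasDerivAt_id r).const_mul hI).fun_sub (P.deriv_H r)
  have hR' : ∀ r, HasDerivAt (fun r => hI - h r) (-f r) r := fun r => by
    simpa using (hasDerivAt_const r hI).fun_sub (P.deriv_h r)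
  have hle2 : (2 : WithTop ℕ∞) ≤ ((⊤ : ℕ∞) : WithTop ℕ∞) := by norm_cast
  constructor
  · intro A hA hAV ρ hρ hAρ
    obtain ⟨I1, I2, I3⟩ := Q.energy_le hR hR' P.cont P.nonneg P.bdd (hζ.of_le hle2)
      (fun x => (hζ01 x).1) hζc hζV hA hρ hAρ
    have hcongr : Set.EqOn (fun x => ζ x * (f (g x) * QU u g x))
        (fun x => f (g x) * QU u g x) A := by
      intro x hx
      have hx0 : x ≠ x₀ := fun h => Set.disjoint_left.1 hAρ hx (h ▸ Metric.mem_ball_self hρ)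
      rcases le_or_gt (g x) (k₁ + 1) with hgx | hgx
      · simp [P.f_eq _ hgx]
      · simp [(hζev x (hAV hx) hx0 hgx).self_of_nhds]
    refine ⟨I1.congr_fun hcongr hA, ?_⟩
    rw [← setIntegral_congr_fun hA hcongr]
    refine I3.trans ?_
    have e1 : ∫ x in V, (hI * g x - H (g x)) * LU u ζ x = ∫ x in V, hI * (g x * LU u ζ x) := by
      refine setIntegral_congr_ae G.isOpen.measurableSet ?_
      filter_upwards [Measure.ae_ne volume x₀] with x hx hxV
      rcases le_or_gt (g x) (k₁ + 1) with hgx | hgx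
      · rw [P.H_eq _ hgx]; ring
      · have : LU u ζ x = 0 := by
          rw [LU_congr (hζev x hxV hx hgx), LU_const]
        rw [this]; ring
    rw [e1, integral_const_mul, G.integral_eq hζ hζc hζV, hζx₀]
    linarith
  · set φ : E 2 → ℝ := fun x => ζ x * (s₁ - u x) with hφdef
    have hφs : tsupport φ ⊆ tsupport ζ := tsupport_mul_subset_left (f := ζ)
    have hφ : ContDiff ℝ (⊤ : ℕ∞) φ := by
      refine contDiff_of_tsupport_subset (hφs.trans hζV) fun x hx => ?_
      exact hζ.contDiffAt.mul (contDiffAt_const.sub (G.smooth x hx))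
    have hφc : HasCompactSupport φ := hζc.of_isClosed_subset (isClosed_tsupport _) hφs
    have hφ0 : ∀ x, 0 ≤ φ x := by
      intro x
      by_cases hx : x ∈ tsupport ζ
      · exact mul_nonneg (hζ01 x).1 (sub_nonneg.2 (hζs hx).2.le)
      · simp [hφdef, image_eq_zero_of_notMem_tsupport hx]
    obtain ⟨-, I2, I3⟩ := Q.energy_le hR hR' P.cont P.nonneg P.bdd (hφ.of_le hle2)
      hφ0 hφc (hφs.trans hζV) MeasurableSet.empty one_pos (Set.empty_disjoint _)
    simp only [Measure.restrict_empty, integral_zero_measure] at I3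
    have hgφ := G.integral_eq hφ hφc (hφs.trans hζV)
    have hφx₀ : φ x₀ = s₁ := by simp [hφdef, hζx₀, G.u_pole]
    rw [hφx₀] at hgφ
    have I4 : IntegrableOn (fun x => g x * LU u φ x) V :=
      Integrable.of_integral_ne_zero (by rw [hgφ]; linarith)
    have e1 : ∀ᵐ x ∂(volume.restrict V), (hI * g x - H (g x)) * LU u φ x
        = hI * (g x * LU u φ x) + H (g x) * (2 * (Hess u x).det) := by
      filter_upwards [PunctureSol.ae_ne (V := V) x₀, ae_restrict_mem G.isOpen.measurableSet]
        with x hx hxV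
      rcases le_or_gt (g x) (k₁ + 1) with hgx | hgx
      · rw [P.H_eq _ hgx]; ring
      · have : LU u φ x = - (2 * (Hess u x).det) := by
          have hux : ContDiffAt ℝ 2 u x := (G.smooth x hxV).of_le hle2
          have e2 : φ =ᶠ[nhds x] fun y => s₁ - u y := by
            filter_upwards [hζev x hxV hx hgx] with y hy
            simp [hφdef, hy]
          rw [LU_congr e2, LU_sub contDiffAt_const hux, LU_self hux,
            LU_const]
          ring
        rw [this]; ring
    have I5 : IntegrableOn (fun x => H (g x) * (2 * (Hess u x).det)) V := by
      refine (I2.sub (I4.const_mul hI)).congr ?_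
      filter_upwards [e1] with x hx
      simp only [Pi.sub_apply, hx]; ring
    have e2 : ∫ x in V, H (g x) * (2 * (Hess u x).det) ≤ hI * s₁ := by
      rw [integral_congr_ae e1, integral_add (I4.const_mul hI) I5, integral_const_mul, hgφ] at I3
      linarith
    have hpt : ∀ x ∈ V, lam * h (g x) ^ 2 ≤ H (g x) * (2 * (Hess u x).det) := by
      intro x hx
      have h1 := P.sq_le (g x)
      have h2 := G.le_det x hx
      have h3 := G.lam_pos
      nlinarith [sq_nonneg (h (g x)), mul_nonneg (sub_nonneg.2 h2) ((sq_nonneg _).trans h1),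
        mul_nonneg h3.le (sub_nonneg.2 h1)]
    have hhc : Continuous h := continuous_iff_continuousAt.2 fun r => (P.deriv_h r).continuousAt
    have I6 : IntegrableOn (fun x => lam * h (g x) ^ 2) V := by
      refine I5.mono' ((Q.aestronglyMeasurable_comp (hhc.pow 2)).const_mul lam) ?_
      filter_upwards [ae_restrict_mem G.isOpen.measurableSet] with x hx
      rw [Real.norm_of_nonneg (mul_nonneg G.lam_pos.le (sq_nonneg _))]
      exact hpt x hx
    refine ⟨?_, ?_⟩
    · have := I6.const_mul lam⁻¹
      refine this.congr (Filter.Eventually.of_forall fun x => ?_)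
      have := G.lam_pos.ne'
      simp only []
      field_simp
    · rw [← integral_const_mul]
      exact (setIntegral_mono_on I6 I5 G.isOpen.measurableSet hpt).trans e2

end

lemma LU_const_mul {u f : E 2 → ℝ} {x : E 2} (hu : ContDiffAt ℝ 2 u x) (hf : ContDiffAt ℝ 2 f x)
    (c : ℝ) : LU u (fun y => c * f y) x = c * LU u f x := by
  rw [LU_mul hu contDiffAt_const hf, LU_const]
  have h : ∀ i, pd (fun _ : E 2 => c) x i = 0 := fun i => by simp [pd]
  simp only [h]; ring

lemma GreenData.exists_ge {u g : E 2 → ℝ} {V : Set (E 2)} {x₀ : E 2} {lam : ℝ}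
    (G : GreenData u g V x₀ lam) {P : Set (E 2)} (hP : IsOpen P) (hx₀ : x₀ ∈ P) {B : ℝ}
    (hu0 : ∀ y ∈ closure V, 0 ≤ u y) (huB : ∀ y ∈ closure V, u y ≤ B)
    (huc : ContinuousOn u (closure V)) {z : E 2} (hz : z ∈ V) (hzP : z ∉ P) :
    ∃ y ∈ V, y ∈ closure P ∧ y ∉ P ∧ g z ≤ g y := by
  have Q := G.punctureSol
  have hle2 : (2 : WithTop ℕ∞) ≤ ((⊤ : ℕ∞) : WithTop ℕ∞) := by norm_cast
  have hgz : 0 < g z := Q.pos z ⟨hz, fun h => hzP (h ▸ hx₀)⟩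
  have hgc : ContinuousOn g (closure V \ P) :=
    G.green.2.2.2.1.mono fun y hy => ⟨hy.1, fun h => hy.2 (h ▸ hx₀)⟩
  have hVc := G.bounded.isCompact_closure
  have hfr : ∀ y ∈ frontier V, g y = 0 := G.green.2.2.2.2.1
  have hB0 : 0 ≤ B := (hu0 z (subset_closure hz)).trans (huB z (subset_closure hz))
  by_contra! hcon
  obtain ⟨m, hm, hmb⟩ : ∃ m < g z, ∀ y ∈ (closure V ∩ closure P) \ P, g y ≤ m := by
    have hC : IsCompact ((closure V ∩ closure P) \ P) :=
      (hVc.inter_right isClosed_closure).diff hP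
    rcases Set.eq_empty_or_nonempty ((closure V ∩ closure P) \ P) with he | hne
    · exact ⟨0, hgz, by simp [he]⟩
    · obtain ⟨y, hy, hmax⟩ := hC.exists_isMaxOn hne (hgc.mono fun y hy => ⟨hy.1.1, hy.2⟩)
      refine ⟨g y, ?_, fun w hw => hmax hw⟩
      by_cases hyV : y ∈ V
      · exact hcon y hyV hy.1.2 hy.2
      · rw [hfr y (by rw [G.isOpen.frontier_eq]; exact ⟨hy.1.1, hyV⟩)]; exact hgz
  set m' := max m 0 with hm'
  have hm'z : m' < g z := max_lt hm hgz
  obtain ⟨ε, hε, hεB⟩ : ∃ ε : ℝ, 0 < ε ∧ m' + ε * B < g z := by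
    refine ⟨(g z - m') / (B + 1), div_pos (sub_pos.2 hm'z) (by positivity), ?_⟩
    have : (g z - m') / (B + 1) * B < g z - m' := by
      rw [div_mul_eq_mul_div, div_lt_iff₀ (by positivity)]
      nlinarith
    linarith
  have hzu := hu0 z (subset_closure hz)
  have hm0 : 0 ≤ m' := le_max_right _ _
  have hbd : ∀ y ∈ closure V, g y ≤ m' → -ε * u z - g z < -ε * u y - g y := by
    intro y hy hgy
    have h1 := mul_le_mul_of_nonneg_left (huB y hy) hε.le
    have h2 := mul_nonneg hε.le hzu
    linarith
  obtain ⟨w, hwK, hmin, hwz⟩ := exists_isLocalMin_of_lt (f := fun y => -ε * u y - g y)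
    (K := closure V \ P) (hVc.diff hP)
    ((continuousOn_const.mul (huc.mono Set.sdiff_subset)).sub hgc) (z₀ := z)
    ⟨subset_closure hz, hzP⟩ (by
      intro y hy
      have hyK : y ∈ closure V \ P := (hVc.diff hP).isClosed.frontier_subset hy
      refine hbd y hyK.1 ?_
      by_cases hyV : y ∈ V
      · by_cases hyP : y ∈ closure P
        · exact (hmb y ⟨⟨hyK.1, hyP⟩, hyK.2⟩).trans (le_max_left _ _)
        · exfalso
          refine hy.2 (mem_interior.2 ⟨V \ closure P, fun a ha => ⟨subset_closure ha.1,
            fun h => ha.2 (subset_closure h)⟩, G.isOpen.sdiff isClosed_closure, hyV, hyP⟩)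
      · rw [hfr y (by rw [G.isOpen.frontier_eq]; exact ⟨hyK.1, hyV⟩)]; exact hm0)
  have hwK' := interior_subset hwK
  have hwV : w ∈ V := by
    by_contra hwV
    have := hbd w hwK'.1 (by
      rw [hfr w (by rw [G.isOpen.frontier_eq]; exact ⟨hwK'.1, hwV⟩)]; exact hm0)
    linarith
  have hwx : w ≠ x₀ := fun h => hwK'.2 (h ▸ hx₀)
  have huw : ContDiffAt ℝ 2 u w := (G.smooth w hwV).of_le hle2
  have hgw := Q.smooth_sol w ⟨hwV, hwx⟩
  have hψ : ContDiffAt ℝ 2 (fun y => g y - -ε * u y) w := hgw.sub (contDiffAt_const.mul huw)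
  have hmax : IsLocalMax (fun y => g y - -ε * u y) w := by
    have := hmin.neg
    simpa using this
  have h1 := LU_nonpos huw hψ (G.psd w hwV) (Q.det_pos w hwV)
    (D2_nonpos_of_isLocalMax hψ hmax)
  rw [LU_sub hgw (contDiffAt_const.mul huw), LU_const_mul huw huw, LU_self huw,
    Q.harmonic w ⟨hwV, hwx⟩] at h1
  have := mul_pos hε (Q.det_pos w hwV)
  linarith

/-- The affine parametrization `(a, b) ↦ x₀ + a e + b f` of the plane. -/
def planeMap (x₀ e f : E 2) (p : ℝ × ℝ) : E 2 := x₀ + p.1 • e + p.2 • f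

lemma continuous_planeMap (x₀ e f : E 2) : Continuous (planeMap x₀ e f) := by
  unfold planeMap; fun_prop

lemma setIntegral_planeMap {x₀ e f : E 2} (hτ : om e f ≠ 0) {S : Set (ℝ × ℝ)}
    (hS : MeasurableSet S) (q : E 2 → ℝ) :
    ∫ p in S, q (planeMap x₀ e f p) = |om e f|⁻¹ * ∫ x in planeMap x₀ e f '' S, q x := by
  set m : E 2 → ℝ × ℝ := fun p => (p 0, p 1) with hm
  have hmeq : m = MeasurableEquiv.finTwoArrow ∘ (MeasurableEquiv.toLp 2 (Fin 2 → ℝ)).symm := by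
    funext p; rfl
  have hmp : MeasurePreserving m volume volume := by
    rw [hmeq]
    exact (volume_preserving_finTwoArrow ℝ).comp
      (EuclideanSpace.volume_preserving_symm_measurableEquiv_toLp (Fin 2))
  have hme : MeasurableEmbedding m := by
    rw [hmeq]
    exact (MeasurableEquiv.measurableEmbedding _).comp (MeasurableEquiv.measurableEmbedding _)
  have hsurj : Function.Surjective m := by
    rw [hmeq]; exact (MeasurableEquiv.surjective _).comp (MeasurableEquiv.surjective _)
  set L : E 2 →L[ℝ] E 2 := (coordL 0).smulRight e + (coordL 1).smulRight f with hL
  have hLm : ∀ p, x₀ + L p = planeMap x₀ e f (m p) := by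
    intro p; simp [hL, planeMap, hm, add_assoc]
  have hdet : L.det = om e f := by
    rw [ContinuousLinearMap.det, ← LinearMap.det_toMatrix (EuclideanSpace.basisFun (Fin 2) ℝ).toBasis,
      Matrix.det_fin_two]
    simp [LinearMap.toMatrix_apply, hL, om]
    ring
  have himg : planeMap x₀ e f '' S = (fun p => x₀ + L p) '' (m ⁻¹' S) := by
    conv_lhs => rw [← Set.image_preimage_eq S hsurj]
    rw [Set.image_image]
    exact Set.image_congr fun p _ => (hLm p).symm
  have hinj : Function.Injective fun p => x₀ + L p := by
    intro p r hpr
    have h1 : L (p - r) = 0 := by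
      rw [map_sub]; simpa [sub_eq_zero] using hpr
    set v := p - r with hv
    have h2 : v 0 • e + v 1 • f = 0 := by simpa [hL] using h1
    have h30 : v 0 * e 0 + v 1 * f 0 = 0 := by simpa using congrArg (fun w : E 2 => w 0) h2
    have h31 : v 0 * e 1 + v 1 * f 1 = 0 := by simpa using congrArg (fun w : E 2 => w 1) h2
    have h4 : v 0 * om e f = 0 := by unfold om; linear_combination f 1 * h30 - f 0 * h31
    have h5 : v 1 * om e f = 0 := by unfold om; linear_combination -e 1 * h30 + e 0 * h31
    have : v = 0 := by
      rw [eq_coord v, (mul_eq_zero.1 h4).resolve_right hτ, (mul_eq_zero.1 h5).resolve_right hτ]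
      simp
    exact sub_eq_zero.1 this
  rw [himg, integral_image_eq_integral_abs_det_fderiv_smul volume (hme.measurable hS)
    (f' := fun _ => L) (fun p _ => (L.hasFDerivAt.const_add x₀).hasFDerivWithinAt)
    hinj.injOn, hdet]
  simp only [smul_eq_mul]
  rw [integral_const_mul, ← mul_assoc, inv_mul_cancel₀ (abs_ne_zero.2 hτ), one_mul,
    ← hmp.setIntegral_preimage_emb hme]
  simp only [hLm]

lemma sub_le_of_sq_deriv_le {φ φ' q p p' p'' : ℝ → ℝ} {lam s ε : ℝ} (hlam : 0 < lam) (hε : 0 < ε)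
    (hφ : ∀ t, HasDerivAt φ (φ' t) t) (hq : Continuous q)
    (hp : ∀ t ∈ Set.Icc (-2 : ℝ) 2, HasDerivAt p (p' t) t)
    (hp' : ∀ t ∈ Set.Icc (-2 : ℝ) 2, HasDerivAt p' (p'' t) t)
    (hp'' : ∀ t ∈ Set.Icc (-2 : ℝ) 2, 0 ≤ p'' t)
    (h0 : ∀ t ∈ Set.Icc (-2 : ℝ) 2, 0 ≤ p t) (hs : ∀ t ∈ Set.Icc (-2 : ℝ) 2, p t ≤ s)
    (hq0 : ∀ t, 0 ≤ q t) (hb : ∀ t ∈ Set.Icc (-2 : ℝ) 2, lam * φ' t ^ 2 ≤ p'' t * q t)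
    {t t' : ℝ} (ht : t ∈ Set.Icc (-1 : ℝ) 1) (ht' : t' ∈ Set.Icc (-1 : ℝ) 1) :
    φ t - φ t' ≤ ε / (2 * lam) * (∫ x in (-1)..1, q x) + s / ε := by
  have hmono' : MonotoneOn p' (Set.Icc (-2) 2) := by
    refine monotoneOn_of_hasDerivWithinAt_nonneg (f' := p'') (convex_Icc _ _)
      (fun x hx => (hp' x hx).continuousAt.continuousWithinAt) (fun x hx => ?_) fun x hx => ?_
    · exact (hp' x (interior_subset hx)).hasDerivWithinAt
    · exact hp'' x (interior_subset hx)
  have hr : p' 1 ≤ s := by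
    obtain ⟨c, hc, hc'⟩ := exists_hasDerivAt_eq_slope p p' (show (1 : ℝ) < 2 by norm_num)
      (fun x hx => (hp x ⟨by linarith [hx.1], hx.2⟩).continuousAt.continuousWithinAt)
      (fun x hx => hp x ⟨by linarith [hx.1], hx.2.le⟩)
    have h1 := hmono' (by norm_num : (1 : ℝ) ∈ Set.Icc (-2 : ℝ) 2)
      (⟨by linarith [hc.1], hc.2.le⟩ : c ∈ Set.Icc (-2 : ℝ) 2) hc.1.le
    have h2 := h0 1 (by norm_num)
    have h3 := hs 2 (by norm_num)
    have : p' c = p 2 - p 1 := by rw [hc']; norm_num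
    linarith
  have hl : -s ≤ p' (-1) := by
    obtain ⟨c, hc, hc'⟩ := exists_hasDerivAt_eq_slope p p' (show (-2 : ℝ) < -1 by norm_num)
      (fun x hx => (hp x ⟨hx.1, by linarith [hx.2]⟩).continuousAt.continuousWithinAt)
      (fun x hx => hp x ⟨hx.1.le, by linarith [hx.2]⟩)
    have h1 := hmono' (⟨hc.1.le, by linarith [hc.2]⟩ : c ∈ Set.Icc (-2 : ℝ) 2)
      (by norm_num : (-1 : ℝ) ∈ Set.Icc (-2 : ℝ) 2) hc.2.le
    have h2 := h0 (-1) (by norm_num)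
    have h3 := hs (-2) (by norm_num)
    have : p' c = p (-1) - p (-2) := by rw [hc']; norm_num
    linarith
  set Ψ : ℝ → ℝ := fun t => ε / (2 * lam) * (∫ x in (-1)..t, q x) + p' t / (2 * ε) with hΨ
  have hΨd : ∀ t ∈ Set.Icc (-2 : ℝ) 2, HasDerivAt Ψ (ε / (2 * lam) * q t + p'' t / (2 * ε)) t :=
    fun t ht => ((hq.integral_hasStrictDerivAt (-1) t).hasDerivAt.const_mul _).fun_add
      ((hp' t ht).div_const _)
  have hle : ∀ t ∈ Set.Icc (-2 : ℝ) 2, |φ' t| ≤ ε / (2 * lam) * q t + p'' t / (2 * ε) := by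
    intro t ht
    have hqt := hq0 t
    have hpt := hp'' t ht
    refine abs_le_of_sq_le_sq ?_ (by positivity)
    have h1 : (ε / (2 * lam) * q t + p'' t / (2 * ε)) ^ 2 - p'' t * q t / lam
        = (ε / (2 * lam) * q t - p'' t / (2 * ε)) ^ 2 := by
      field_simp; ring
    have h2 : φ' t ^ 2 ≤ p'' t * q t / lam := by
      rw [le_div_iff₀ hlam]; linarith [hb t ht]
    nlinarith [sq_nonneg (ε / (2 * lam) * q t - p'' t / (2 * ε))]
  have hI : Set.Icc (-1 : ℝ) 1 ⊆ Set.Icc (-2) 2 := Set.Icc_subset_Icc (by norm_num) (by norm_num)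
  have hm1 : MonotoneOn (fun t => Ψ t - φ t) (Set.Icc (-1) 1) := by
    refine monotoneOn_of_hasDerivWithinAt_nonneg
      (f' := fun t => ε / (2 * lam) * q t + p'' t / (2 * ε) - φ' t) (convex_Icc _ _)
      (fun x hx => ((hΨd x (hI hx)).fun_sub (hφ x)).continuousAt.continuousWithinAt)
      (fun x hx => ((hΨd x (hI (interior_subset hx))).fun_sub (hφ x)).hasDerivWithinAt)
      fun x hx => ?_
    linarith [(le_abs_self _).trans (hle x (hI (interior_subset hx)))]
  have hm2 : MonotoneOn (fun t => Ψ t + φ t) (Set.Icc (-1) 1) := by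
    refine monotoneOn_of_hasDerivWithinAt_nonneg
      (f' := fun t => ε / (2 * lam) * q t + p'' t / (2 * ε) + φ' t) (convex_Icc _ _)
      (fun x hx => ((hΨd x (hI hx)).fun_add (hφ x)).continuousAt.continuousWithinAt)
      (fun x hx => ((hΨd x (hI (interior_subset hx))).fun_add (hφ x)).hasDerivWithinAt)
      fun x hx => ?_
    linarith [(neg_abs_le _).trans' (neg_le_neg (hle x (hI (interior_subset hx))))]
  have hend : Ψ 1 - Ψ (-1) ≤ ε / (2 * lam) * (∫ x in (-1)..1, q x) + s / ε := by
    have : (p' 1 - p' (-1)) / (2 * ε) ≤ s / ε := by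
      rw [div_le_div_iff₀ (by positivity) hε]; nlinarith
    simp only [hΨ, intervalIntegral.integral_same, mul_zero]
    rw [sub_div] at this
    linarith
  have l1 : (-1 : ℝ) ∈ Set.Icc (-1 : ℝ) 1 := by norm_num
  have r1 : (1 : ℝ) ∈ Set.Icc (-1 : ℝ) 1 := by norm_num
  rcases le_total t t' with h | h
  · have a1 := hm2 ht ht' h
    have a1' := hm1 ht ht' h
    have a2 := hm1 l1 ht ht.1
    have a3 := hm1 ht' r1 ht'.2
    have a4 := hm2 l1 ht ht.1
    have a5 := hm2 ht' r1 ht'.2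
    simp only at a1 a2 a3 a4 a5 a1'
    linarith
  · have a1 := hm1 ht' ht h
    have a1' := hm2 ht' ht h
    have a2 := hm1 l1 ht' ht'.1
    have a3 := hm1 ht r1 ht.2
    have a4 := hm2 l1 ht' ht'.1
    have a5 := hm2 ht r1 ht.2
    simp only at a1 a2 a3 a4 a5 a1'
    linarith

lemma planeMap_ne {x₀ e f : E 2} (hτ : om e f ≠ 0) {p : ℝ × ℝ} (hp : p.1 ≠ 0) :
    planeMap x₀ e f p ≠ x₀ := by
  intro h
  have h2 : p.1 • e + p.2 • f = 0 := by
    have : x₀ + (p.1 • e + p.2 • f) = x₀ + 0 := by rw [add_zero, ← add_assoc]; exact h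
    exact add_left_cancel this
  have h30 : p.1 * e 0 + p.2 * f 0 = 0 := by simpa using congrArg (fun w : E 2 => w 0) h2
  have h31 : p.1 * e 1 + p.2 * f 1 = 0 := by simpa using congrArg (fun w : E 2 => w 1) h2
  have h4 : p.1 * om e f = 0 := by unfold om; linear_combination f 1 * h30 - f 0 * h31
  exact (mul_ne_zero hp hτ) h4

lemma strip_integral {q : E 2 → ℝ} {x₀ e f : E 2} (hτ : om e f ≠ 0)
    (hq : ∀ x, x ≠ x₀ → ContinuousAt q x) {c : ℝ} (hc : 0 ≤ c) :
    IntervalIntegrable (fun ρ => ∫ t in (-c)..c, q (planeMap x₀ e f (ρ, t))) volume (1 / 2) 1 ∧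
    ∫ ρ in (1 / 2 : ℝ)..1, ∫ t in (-c)..c, q (planeMap x₀ e f (ρ, t))
      = |om e f|⁻¹ * ∫ x in planeMap x₀ e f '' (Set.Icc (1 / 2) 1 ×ˢ Set.Icc (-c) c), q x := by
  have hcc : -c ≤ c := by linarith
  have hint : IntegrableOn (fun p : ℝ × ℝ => q (planeMap x₀ e f p))
      (Set.Icc (1 / 2) 1 ×ˢ Set.Icc (-c) c) (volume.prod volume) := by
    refine ContinuousOn.integrableOn_compact (isCompact_Icc.prod isCompact_Icc) fun p hp => ?_
    refine ContinuousAt.continuousWithinAt ?_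
    refine ContinuousAt.comp (g := q) (hq _ (planeMap_ne hτ ?_)) (continuous_planeMap x₀ e f).continuousAt
    have := hp.1.1
    linarith
  have heq : (fun ρ => ∫ t in (-c)..c, q (planeMap x₀ e f (ρ, t)))
      = fun ρ => ∫ t in Set.Icc (-c) c, q (planeMap x₀ e f (ρ, t)) := by
    funext ρ
    rw [intervalIntegral.integral_of_le hcc, integral_Icc_eq_integral_Ioc]
  rw [heq]
  constructor
  · rw [intervalIntegrable_iff_integrableOn_Icc_of_le (by norm_num)]
    have : Integrable (fun p : ℝ × ℝ => q (planeMap x₀ e f p))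
      ((volume.restrict (Set.Icc (1 / 2) 1)).prod (volume.restrict (Set.Icc (-c) c))) := by
      rw [Measure.prod_restrict]; exact hint
    exact this.integral_prod_left
  · rw [intervalIntegral.integral_of_le (by norm_num), ← integral_Icc_eq_integral_Ioc,
      ← setIntegral_prod _ hint, ← setIntegral_planeMap hτ (measurableSet_Icc.prod measurableSet_Icc)]
    rfl

section

variable {u g : E 2 → ℝ} {V : Set (E 2)} {x₀ : E 2} {lam k k₂ hI M : ℝ} {f h H : ℝ → ℝ}

lemma GreenData.eventually_lt (G : GreenData u g V x₀ lam) (hk : 0 < k) {x : E 2}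
    (hx : x ≠ x₀) (hxV : x ∉ V) : ∀ᶠ y in nhds x, y ∈ V → g y < k := by
  by_cases hxc : x ∈ closure V
  · have hc := G.green.2.2.2.1 x ⟨hxc, hx⟩
    have h0 : g x = 0 := G.green.2.2.2.2.1 x (by rw [G.isOpen.frontier_eq]; exact ⟨hxc, hxV⟩)
    have h1 := hc.eventually (gt_mem_nhds (show g x < k by rwa [h0]))
    rw [eventually_nhdsWithin_iff] at h1
    filter_upwards [h1, isOpen_ne.mem_nhds hx] with y hy hy0 hyV
    exact hy ⟨subset_closure hyV, hy0⟩
  · filter_upwards [isClosed_closure.isOpen_compl.mem_nhds hxc] with y hy hyV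
    exact absurd (subset_closure hyV) hy

/-- The extension by zero of `h ∘ g`. -/
def cutSol (V : Set (E 2)) (g : E 2 → ℝ) (h : ℝ → ℝ) : E 2 → ℝ := V.indicator fun x => h (g x)

/-- The extension by zero of the energy density `f(g) U^{ij} ∂_i g ∂_j g`. -/
def cutEnergy (u : E 2 → ℝ) (V : Set (E 2)) (g : E 2 → ℝ) (f : ℝ → ℝ) : E 2 → ℝ :=
  V.indicator fun x => f (g x) * QU u g x

lemma GreenData.cut_local (G : GreenData u g V x₀ lam) (hk : 0 < k)
    (P : Profile k k₂ f h H hI M) {x : E 2} (hx : x ≠ x₀) :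
    DifferentiableAt ℝ (cutSol V g h) x ∧ ContinuousAt (cutEnergy u V g f) x ∧
      0 ≤ cutEnergy u V g f x ∧
      ((∀ v, 0 ≤ D2 u x v v) → ∀ v, lam * fderiv ℝ (cutSol V g h) x v ^ 2 ≤
        D2 u x v v * cutEnergy u V g f x) := by
  by_cases hxV : x ∈ V
  · have hle2 : (2 : WithTop ℕ∞) ≤ ((⊤ : ℕ∞) : WithTop ℕ∞) := by norm_cast
    have hux := (G.smooth x hxV).of_le hle2
    have hgx := G.punctureSol.smooth_sol x ⟨hxV, hx⟩
    have hgd : DifferentiableAt ℝ g x := hgx.differentiableAt (by norm_num)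
    have e1 : cutSol V g h =ᶠ[nhds x] fun y => h (g y) := by
      filter_upwards [G.isOpen.mem_nhds hxV] with y hy
      simp [cutSol, hy]
    have e2 : cutEnergy u V g f =ᶠ[nhds x] fun y => f (g y) * QU u g y := by
      filter_upwards [G.isOpen.mem_nhds hxV] with y hy
      simp [cutEnergy, hy]
    have hd : HasFDerivAt (cutSol V g h) (f (g x) • fderiv ℝ g x) x :=
      ((P.deriv_h (g x)).comp_hasFDerivAt x hgd.hasFDerivAt).congr_of_eventuallyEq e1
    have hQ : 0 ≤ QU u g x := QU_nonneg g hux (G.psd x hxV)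
    refine ⟨hd.differentiableAt, ?_, ?_, fun _ v => ?_⟩
    · refine ContinuousAt.congr ?_ e2.symm
      exact (P.cont.continuousAt.comp hgd.continuousAt).mul
        (continuousAt_QU hux (hgx.of_le (by norm_num)))
    · rw [e2.self_of_nhds]; exact mul_nonneg (P.nonneg _) hQ
    · rw [hd.fderiv, e2.self_of_nhds]
      simp only [smul_apply, smul_eq_mul]
      have h1 := det_mul_sq_le (g := g) hux v
      have h2 := mul_le_mul_of_nonneg_right (G.le_det x hxV) (sq_nonneg (fderiv ℝ g x v))
      have h3 := P.nonneg (g x)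
      have h4 := P.le_one (g x)
      have h5 := mul_nonneg G.lam_pos.le (sq_nonneg (fderiv ℝ g x v))
      calc lam * (f (g x) * fderiv ℝ g x v) ^ 2
          = f (g x) * (f (g x) * (lam * fderiv ℝ g x v ^ 2)) := by ring
        _ ≤ f (g x) * (lam * fderiv ℝ g x v ^ 2) :=
            mul_le_mul_of_nonneg_left (mul_le_of_le_one_left h5 h4) h3
        _ ≤ f (g x) * (D2 u x v v * QU u g x) := mul_le_mul_of_nonneg_left (h2.trans h1) h3
        _ = _ := by ring
  · have hev := G.eventually_lt hk hx hxV
    have e1 : cutSol V g h =ᶠ[nhds x] fun _ => 0 := by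
      filter_upwards [hev] with y hy
      by_cases hyV : y ∈ V
      · simp [cutSol, P.h_eq _ (hy hyV).le]
      · simp [cutSol, hyV]
    have e2 : cutEnergy u V g f =ᶠ[nhds x] fun _ => 0 := by
      filter_upwards [hev] with y hy
      by_cases hyV : y ∈ V
      · simp [cutEnergy, P.f_eq _ (hy hyV).le]
      · simp [cutEnergy, hyV]
    have hd : HasFDerivAt (cutSol V g h) (0 : E 2 →L[ℝ] ℝ) x :=
      (hasFDerivAt_const (0 : ℝ) x).congr_of_eventuallyEq e1
    refine ⟨hd.differentiableAt, continuousAt_const.congr e2.symm, e2.self_of_nhds.ge,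
      fun _ v => ?_⟩
    rw [hd.fderiv, e2.self_of_nhds]
    simp

lemma om_swap (e f : E 2) : om f e = -om e f := by unfold om; ring

lemma om_neg_left (e f : E 2) : om (-e) f = -om e f := by unfold om; simp; ring

/-- The closed parallelogram of half-size `2` spanned by `e, f` at `x₀` lies in the region where
`u` is convex with values in `[0, s]`. -/
def GoodFrame (u : E 2 → ℝ) (x₀ e f : E 2) (s : ℝ) : Prop :=
  ∀ a ∈ Set.Icc (-2 : ℝ) 2, ∀ b ∈ Set.Icc (-2 : ℝ) 2,
    ContDiffAt ℝ 2 u (planeMap x₀ e f (a, b)) ∧ (∀ v, 0 ≤ D2 u (planeMap x₀ e f (a, b)) v v) ∧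
    0 ≤ u (planeMap x₀ e f (a, b)) ∧ u (planeMap x₀ e f (a, b)) ≤ s

lemma planeMap_swap (x₀ e f : E 2) (a b : ℝ) :
    planeMap x₀ f e (a, b) = planeMap x₀ e f (b, a) := by simp only [planeMap]; abel

lemma planeMap_neg (x₀ e f : E 2) (a b : ℝ) :
    planeMap x₀ (-e) f (a, b) = planeMap x₀ e f (-a, b) := by simp [planeMap]

lemma GoodFrame.swap {e f : E 2} {s : ℝ} (h : GoodFrame u x₀ e f s) : GoodFrame u x₀ f e s := by
  intro a ha b hb
  rw [planeMap_swap]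
  exact h b hb a ha

lemma GoodFrame.neg {e f : E 2} {s : ℝ} (h : GoodFrame u x₀ e f s) : GoodFrame u x₀ (-e) f s := by
  intro a ha b hb
  rw [planeMap_neg]
  exact h (-a) ⟨by linarith [ha.2], by linarith [ha.1]⟩ b hb

lemma GreenData.oscillation (G : GreenData u g V x₀ lam) (hk : 0 < k)
    (P : Profile k k₂ f h H hI M) {e f' : E 2} (hτ : om e f' ≠ 0) {s ε : ℝ} (hε : 0 < ε)
    (hF : GoodFrame u x₀ e f' s) {ρ : ℝ} (hρ : ρ ∈ Set.Icc (1 / 2 : ℝ) 1) {t t' : ℝ}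
    (ht : t ∈ Set.Icc (-1 : ℝ) 1) (ht' : t' ∈ Set.Icc (-1 : ℝ) 1) :
    cutSol V g h (planeMap x₀ e f' (ρ, t)) ≤ cutSol V g h (planeMap x₀ e f' (ρ, t')) +
      (ε / (2 * lam) * (∫ x in (-1)..1, cutEnergy u V g f (planeMap x₀ e f' (ρ, x))) + s / ε) := by
  have hne : ∀ t, planeMap x₀ e f' (ρ, t) ≠ x₀ := fun t =>
    planeMap_ne hτ (by simp only; linarith [hρ.1])
  have hline : ∀ t, planeMap x₀ e f' (ρ, t) = (x₀ + ρ • e) + t • f' := fun t => rfl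
  have hρ2 : ρ ∈ Set.Icc (-2 : ℝ) 2 := ⟨by linarith [hρ.1], by linarith [hρ.2]⟩
  have := sub_le_of_sq_deriv_le (φ := fun t => cutSol V g h (planeMap x₀ e f' (ρ, t)))
    (φ' := fun t => fderiv ℝ (cutSol V g h) (planeMap x₀ e f' (ρ, t)) f')
    (q := fun t => cutEnergy u V g f (planeMap x₀ e f' (ρ, t)))
    (p := fun t => u (planeMap x₀ e f' (ρ, t)))
    (p' := fun t => fderiv ℝ u (planeMap x₀ e f' (ρ, t)) f')
    (p'' := fun t => D2 u (planeMap x₀ e f' (ρ, t)) f' f') (s := s) G.lam_pos hε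
    (fun t => ?_) ?_ (fun t ht => ?_) (fun t ht => ?_) (fun t ht => (hF ρ hρ2 t ht).2.1 f')
    (fun t ht => (hF ρ hρ2 t ht).2.2.1) (fun t ht => (hF ρ hρ2 t ht).2.2.2)
    (fun t => (G.cut_local hk P (hne t)).2.2.1)
    (fun t ht => (G.cut_local hk P (hne t)).2.2.2 (hF ρ hρ2 t ht).2.1 f') ht ht'
  · linarith
  · exact hasDerivAt_comp_line (G.cut_local hk P (hne t)).1
  · refine continuous_iff_continuousAt.2 fun t => ?_
    exact ContinuousAt.comp (g := cutEnergy u V g f) (G.cut_local hk P (hne t)).2.1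
      ((continuous_planeMap x₀ e f').comp (by fun_prop : Continuous fun t : ℝ => (ρ, t))).continuousAt
  · exact hasDerivAt_comp_line ((hF ρ hρ2 t ht).1.differentiableAt (by norm_num))
  · exact hasDerivAt_fderiv_comp_line (hF ρ hρ2 t ht).1

end

lemma continuous_om_left (f : E 2) : Continuous fun y : E 2 => om y f := by
  unfold om; fun_prop

lemma continuous_om_right (e : E 2) : Continuous fun y : E 2 => om e y := by
  unfold om; fun_prop

lemma planeMap_coord {e f : E 2} (hτ : om e f ≠ 0) (x₀ y : E 2) :
    planeMap x₀ e f (om (y - x₀) f / om e f, om e (y - x₀) / om e f) = y := by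
  have h : ∀ i, om (y - x₀) f * e i + om e (y - x₀) * f i = om e f * (y - x₀) i := by
    intro i; fin_cases i <;> simp [om] <;> ring
  have h2 : (om (y - x₀) f / om e f) • e + (om e (y - x₀) / om e f) • f = y - x₀ := by
    ext i
    simp only [PiLp.add_apply, PiLp.smul_apply, smul_eq_mul]
    rw [div_mul_eq_mul_div, div_mul_eq_mul_div, ← add_div, h i, mul_div_cancel_left₀ _ hτ]
  simp only [planeMap]
  rw [add_assoc, h2]; abel

section

variable {u g : E 2 → ℝ} {V : Set (E 2)} {x₀ : E 2} {lam k k₂ hI M : ℝ} {f h H : ℝ → ℝ}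

lemma GreenData.exists_side (G : GreenData u g V x₀ lam) {B : ℝ}
    (hu0 : ∀ y ∈ closure V, 0 ≤ u y) (huB : ∀ y ∈ closure V, u y ≤ B)
    (huc : ContinuousOn u (closure V)) {z : E 2} (hz : z ∈ V) {e f' : E 2} (hτ : om e f' ≠ 0)
    {s : ℝ} (hs : s ≤ u z)
    (hsmall : ∀ a ∈ Set.Icc (-1 : ℝ) 1, ∀ b ∈ Set.Icc (-1 : ℝ) 1, u (planeMap x₀ e f' (a, b)) < s)
    {ρ : ℝ} (hρ : ρ ∈ Set.Icc (1 / 2 : ℝ) 1) :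
    ∃ a ∈ Set.Icc (-ρ) ρ, ∃ b ∈ Set.Icc (-ρ) ρ, (a = ρ ∨ a = -ρ ∨ b = ρ ∨ b = -ρ) ∧
      planeMap x₀ e f' (a, b) ∈ V ∧ g z ≤ g (planeMap x₀ e f' (a, b)) := by
  set A : E 2 → ℝ := fun y => om (y - x₀) f' / om e f' with hA
  set D : E 2 → ℝ := fun y => om e (y - x₀) / om e f' with hD
  have hAc : Continuous A :=
    ((continuous_om_left f').comp (continuous_id.sub continuous_const)).div_const _
  have hDc : Continuous D :=
    ((continuous_om_right e).comp (continuous_id.sub continuous_const)).div_const _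
  have hρ0 : 0 < ρ := by linarith [hρ.1]
  have hcoord : ∀ y, planeMap x₀ e f' (A y, D y) = y := planeMap_coord hτ x₀
  set P : Set (E 2) := {y | |A y| < ρ} ∩ {y | |D y| < ρ} with hPdef
  have hP : IsOpen P := (isOpen_lt hAc.abs continuous_const).inter
    (isOpen_lt hDc.abs continuous_const)
  have hx₀P : x₀ ∈ P := by
    constructor <;> simp [hA, hD, om, hρ0]
  have hzP : z ∉ P := by
    rintro ⟨h1, h2⟩
    have h1' := abs_lt.1 (show |A z| < ρ from h1)
    have h2' := abs_lt.1 (show |D z| < ρ from h2)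
    have := hsmall (A z) ⟨by linarith [hρ.2], by linarith [hρ.2]⟩ (D z)
      ⟨by linarith [hρ.2], by linarith [hρ.2]⟩
    rw [hcoord] at this
    linarith
  obtain ⟨y, hyV, hyc, hyP, hgy⟩ := G.exists_ge hP hx₀P hu0 huB huc hz hzP
  have hcl : closure P ⊆ {y | |A y| ≤ ρ} ∩ {y | |D y| ≤ ρ} := by
    refine closure_minimal (fun y hy => ⟨le_of_lt (show |A y| < ρ from hy.1),
      le_of_lt (show |D y| < ρ from hy.2)⟩) ?_
    exact (isClosed_le hAc.abs continuous_const).inter (isClosed_le hDc.abs continuous_const)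
  obtain ⟨h1, h2⟩ := hcl hyc
  refine ⟨A y, abs_le.1 h1, D y, abs_le.1 h2, ?_, by rwa [hcoord], by rwa [hcoord]⟩
  by_contra! hcon
  refine hyP ⟨show |A y| < ρ from lt_of_le_of_ne h1 fun h => ?_,
    show |D y| < ρ from lt_of_le_of_ne h2 fun h => ?_⟩
  · rcases (abs_eq hρ0.le).1 h with h | h
    · exact hcon.1 h
    · exact hcon.2.1 h
  · rcases (abs_eq hρ0.le).1 h with h | h
    · exact hcon.2.2.1 h
    · exact hcon.2.2.2 h

lemma image_strip {e f' : E 2} (hτ : om e f' ≠ 0) (c : ℝ) :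
    IsClosed (planeMap x₀ e f' '' (Set.Icc (1 / 2) 1 ×ˢ Set.Icc (-c) c)) ∧
      ∃ r > 0, Disjoint (planeMap x₀ e f' '' (Set.Icc (1 / 2) 1 ×ˢ Set.Icc (-c) c))
        (Metric.ball x₀ r) := by
  have hcl : IsClosed (planeMap x₀ e f' '' (Set.Icc (1 / 2) 1 ×ˢ Set.Icc (-c) c)) :=
    ((isCompact_Icc.prod isCompact_Icc).image (continuous_planeMap x₀ e f')).isClosed
  refine ⟨hcl, ?_⟩
  have hx : x₀ ∉ planeMap x₀ e f' '' (Set.Icc (1 / 2) 1 ×ˢ Set.Icc (-c) c) := by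
    rintro ⟨p, hp, hpx⟩
    refine planeMap_ne hτ (p := p) ?_ hpx
    have := hp.1.1
    linarith
  obtain ⟨r, hr, hball⟩ := Metric.isOpen_iff.1 hcl.isOpen_compl x₀ hx
  exact ⟨r, hr, Set.disjoint_left.2 fun y hy hyb => hball hyb hy⟩

/-- The energy along the segment of a frame at height `ρ`. -/
def lineEnergy (u : E 2 → ℝ) (V : Set (E 2)) (g : E 2 → ℝ) (f : ℝ → ℝ) (x₀ e f' : E 2)
    (ρ : ℝ) : ℝ := ∫ x in (-1)..1, cutEnergy u V g f (planeMap x₀ e f' (ρ, x))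

lemma GreenData.lineEnergy_bound (G : GreenData u g V x₀ lam) (hk : 0 < k)
    (P : Profile k k₂ f h H hI M)
    (hE : ∀ A : Set (E 2), MeasurableSet A → A ⊆ V → ∀ ρ > 0, Disjoint A (Metric.ball x₀ ρ) →
      IntegrableOn (fun x => f (g x) * QU u g x) A ∧ ∫ x in A, f (g x) * QU u g x ≤ hI)
    {e f' : E 2} (hτ : om e f' ≠ 0) :
    IntervalIntegrable (lineEnergy u V g f x₀ e f') volume (1 / 2) 1 ∧
      ∫ ρ in (1 / 2 : ℝ)..1, lineEnergy u V g f x₀ e f' ρ ≤ |om e f'|⁻¹ * hI := by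
  obtain ⟨h1, h2⟩ := strip_integral (q := cutEnergy u V g f) hτ
    (fun x hx => (G.cut_local hk P hx).2.1) zero_le_one
  refine ⟨h1, ?_⟩
  unfold lineEnergy
  rw [h2]
  refine mul_le_mul_of_nonneg_left ?_ (by positivity)
  obtain ⟨hcl, r, hr, hd⟩ := image_strip (x₀ := x₀) hτ 1
  unfold cutEnergy
  rw [setIntegral_indicator G.isOpen.measurableSet]
  exact (hE _ (hcl.measurableSet.inter G.isOpen.measurableSet) Set.inter_subset_right r hr
    (hd.mono_left Set.inter_subset_left)).2

lemma GreenData.square_bound (G : GreenData u g V x₀ lam) (hk : 0 < k)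
    (P : Profile k k₂ f h H hI M) (hE : IntegrableOn (fun x => h (g x) ^ 2) V)
    {e f' : E 2} (hτ : om e f' ≠ 0) :
    IntervalIntegrable (fun ρ => ∫ t in (-(1 / 2 : ℝ))..(1 / 2),
      cutSol V g h (planeMap x₀ e f' (ρ, t)) ^ 2) volume (1 / 2) 1 ∧
    ∫ ρ in (1 / 2 : ℝ)..1, (∫ t in (-(1 / 2 : ℝ))..(1 / 2),
      cutSol V g h (planeMap x₀ e f' (ρ, t)) ^ 2) ≤ |om e f'|⁻¹ * ∫ x in V, h (g x) ^ 2 := by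
  obtain ⟨h1, h2⟩ := strip_integral (q := fun x => cutSol V g h x ^ 2) hτ
    (fun x hx => (G.cut_local hk P hx).1.continuousAt.pow 2)
    (show (0 : ℝ) ≤ 1 / 2 by norm_num)
  refine ⟨h1, ?_⟩
  rw [h2]
  refine mul_le_mul_of_nonneg_left ?_ (by positivity)
  have : (fun x => cutSol V g h x ^ 2) = V.indicator fun x => h (g x) ^ 2 := by
    funext x
    by_cases hx : x ∈ V <;> simp [cutSol, hx]
  rw [this, setIntegral_indicator G.isOpen.measurableSet]
  exact setIntegral_mono_set hE (Filter.Eventually.of_forall fun x => sq_nonneg _)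
    (Filter.Eventually.of_forall Set.inter_subset_right)

lemma GreenData.hI_le (G : GreenData u g V x₀ lam) (hk : 0 < k)
    (P : Profile k k₂ f h H hI M) {B : ℝ}
    (hu0 : ∀ y ∈ closure V, 0 ≤ u y) (huB : ∀ y ∈ closure V, u y ≤ B)
    (huc : ContinuousOn u (closure V)) {z : E 2} (hz : z ∈ V) (hzk : k₂ ≤ g z)
    {e f' : E 2} (hτ : om e f' ≠ 0) {s : ℝ} (hs : s ≤ u z)
    (hsmall : ∀ a ∈ Set.Icc (-1 : ℝ) 1, ∀ b ∈ Set.Icc (-1 : ℝ) 1, u (planeMap x₀ e f' (a, b)) < s)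
    (hF : GoodFrame u x₀ e f' s) {ε : ℝ} (hε : 0 < ε) {ρ : ℝ} (hρ : ρ ∈ Set.Icc (1 / 2 : ℝ) 1)
    {b : ℝ} (hb : b ∈ Set.Icc (-1 : ℝ) 1) :
    hI ≤ cutSol V g h (planeMap x₀ e f' (ρ, b)) + (ε / (2 * lam) * (lineEnergy u V g f x₀ e f' ρ
      + lineEnergy u V g f x₀ (-e) f' ρ + lineEnergy u V g f x₀ f' e ρ
      + lineEnergy u V g f x₀ (-f') e ρ) + 4 * (s / ε)) := by
  obtain ⟨a, ha, c, hc, hside, hyV, hgy⟩ := G.exists_side hu0 huB huc hz hτ hs hsmall hρ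
  have hval : cutSol V g h (planeMap x₀ e f' (a, c)) = hI := by
    simp only [cutSol, Set.indicator_of_mem hyV]
    exact P.h_eq' _ (hzk.trans hgy)
  have hτ2 : om (-e) f' ≠ 0 := by rwa [om_neg_left, neg_ne_zero]
  have hτ3 : om f' e ≠ 0 := by rwa [om_swap, neg_ne_zero]
  have hτ4 : om (-f') e ≠ 0 := by rwa [om_neg_left, om_swap, neg_neg]
  have O1 := fun t ht t' ht' => G.oscillation hk P hτ hε hF hρ (t := t) (t' := t') ht ht'
  have O2 := fun t ht t' ht' => G.oscillation hk P hτ2 hε hF.neg hρ (t := t) (t' := t') ht ht'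
  have O3 := fun t ht t' ht' => G.oscillation hk P hτ3 hε hF.swap hρ (t := t) (t' := t') ht ht'
  have O4 := fun t ht t' ht' => G.oscillation hk P hτ4 hε hF.swap.neg hρ (t := t) (t' := t') ht ht'
  change ∀ t ∈ _, ∀ t' ∈ _, _ ≤ _ + (_ * lineEnergy u V g f x₀ e f' ρ + _) at O1
  change ∀ t ∈ _, ∀ t' ∈ _, _ ≤ _ + (_ * lineEnergy u V g f x₀ (-e) f' ρ + _) at O2
  change ∀ t ∈ _, ∀ t' ∈ _, _ ≤ _ + (_ * lineEnergy u V g f x₀ f' e ρ + _) at O3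
  change ∀ t ∈ _, ∀ t' ∈ _, _ ≤ _ + (_ * lineEnergy u V g f x₀ (-f') e ρ + _) at O4
  simp only [planeMap_neg, planeMap_swap x₀ e f'] at O2 O3 O4
  have ha1 : a ∈ Set.Icc (-1 : ℝ) 1 := ⟨by linarith [ha.1, hρ.2], by linarith [ha.2, hρ.2]⟩
  have hc1 : c ∈ Set.Icc (-1 : ℝ) 1 := ⟨by linarith [hc.1, hρ.2], by linarith [hc.2, hρ.2]⟩
  have hρ1 : ρ ∈ Set.Icc (-1 : ℝ) 1 := ⟨by linarith [hρ.1], hρ.2⟩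
  have hρ2 : -ρ ∈ Set.Icc (-1 : ℝ) 1 := ⟨by linarith [hρ.2], by linarith [hρ.1]⟩
  have n1 := O1 b hb b hb
  have n2 := O2 b hb b hb
  have n3 := O3 b hb b hb
  have n4 := O4 b hb b hb
  rw [← hval]
  rcases hside with rfl | rfl | rfl | rfl
  · have := O1 c hc1 b hb
    linarith
  · have a1 := O2 c hc1 ρ hρ1
    have a2 := O3 (-ρ) hρ2 ρ hρ1
    have a3 := O1 ρ hρ1 b hb
    linarith
  · have a2 := O3 a ha1 c hρ1
    have a3 := O1 c hρ1 b hb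
    linarith
  · have a2 := O4 a ha1 ρ hρ1
    have a3 := O1 (-ρ) hρ2 b hb
    linarith

end

section

variable {u g : E 2 → ℝ} {V : Set (E 2)} {x₀ : E 2} {lam : ℝ}

lemma GreenData.le_average (G : GreenData u g V x₀ lam) {k k₂ hI M : ℝ} {f h H : ℝ → ℝ}
    (hk : 0 < k) (P : Profile k k₂ f h H hI M) {e f' : E 2} (hτ : om e f' ≠ 0) {ρ W β : ℝ}
    (hρ : ρ ≠ 0) (hβ : 0 < β)
    (hle : ∀ b ∈ Set.Icc (-1 : ℝ) 1, hI ≤ cutSol V g h (planeMap x₀ e f' (ρ, b)) + W) :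
    hI ≤ β + (1 / (4 * β)) * (∫ t in (-(1 / 2 : ℝ))..(1 / 2),
      cutSol V g h (planeMap x₀ e f' (ρ, t)) ^ 2) + W := by
  have hc : Continuous fun t : ℝ => cutSol V g h (planeMap x₀ e f' (ρ, t)) ^ 2 := by
    refine Continuous.pow (continuous_iff_continuousAt.2 fun t => ?_) 2
    have h1 : ContinuousAt (cutSol V g h) (planeMap x₀ e f' (ρ, t)) :=
      (G.cut_local hk P (planeMap_ne hτ hρ)).1.continuousAt
    exact ContinuousAt.comp (f := fun t : ℝ => planeMap x₀ e f' (ρ, t)) h1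
      ((continuous_planeMap x₀ e f').comp (Continuous.prodMk_right ρ)).continuousAt
  have h1 : ∫ _ in (-(1 / 2 : ℝ))..(1 / 2), hI ≤ ∫ t in (-(1 / 2 : ℝ))..(1 / 2),
      (β + W + (1 / (4 * β)) * cutSol V g h (planeMap x₀ e f' (ρ, t)) ^ 2) := by
    refine intervalIntegral.integral_mono_on (by norm_num) (by simp)
      ((continuous_const.add (continuous_const.mul hc)).intervalIntegrable _ _) fun t ht => ?_
    have h2 := hle t ⟨by linarith [ht.1], by linarith [ht.2]⟩
    set F := cutSol V g h (planeMap x₀ e f' (ρ, t))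
    have h3 : β + 1 / (4 * β) * F ^ 2 - F = (F - 2 * β) ^ 2 / (4 * β) := by
      field_simp
      ring
    have h4 : 0 ≤ (F - 2 * β) ^ 2 / (4 * β) := by positivity
    linarith
  rw [intervalIntegral.integral_add (by simp)
    ((hc.intervalIntegrable _ _).const_mul _), intervalIntegral.integral_const_mul] at h1
  simp only [intervalIntegral.integral_const, smul_eq_mul] at h1
  linarith

/-- One step of the iteration: the growth of a Green's function between two levels of the
potential. -/
theorem GreenData.step (G : GreenData u g V x₀ lam) {k₁ s₁ s B c : ℝ} (hk₁ : 0 ≤ k₁)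
    (hs : 0 < s) (hs₁ : s ≤ s₁) (hle : ∀ x ∈ V, s₁ ≤ u x → g x ≤ k₁)
    (hu0 : ∀ y ∈ closure V, 0 ≤ u y) (huB : ∀ y ∈ closure V, u y ≤ B)
    (huc : ContinuousOn u (closure V)) {e f' : E 2}
    (hsmall : ∀ a ∈ Set.Icc (-1 : ℝ) 1, ∀ b ∈ Set.Icc (-1 : ℝ) 1, u (planeMap x₀ e f' (a, b)) < s)
    (hF : GoodFrame u x₀ e f' s) (hc : 0 < c) (hT : c * s ≤ |om e f'|) {z : E 2} (hz : z ∈ V)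
    (hzs : s ≤ u z) : g z ≤ k₁ + 1 + 264 / (lam * c) * (s₁ / s) := by
  have hlam := G.lam_pos
  have hs₁0 : 0 < s₁ := hs.trans_le hs₁
  have hpos : 0 < 264 / (lam * c) * (s₁ / s) := by positivity
  by_contra! hcon
  have hk₂ : k₁ + 1 < g z := by linarith
  obtain ⟨f, h, H, hI, M, P⟩ := exists_profile (show 0 ≤ k₁ + 1 by linarith) hk₂
  obtain ⟨hE, hsq, hsqle⟩ := G.energy_bounds hk₁ hs₁0 hle hk₂ P
  have hk : 0 < k₁ + 1 := by linarith
  set T := |om e f'| with hTdef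
  have hT0 : 0 < T := lt_of_lt_of_le (by positivity) hT
  have hτ : om e f' ≠ 0 := abs_pos.1 hT0
  have hτ2 : om (-e) f' ≠ 0 := by rwa [om_neg_left, neg_ne_zero]
  have hτ3 : om f' e ≠ 0 := by rwa [om_swap, neg_ne_zero]
  have hτ4 : om (-f') e ≠ 0 := by rwa [om_neg_left, om_swap, neg_neg]
  obtain ⟨i1, b1⟩ := G.lineEnergy_bound hk P hE hτ
  obtain ⟨i2, b2⟩ := G.lineEnergy_bound hk P hE hτ2
  obtain ⟨i3, b3⟩ := G.lineEnergy_bound hk P hE hτ3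
  obtain ⟨i4, b4⟩ := G.lineEnergy_bound hk P hE hτ4
  obtain ⟨i5, b5⟩ := G.square_bound hk P hsq hτ
  rw [om_neg_left, abs_neg] at b2
  rw [om_swap, abs_neg] at b3
  rw [om_neg_left, abs_neg, om_swap, abs_neg] at b4
  rw [← hTdef] at b1 b2 b3 b4 b5
  set ε := lam * T / 16 with hεdef
  set β := 2 * s₁ / (lam * T) with hβdef
  have hε : 0 < ε := by positivity
  have hβ : 0 < β := by positivity
  set J : ℝ → ℝ := fun ρ => ∫ t in (-(1 / 2 : ℝ))..(1 / 2),
    cutSol V g h (planeMap x₀ e f' (ρ, t)) ^ 2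
  set L1 := lineEnergy u V g f x₀ e f'
  set L2 := lineEnergy u V g f x₀ (-e) f'
  set L3 := lineEnergy u V g f x₀ f' e
  set L4 := lineEnergy u V g f x₀ (-f') e
  have iL : IntervalIntegrable (fun ρ => L1 ρ + L2 ρ + L3 ρ + L4 ρ) volume (1 / 2) 1 :=
    ((i1.add i2).add i3).add i4
  have key : ∫ _ in (1 / 2 : ℝ)..1, hI ≤ ∫ ρ in (1 / 2 : ℝ)..1,
      ((β + 4 * (s / ε)) + ((1 / (4 * β)) * J ρ +
        ε / (2 * lam) * (L1 ρ + L2 ρ + L3 ρ + L4 ρ))) := by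
    refine intervalIntegral.integral_mono_on (by norm_num) (by simp) ?_ fun ρ hρ => ?_
    · exact (by simp : IntervalIntegrable (fun _ : ℝ => β + 4 * (s / ε)) volume (1 / 2) 1).add
        ((i5.const_mul _).add (iL.const_mul _))
    · have := G.le_average hk P hτ (ρ := ρ) (by linarith [hρ.1]) hβ fun b hb =>
        G.hI_le hk P hu0 huB huc hz le_rfl hτ hzs hsmall hF hε hρ hb
      linarith
  rw [intervalIntegral.integral_add (by simp) ((i5.const_mul _).add (iL.const_mul _)),
    intervalIntegral.integral_add (i5.const_mul _) (iL.const_mul _),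
    intervalIntegral.integral_const_mul, intervalIntegral.integral_const_mul,
    intervalIntegral.integral_add ((i1.add i2).add i3) i4,
    intervalIntegral.integral_add (i1.add i2) i3, intervalIntegral.integral_add i1 i2] at key
  simp only [intervalIntegral.integral_const, smul_eq_mul] at key
  have hI0 : 0 < hI := by linarith [P.le_hI]
  have e1 : (1 / (4 * β)) * ∫ ρ in (1 / 2 : ℝ)..1, J ρ ≤ hI / 8 := by
    have h1 : ∫ ρ in (1 / 2 : ℝ)..1, J ρ ≤ T⁻¹ * (hI * s₁ / lam) := by
      refine b5.trans (mul_le_mul_of_nonneg_left ?_ (by positivity))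
      rw [le_div_iff₀ hlam]
      linarith
    refine (mul_le_mul_of_nonneg_left h1 (by positivity)).trans (le_of_eq ?_)
    rw [hβdef]
    field_simp
    norm_num
  have e2 : ε / (2 * lam) * ((((∫ ρ in (1 / 2 : ℝ)..1, L1 ρ) + ∫ ρ in (1 / 2 : ℝ)..1, L2 ρ)
      + ∫ ρ in (1 / 2 : ℝ)..1, L3 ρ) + ∫ ρ in (1 / 2 : ℝ)..1, L4 ρ) ≤ hI / 8 := by
    have h1 : (((∫ ρ in (1 / 2 : ℝ)..1, L1 ρ) + ∫ ρ in (1 / 2 : ℝ)..1, L2 ρ)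
      + ∫ ρ in (1 / 2 : ℝ)..1, L3 ρ) + ∫ ρ in (1 / 2 : ℝ)..1, L4 ρ ≤ 4 * (T⁻¹ * hI) := by
      linarith
    refine (mul_le_mul_of_nonneg_left h1 (by positivity)).trans (le_of_eq ?_)
    rw [hεdef]
    field_simp
    norm_num
  have e3 : β = 2 * (s₁ / (lam * T)) := by rw [hβdef]; ring
  have e4 : s / ε = 16 * (s / (lam * T)) := by rw [hεdef]; field_simp
  have e5 : s / (lam * T) ≤ s₁ / (lam * T) := by gcongr
  have e6 : s₁ / (lam * T) ≤ s₁ / (lam * (c * s)) := by gcongr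
  have e7 : 264 / (lam * c) * (s₁ / s) = 264 * (s₁ / (lam * (c * s))) := by field_simp
  have := P.le_hI
  linarith

end

/-- The linear functional `v ↦ om v f`. -/
def omL (f : E 2) : E 2 →L[ℝ] ℝ := f 1 • coordL 0 - f 0 • coordL 1

@[simp] lemma omL_apply (f v : E 2) : omL f v = om v f := by
  simp [omL, om]; ring

lemma om_self (v : E 2) : om v v = 0 := by simp [om]; ring

/-- A paraboloid that is diagonal in the coordinates `X`, `Y`. -/
def paraboloid (X Y : E 2 →L[ℝ] ℝ) (α β p q c : ℝ) (y : E 2) : ℝ :=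
  α * (X y - p) ^ 2 + β * (Y y - q) ^ 2 + c

lemma paraboloid_eq (X Y : E 2 →L[ℝ] ℝ) (α β p q c : ℝ) : paraboloid X Y α β p q c =
    fun y => α * X y ^ 2 + β * Y y ^ 2 + (-(2 * α * p) • X - (2 * β * q) • Y) y
      + (α * p ^ 2 + β * q ^ 2 + c) := by
  funext y
  simp [paraboloid]
  ring

lemma D2_paraboloid (X Y : E 2 →L[ℝ] ℝ) (α β p q c : ℝ) (x v w : E 2) :
    D2 (paraboloid X Y α β p q c) x v w = 2 * α * (X v * X w) + 2 * β * (Y v * Y w) := by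
  rw [paraboloid_eq, D2_quadratic]

lemma contDiff_paraboloid (X Y : E 2 →L[ℝ] ℝ) (α β p q c : ℝ) {n : WithTop ℕ∞} :
    ContDiff ℝ n (paraboloid X Y α β p q c) := by
  rw [paraboloid_eq]
  exact contDiff_quadratic _ _ _ _ _ _

section

variable {u : E 2 → ℝ} {K : Set (E 2)} {X Y : E 2 →L[ℝ] ℝ} {e f z₀ : E 2} {α β p q c : ℝ}

/-- A paraboloid that lies below `u` on the boundary but not inside is not too steep. -/
lemma four_mul_le_of_lt_paraboloid {Lam : ℝ} (hK : IsCompact K) (huc : ContinuousOn u K)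
    (hu : ∀ z ∈ interior K, ContDiffAt ℝ 2 u z) (hdet : ∀ z ∈ interior K, (Hess u z).det ≤ Lam)
    (hXe : X e = 1) (hXf : X f = 0) (hYe : Y e = 0) (hYf : Y f = 1) (hα : 0 ≤ α) (hβ : 0 ≤ β)
    (hb : ∀ y ∈ frontier K, paraboloid X Y α β p q c y ≤ u y) (hz₀ : z₀ ∈ K)
    (hlt : u z₀ < paraboloid X Y α β p q c z₀) : 4 * α * β ≤ om e f ^ 2 * Lam := by
  have hw := contDiff_paraboloid X Y α β p q c (n := 2)
  obtain ⟨z, hzK, hz, -⟩ := exists_isLocalMin_of_lt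
    (f := fun y => u y - paraboloid X Y α β p q c y) hK (huc.sub hw.continuous.continuousOn) hz₀
    (fun y hy => by linarith [hb y hy])
  have huz := hu z hzK
  refine (four_mul_le_det (e := e) (f := f) huz hα hβ fun s t => ?_).trans
    (mul_le_mul_of_nonneg_left (hdet z hzK) (sq_nonneg _))
  have := D2_nonneg_of_isLocalMin (huz.sub hw.contDiffAt) hz (s • e + t • f)
  rw [D2_sub huz hw.contDiffAt, D2_paraboloid] at this
  simp only [map_add, map_smul, hXe, hXf, hYe, hYf, smul_eq_mul] at this
  linarith

/-- A paraboloid that lies above `u` on the boundary but not inside is not too flat. -/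
lemma le_four_mul_of_paraboloid_lt {lam : ℝ} (hK : IsCompact K) (huc : ContinuousOn u K)
    (hu : ∀ z ∈ interior K, ContDiffAt ℝ 2 u z) (hdet : ∀ z ∈ interior K, lam ≤ (Hess u z).det)
    (hpsd : ∀ z ∈ interior K, ∀ v, 0 ≤ D2 u z v v)
    (hXe : X e = 1) (hXf : X f = 0) (hYe : Y e = 0) (hYf : Y f = 1)
    (hb : ∀ y ∈ frontier K, u y ≤ paraboloid X Y α β p q c y) (hz₀ : z₀ ∈ K)
    (hlt : paraboloid X Y α β p q c z₀ < u z₀) : om e f ^ 2 * lam ≤ 4 * α * β := by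
  have hw := contDiff_paraboloid X Y α β p q c (n := 2)
  obtain ⟨z, hzK, hz, -⟩ := exists_isLocalMin_of_lt
    (f := fun y => paraboloid X Y α β p q c y - u y) hK (hw.continuous.continuousOn.sub huc) hz₀
    (fun y hy => by linarith [hb y hy])
  have huz := hu z hzK
  have key : ∀ v, D2 u z v v ≤ 2 * α * (X v * X v) + 2 * β * (Y v * Y v) := by
    intro v
    have := D2_nonneg_of_isLocalMin (hw.contDiffAt.sub huz) hz v
    rw [D2_sub hw.contDiffAt huz, D2_paraboloid] at this
    linarith
  have he := key e
  have hf := key f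
  rw [hXe, hYe] at he
  rw [hXf, hYf] at hf
  have := mul_det_le huz he hf (hpsd z hzK e) (hpsd z hzK f)
  have h2 := mul_le_mul_of_nonneg_left (hdet z hzK) (sq_nonneg (om e f))
  linarith

end

/-- A convex potential with bounded Monge-Ampère measure, normalized at the interior point `x₀`. -/
structure NormalizedPotential (Ω : Set (E 2)) (u : E 2 → ℝ) (x₀ : E 2) (lam Lam : ℝ) : Prop where
  isOpen : IsOpen Ω
  bounded : Bornology.IsBounded Ω
  convexOn : ConvexOn ℝ (closure Ω) u
  smooth : ∀ x ∈ Ω, ContDiffAt ℝ (⊤ : ℕ∞) u x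
  continuousOn : ContinuousOn u (closure Ω)
  lam_pos : 0 < lam
  le_det : ∀ x ∈ Ω, lam ≤ (Hess u x).det
  det_le : ∀ x ∈ Ω, (Hess u x).det ≤ Lam
  mem : x₀ ∈ Ω
  u_pole : u x₀ = 0
  nonneg : ∀ x ∈ closure Ω, 0 ≤ u x
  psd : ∀ x ∈ Ω, ∀ v, 0 ≤ D2 u x v v

section

variable {Ω : Set (E 2)} {u : E 2 → ℝ} {x₀ : E 2} {lam Lam s : ℝ}

/-- The sublevel set of the potential at height `s`. -/
def level (Ω : Set (E 2)) (u : E 2 → ℝ) (s : ℝ) : Set (E 2) := {y ∈ closure Ω | u y ≤ s}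

namespace NormalizedPotential

lemma contDiffAt_two (N : NormalizedPotential Ω u x₀ lam Lam) {x : E 2} (hx : x ∈ Ω) :
    ContDiffAt ℝ 2 u x := (N.smooth x hx).of_le (by norm_cast)

lemma isCompact_level (N : NormalizedPotential Ω u x₀ lam Lam) (s : ℝ) :
    IsCompact (level Ω u s) := by
  have h : IsClosed (closure Ω ∩ u ⁻¹' Set.Iic s) :=
    N.continuousOn.preimage_isClosed_of_isClosed isClosed_closure isClosed_Iic
  exact N.bounded.isCompact_closure.of_isClosed_subset h Set.inter_subset_left

lemma convex_level (N : NormalizedPotential Ω u x₀ lam Lam) (s : ℝ) :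
    Convex ℝ (level Ω u s) := N.convexOn.convex_le s

lemma mem_level (N : NormalizedPotential Ω u x₀ lam Lam) (hs : 0 ≤ s) : x₀ ∈ level Ω u s :=
  ⟨subset_closure N.mem, by rwa [N.u_pole]⟩

lemma level_mem_nhds (N : NormalizedPotential Ω u x₀ lam Lam) {y : E 2} (hy : y ∈ Ω)
    (hys : u y < s) : level Ω u s ∈ nhds y := by
  filter_upwards [N.isOpen.mem_nhds hy,
    (N.smooth y hy).continuousAt.eventually_lt continuousAt_const hys] with z hz hzs
  exact ⟨subset_closure hz, hzs.le⟩

lemma eq_of_mem_frontier (N : NormalizedPotential Ω u x₀ lam Lam) (hK : level Ω u s ⊆ Ω) {y : E 2}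
    (hy : y ∈ frontier (level Ω u s)) : u y = s := by
  have hyK : y ∈ level Ω u s := (N.isCompact_level s).isClosed.frontier_subset hy
  refine le_antisymm hyK.2 (not_lt.1 fun h => hy.2 ?_)
  exact mem_interior_iff_mem_nhds.2 (N.level_mem_nhds (hK hyK) h)

lemma exists_map_lt (N : NormalizedPotential Ω u x₀ lam Lam) (hs : 0 < s) {ℓ : E 2 →L[ℝ] ℝ}
    (hℓ : ℓ ≠ 0) : ∃ y ∈ level Ω u s, ℓ y < ℓ x₀ := by
  obtain ⟨v, hv⟩ : ∃ v, ℓ v ≠ 0 := by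
    by_contra! h
    exact hℓ (ContinuousLinearMap.ext h)
  have h0 : Filter.Tendsto (fun t : ℝ => x₀ - (t * ℓ v) • v) (nhds 0) (nhds x₀) := by
    have : Continuous fun t : ℝ => x₀ - (t * ℓ v) • v := by fun_prop
    simpa using this.tendsto 0
  have h1 := h0.eventually (N.level_mem_nhds N.mem (s := s) (by rwa [N.u_pole]))
  obtain ⟨t, ht, ht0⟩ := ((h1.filter_mono nhdsWithin_le_nhds).and
    (self_mem_nhdsWithin (a := (0 : ℝ)) (s := Set.Ioi 0))).exists
  refine ⟨_, ht, ?_⟩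
  have : 0 < t * (ℓ v * ℓ v) := mul_pos ht0 (mul_self_pos.2 hv)
  simp only [map_sub, map_smul, smul_eq_mul]
  linarith

end NormalizedPotential

end

lemma convex_triangle {K : Set (E 2)} (hK : Convex ℝ K) {b a z : E 2} (hb : b ∈ K) (ha : a ∈ K)
    (hz : z ∈ K) {α β : ℝ} (hα : 0 ≤ α) (hβ : 0 ≤ β) (hαβ : α + β ≤ 1) :
    b + α • (a - b) + β • (z - b) ∈ K := by
  have := hK.sum_mem (t := Finset.univ) (w := ![1 - α - β, α, β]) (z := ![b, a, z])
    (by intro i _; fin_cases i <;> simp <;> linarith) (by simp [Fin.sum_univ_three]; ring)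
    (by intro i _; fin_cases i <;> simpa)
  convert this using 1
  simp [Fin.sum_univ_three]
  module

lemma omL_ne_zero {e : E 2} (he : e ≠ 0) : omL e ≠ 0 := by
  intro h
  apply he
  have h0 := congrArg (fun L : E 2 →L[ℝ] ℝ => L (EuclideanSpace.single 0 1)) h
  have h1 := congrArg (fun L : E 2 →L[ℝ] ℝ => L (EuclideanSpace.single 1 1)) h
  simp [om] at h0 h1
  rw [eq_coord e, h0, h1]
  simp

section

variable {Ω : Set (E 2)} {u : E 2 → ℝ} {x₀ : E 2} {lam Lam s : ℝ}

namespace NormalizedPotential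

/-- A triangle inscribed in a level set has area controlled by the height. -/
lemma om_sq_mul_le (N : NormalizedPotential Ω u x₀ lam Lam) (hs : 0 < s)
    (hK : level Ω u s ⊆ Ω) {a b z : E 2} (ha : a ∈ level Ω u s) (hb : b ∈ level Ω u s)
    (hz : z ∈ level Ω u s) : om (a - b) (z - b) ^ 2 * lam ≤ 1600 * s ^ 2 := by
  set e := a - b with he
  set f := z - b with hf
  by_cases hτ : om e f = 0
  · rw [hτ, zero_pow two_ne_zero, zero_mul]
    positivity
  have hτ' : om f e ≠ 0 := by rwa [om_swap, neg_ne_zero]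
  set X : E 2 →L[ℝ] ℝ := (om e f)⁻¹ • omL f with hX
  set Y : E 2 →L[ℝ] ℝ := (om f e)⁻¹ • omL e with hY
  have hXe : X e = 1 := by simp [hX, hτ]
  have hXf : X f = 0 := by simp [hX, om_self]
  have hYe : Y e = 0 := by simp [hY, om_self]
  have hYf : Y f = 1 := by simp [hY, hτ']
  set T : Set (E 2) := {y | (X y - (X b + 1 / 3)) ^ 2 + (Y y - (Y b + 1 / 3)) ^ 2 ≤ 1 / 18}
  have hc : Continuous fun y => (X y - (X b + 1 / 3)) ^ 2 + (Y y - (Y b + 1 / 3)) ^ 2 := by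
    fun_prop
  have hTK : T ⊆ level Ω u s := by
    intro y hy
    have hy' : (X y - (X b + 1 / 3)) ^ 2 + (Y y - (Y b + 1 / 3)) ^ 2 ≤ 1 / 18 := hy
    have h1 : planeMap b e f (X y - X b, Y y - Y b) = y := by
      have h2 := planeMap_coord hτ b y
      have h3 : om (y - b) f / om e f = X y - X b := by
        rw [← map_sub]; simp [hX]; field_simp
      have h4 : om e (y - b) / om e f = Y y - Y b := by
        rw [← map_sub]
        simp only [hY, smul_apply, omL_apply, smul_eq_mul]
        rw [om_swap e (y - b), om_swap e f]
        field_simp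
      rwa [h3, h4] at h2
    rw [← h1]
    refine convex_triangle (N.convex_level s) hb ha hz ?_ ?_ ?_
    · nlinarith [sq_nonneg (Y y - (Y b + 1 / 3))]
    · nlinarith [sq_nonneg (X y - (X b + 1 / 3))]
    · nlinarith [sq_nonneg (X y - X b - (Y y - Y b))]
  have hTc : IsCompact T :=
    (N.isCompact_level s).of_isClosed_subset (isClosed_le hc continuous_const) hTK
  have hTΩ : ∀ y ∈ interior T, y ∈ Ω := fun y hy => hK (hTK (interior_subset hy))
  have hval : ∀ y, paraboloid X Y (20 * s) (20 * s) (X b + 1 / 3) (Y b + 1 / 3)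
      (s - 20 * s / 18) y = s + 20 * s * ((X y - (X b + 1 / 3)) ^ 2 + (Y y - (Y b + 1 / 3)) ^ 2
        - 1 / 18) := by
    intro y
    simp only [paraboloid]
    ring
  set z₀ := b + (1 / 3 : ℝ) • e + (1 / 3 : ℝ) • f with hz₀
  have hz₀X : X z₀ - (X b + 1 / 3) = 0 := by simp [hz₀, hXe, hXf]
  have hz₀Y : Y z₀ - (Y b + 1 / 3) = 0 := by simp [hz₀, hYe, hYf]
  have hz₀T : z₀ ∈ T := by
    change (X z₀ - (X b + 1 / 3)) ^ 2 + (Y z₀ - (Y b + 1 / 3)) ^ 2 ≤ 1 / 18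
    rw [hz₀X, hz₀Y]
    norm_num
  have := le_four_mul_of_paraboloid_lt (u := u) hTc
    (N.continuousOn.mono fun y hy => (hTK hy).1) (fun y hy => N.contDiffAt_two (hTΩ y hy))
    (fun y hy => N.le_det y (hTΩ y hy)) (fun y hy => N.psd y (hTΩ y hy)) hXe hXf hYe hYf
    (α := 20 * s) (β := 20 * s) (p := X b + 1 / 3) (q := Y b + 1 / 3) (c := s - 20 * s / 18)
    (fun y hy => ?_) hz₀T ?_
  · linarith
  · have h1 : (X y - (X b + 1 / 3)) ^ 2 + (Y y - (Y b + 1 / 3)) ^ 2 = 1 / 18 :=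
      frontier_le_subset_eq hc continuous_const hy
    rw [hval, h1]
    linarith [(hTK (hTc.isClosed.frontier_subset hy)).2]
  · have h1 := N.nonneg z₀ (hTK hz₀T).1
    rw [hval, hz₀X, hz₀Y]
    linarith

/-- The minimum point of a convex potential is well inside its level sets. -/
lemma exists_balanced (N : NormalizedPotential Ω u x₀ lam Lam) (hs : 0 < s)
    (hK : level Ω u s ⊆ Ω) {ℓ : E 2 →L[ℝ] ℝ} (hℓ : ℓ ≠ 0) :
    ∃ b ∈ level Ω u s, ∀ p ∈ level Ω u s,
      lam / (8000 * Lam) * (ℓ p - ℓ x₀) ≤ ℓ x₀ - ℓ b := by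
  have hlam := N.lam_pos
  have hLam : 0 < Lam := hlam.trans_le ((N.le_det x₀ N.mem).trans (N.det_le x₀ N.mem))
  have hKc := N.isCompact_level s
  have hx₀ := N.mem_level hs.le
  obtain ⟨b, hb, hbmin⟩ := hKc.exists_isMinOn ⟨x₀, hx₀⟩ ℓ.continuous.continuousOn
  obtain ⟨a, ha, hamax⟩ := hKc.exists_isMaxOn ⟨x₀, hx₀⟩ ℓ.continuous.continuousOn
  have hbmin' : ∀ y ∈ level Ω u s, ℓ b ≤ ℓ y := fun y hy => hbmin hy
  have hamax' : ∀ y ∈ level Ω u s, ℓ y ≤ ℓ a := fun y hy => hamax hy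
  refine ⟨b, hb, fun p hp => ?_⟩
  set c := lam / (8000 * Lam) with hc
  have hc0 : 0 < c := by positivity
  obtain ⟨y₀, hy₀, hy₀x⟩ := N.exists_map_lt hs hℓ
  set R := ℓ a - ℓ b with hR
  have hR0 : 0 < R := by linarith [hbmin' y₀ hy₀, hamax' x₀ hx₀]
  suffices h : c * R ≤ ℓ x₀ - ℓ b by
    refine le_trans (mul_le_mul_of_nonneg_left ?_ hc0.le) h
    linarith [hbmin' x₀ hx₀, hamax' p hp]
  by_contra! hcon
  set e := a - b with he
  have he0 : e ≠ 0 := by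
    rintro h
    have : ℓ e = R := by rw [he, map_sub]
    rw [h, map_zero] at this
    linarith
  obtain ⟨z, hz, hzmax⟩ := hKc.exists_isMaxOn ⟨x₀, hx₀⟩
    (f := fun y => |omL e y - omL e b|) (by fun_prop)
  set f := z - b with hf
  have hzmax' : ∀ y ∈ level Ω u s, |omL e y - omL e b| ≤ |om f e| := by
    intro y hy
    have h1 : |omL e y - omL e b| ≤ |omL e z - omL e b| := hzmax hy
    rwa [← map_sub (omL e) z b, omL_apply e (z - b)] at h1
  have hτ' : om f e ≠ 0 := by
    intro h
    obtain ⟨y, hy, hyx⟩ := N.exists_map_lt hs (omL_ne_zero he0)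
    have h1 := hzmax' y hy
    have h2 := hzmax' x₀ hx₀
    rw [h, abs_zero, abs_nonpos_iff] at h1 h2
    linarith
  set X : E 2 →L[ℝ] ℝ := R⁻¹ • ℓ with hX
  set Y : E 2 →L[ℝ] ℝ := (om f e)⁻¹ • omL e with hY
  set f' := f - X f • e with hf'
  have hXe : X e = 1 := by
    simp only [hX, smul_apply, he, map_sub, smul_eq_mul]
    rw [← mul_sub, ← hR]
    exact inv_mul_cancel₀ hR0.ne'
  have hYe : Y e = 0 := by simp [hY, om_self]
  have hYf : Y f = 1 := by simp [hY, hτ']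
  have hXf' : X f' = 0 := by simp [hf', hXe]
  have hYf' : Y f' = 1 := by simp [hf', hYe, hYf]
  have hom : om e f' = om e f := by simp only [hf', om]; simp; ring
  have hXb : ∀ y, X y - X b = (ℓ y - ℓ b) / R := by
    intro y; simp only [hX, smul_apply, smul_eq_mul]; field_simp
  have hYb : ∀ y, Y y - Y b = (omL e y - omL e b) / om f e := by
    intro y; simp only [hY, smul_apply, smul_eq_mul]; field_simp
  have key := four_mul_le_of_lt_paraboloid (u := u) hKc (N.continuousOn.mono fun y hy => hy.1)
    (fun y hy => N.contDiffAt_two (hK (interior_subset hy)))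
    (fun y hy => N.det_le y (hK (interior_subset hy))) hXe hXf' hYe hYf'
    (α := s / (4 * c)) (β := s / 4) (p := X b + 1 / 2) (q := Y b)
    (c := s - s / 4 - s / (4 * c) / 4) (by positivity) (by positivity) (fun y hy => ?_) hx₀ ?_
  · have h1 := N.om_sq_mul_le hs hK ha hb hz
    rw [hom] at key
    have h2 : 4 * (s / (4 * c)) * (s / 4) * lam ≤ 1600 * s ^ 2 * Lam := by
      calc _ ≤ om e f ^ 2 * Lam * lam := mul_le_mul_of_nonneg_right key hlam.le
        _ = om e f ^ 2 * lam * Lam := by ring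
        _ ≤ _ := mul_le_mul_of_nonneg_right h1 hLam.le
    have h3 : 4 * (s / (4 * c)) * (s / 4) * lam = 2000 * s ^ 2 * Lam := by
      rw [hc]; field_simp; norm_num
    have h4 : 0 < s ^ 2 * Lam := by positivity
    linarith
  · have hyK := hKc.isClosed.frontier_subset hy
    rw [N.eq_of_mem_frontier hK hy]
    have h1 : 0 ≤ X y - X b := by
      rw [hXb]; exact div_nonneg (by linarith [hbmin' y hyK]) hR0.le
    have h2 : X y - X b ≤ 1 := by
      rw [hXb, div_le_one hR0]; linarith [hamax' y hyK]
    have h3 : (Y y - Y b) ^ 2 ≤ 1 := by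
      rw [sq_le_one_iff_abs_le_one, hYb, abs_div, div_le_one (abs_pos.2 hτ')]
      exact hzmax' y hyK
    have h4 : (X y - (X b + 1 / 2)) ^ 2 ≤ 1 / 4 := by nlinarith
    have h5 := mul_le_mul_of_nonneg_left h3 (show 0 ≤ s / 4 by positivity)
    have h6 := mul_le_mul_of_nonneg_left h4 (show 0 ≤ s / (4 * c) by positivity)
    simp only [paraboloid]
    linarith
  · rw [N.u_pole]
    have h1 : X x₀ - X b < c := by
      rw [hXb, div_lt_iff₀ hR0]; exact hcon
    have h2 : -c < (X x₀ - (X b + 1 / 2)) ^ 2 - 1 / 4 := by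
      nlinarith [sq_nonneg (X x₀ - X b)]
    have h3 := mul_lt_mul_of_pos_left h2 (show 0 < s / (4 * c) by positivity)
    have h4 : s / (4 * c) * -c = -(s / 4) := by field_simp
    have h5 : 0 ≤ s / 4 * (Y x₀ - Y b) ^ 2 := by positivity
    simp only [paraboloid]
    linarith

/-- Level sets contain a proportion of their reflection through the minimum point. -/
lemma reflect_mem_level (N : NormalizedPotential Ω u x₀ lam Lam) (hs : 0 < s)
    (hK : level Ω u s ⊆ Ω) {p : E 2} (hp : p ∈ level Ω u s) :
    x₀ - (lam / (8000 * Lam)) • (p - x₀) ∈ level Ω u s := by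
  by_contra hcon
  obtain ⟨ℓ, r, hr, hℓ⟩ := geometric_hahn_banach_point_closed (N.convex_level s)
    (N.isCompact_level s).isClosed hcon
  have hℓ0 : ℓ ≠ 0 := by
    rintro rfl
    have := hℓ p hp
    simp at hr this
    linarith
  obtain ⟨b, hb, hbal⟩ := N.exists_balanced hs hK hℓ0
  have h1 := hbal p hp
  have h2 := hℓ b hb
  simp only [map_sub, map_smul, smul_eq_mul] at hr
  linarith

end NormalizedPotential

end

section

variable {Ω : Set (E 2)} {u : E 2 → ℝ} {x₀ : E 2} {lam Lam s : ℝ}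

namespace NormalizedPotential

lemma pos_of_mem (N : NormalizedPotential Ω u x₀ lam Lam) : 0 < Lam ∧ lam ≤ Lam :=
  have h := (N.le_det x₀ N.mem).trans (N.det_le x₀ N.mem)
  ⟨N.lam_pos.trans_le h, h⟩

/-- Level sets contain triangles of area comparable to the height. -/
lemma exists_large_triangle (N : NormalizedPotential Ω u x₀ lam Lam) (hs : 0 < s)
    (hK : level Ω u s ⊆ Ω) : ∃ p ∈ level Ω u s, ∃ q ∈ level Ω u s,
      s ≤ 2 * Real.sqrt Lam * |om (p - x₀) (q - x₀)| := by
  have hLam := N.pos_of_mem.1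
  have hKc := N.isCompact_level s
  have hx₀ := N.mem_level hs.le
  have hcont : Continuous fun z : E 2 × E 2 => |om (z.1 - x₀) (z.2 - x₀)| := by
    unfold om; fun_prop
  obtain ⟨⟨p, q⟩, ⟨hp, hq⟩, hmax⟩ := (hKc.prod hKc).exists_isMaxOn ⟨(x₀, x₀), hx₀, hx₀⟩
    hcont.continuousOn
  set e := p - x₀ with he
  set f := q - x₀ with hf
  have hmax' : ∀ y ∈ level Ω u s, ∀ z ∈ level Ω u s, |om (y - x₀) (z - x₀)| ≤ |om e f| :=
    fun y hy z hz => hmax (Set.mk_mem_prod hy hz)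
  have hτ : om e f ≠ 0 := by
    intro h
    obtain ⟨v, hv⟩ : ∃ v : E 2, v ≠ 0 := exists_ne 0
    obtain ⟨y, hy, hyx⟩ := N.exists_map_lt hs (omL_ne_zero hv)
    have hy0 : y - x₀ ≠ 0 := by
      rintro h
      rw [sub_eq_zero.1 h] at hyx
      exact lt_irrefl _ hyx
    obtain ⟨z, hz, hzx⟩ := N.exists_map_lt hs (omL_ne_zero hy0)
    have h1 := hmax' z hz y hy
    rw [h, abs_zero, abs_nonpos_iff, ← omL_apply, map_sub] at h1
    linarith
  have hτ' : om f e ≠ 0 := by rwa [om_swap, neg_ne_zero]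
  refine ⟨p, hp, q, hq, ?_⟩
  set X : E 2 →L[ℝ] ℝ := (om e f)⁻¹ • omL f with hX
  set Y : E 2 →L[ℝ] ℝ := (om f e)⁻¹ • omL e with hY
  have hXe : X e = 1 := by simp [hX, hτ]
  have hXf : X f = 0 := by simp [hX, om_self]
  have hYe : Y e = 0 := by simp [hY, om_self]
  have hYf : Y f = 1 := by simp [hY, hτ']
  have key := four_mul_le_of_lt_paraboloid (u := u) hKc (N.continuousOn.mono fun y hy => hy.1)
    (fun y hy => N.contDiffAt_two (hK (interior_subset hy)))
    (fun y hy => N.det_le y (hK (interior_subset hy))) hXe hXf hYe hYf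
    (α := s / 4) (β := s / 4) (p := X x₀) (q := Y x₀)
    (c := s - s / 4 - s / 4) (by positivity) (by positivity) (fun y hy => ?_) hx₀ ?_
  · have h1 : (s / 2) ^ 2 ≤ (Real.sqrt Lam * |om e f|) ^ 2 := by
      rw [mul_pow, Real.sq_sqrt hLam.le, sq_abs]
      linarith
    have h2 := (pow_le_pow_iff_left₀ (by positivity) (by positivity) two_ne_zero).1 h1
    linarith
  · have hyK := hKc.isClosed.frontier_subset hy
    rw [N.eq_of_mem_frontier hK hy]
    have h1 : (X y - X x₀) ^ 2 ≤ 1 := by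
      rw [sq_le_one_iff_abs_le_one, ← map_sub, hX, smul_apply, omL_apply, smul_eq_mul, abs_mul,
        abs_inv, inv_mul_le_one₀ (abs_pos.2 hτ)]
      exact hmax' y hyK q hq
    have h2 : (Y y - Y x₀) ^ 2 ≤ 1 := by
      rw [sq_le_one_iff_abs_le_one, ← map_sub, hY, smul_apply, omL_apply, smul_eq_mul, abs_mul,
        abs_inv, inv_mul_le_one₀ (abs_pos.2 hτ'), om_swap e f, abs_neg]
      exact hmax' y hyK p hp
    have h3 := mul_le_mul_of_nonneg_left h1 (show 0 ≤ s / 4 by positivity)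
    have h4 := mul_le_mul_of_nonneg_left h2 (show 0 ≤ s / 4 by positivity)
    simp only [paraboloid]
    linarith
  · rw [N.u_pole]
    simp only [paraboloid, sub_self]
    linarith

/-- The constant in `exists_frame`. -/
def frameConst (lam Lam : ℝ) : ℝ := (lam / (8000 * Lam)) ^ 2 / (32 * Real.sqrt Lam)

lemma frameConst_pos (N : NormalizedPotential Ω u x₀ lam Lam) : 0 < frameConst lam Lam := by
  have := N.pos_of_mem.1
  have := N.lam_pos
  unfold frameConst
  positivity

/-- Level sets contain a parallelogram centred at the minimum point with area comparable to the
height. -/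
theorem exists_frame (N : NormalizedPotential Ω u x₀ lam Lam) (hs : 0 < s)
    (hK : level Ω u s ⊆ Ω) : ∃ e f, GoodFrame u x₀ e f s ∧
      (∀ a ∈ Set.Icc (-1 : ℝ) 1, ∀ b ∈ Set.Icc (-1 : ℝ) 1, u (planeMap x₀ e f (a, b)) < s) ∧
      frameConst lam Lam * s ≤ |om e f| := by
  obtain ⟨hLam, hlL⟩ := N.pos_of_mem
  have hlam := N.lam_pos
  obtain ⟨p, hp, q, hq, hpq⟩ := N.exists_large_triangle hs hK
  set c := lam / (8000 * Lam) with hc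
  have hc0 : 0 < c := by positivity
  have hc1 : c ≤ 1 := by
    rw [hc, div_le_one (by positivity)]; linarith
  have hconv := N.convex_level s
  have hx₀ := N.mem_level hs.le
  have half : ∀ r ∈ level Ω u s, ∀ a ∈ Set.Icc (-2 : ℝ) 2,
      x₀ + a • ((c / 2) • (r - x₀)) ∈ level Ω u s := by
    intro r hr a ha
    have h1 := N.reflect_mem_level hs hK hr
    rw [← hc] at h1
    have h2 := convex_triangle hconv h1 hr hr (α := (c + a * (c / 2)) / (1 + c)) (β := 0)
      (div_nonneg (by nlinarith [ha.1]) (by positivity)) le_rfl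
      (by rw [add_zero, div_le_one (by positivity)]; nlinarith [ha.2])
    convert h2 using 1
    have h3 : x₀ - c • (r - x₀) + ((c + a * (c / 2)) / (1 + c)) • (r - (x₀ - c • (r - x₀)))
        = x₀ + ((c + a * (c / 2)) / (1 + c) * (1 + c) - c) • (r - x₀) := by module
    rw [zero_smul, add_zero, h3, div_mul_cancel₀ _ (by positivity)]
    module
  set e := (c / 4) • (p - x₀) with he
  set f := (c / 4) • (q - x₀) with hf
  have hbox : ∀ a ∈ Set.Icc (-2 : ℝ) 2, ∀ b ∈ Set.Icc (-2 : ℝ) 2,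
      planeMap x₀ e f (a, b) ∈ level Ω u s := by
    intro a ha b hb
    have := hconv (half p hp a ha) (half q hq b hb) (a := 1 / 2) (b := 1 / 2) (by norm_num)
      (by norm_num) (by norm_num)
    convert this using 1
    simp only [planeMap, he, hf]
    module
  refine ⟨e, f, fun a ha b hb => ?_, fun a ha b hb => ?_, ?_⟩
  · have h := hbox a ha b hb
    exact ⟨N.contDiffAt_two (hK h), N.psd _ (hK h), N.nonneg _ h.1, h.2⟩
  · have h := hbox (2 * a) ⟨by linarith [ha.1], by linarith [ha.2]⟩ (2 * b)
      ⟨by linarith [hb.1], by linarith [hb.2]⟩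
    have h1 := N.convexOn.2 hx₀.1 h.1 (show (0 : ℝ) ≤ 1 / 2 by norm_num)
      (show (0 : ℝ) ≤ 1 / 2 by norm_num) (by norm_num)
    have h2 : (1 / 2 : ℝ) • x₀ + (1 / 2 : ℝ) • planeMap x₀ e f (2 * a, 2 * b)
        = planeMap x₀ e f (a, b) := by
      simp only [planeMap]; module
    rw [h2, N.u_pole, smul_eq_mul, smul_eq_mul] at h1
    linarith [h.2]
  · have h1 : om e f = (c / 4) ^ 2 * om (p - x₀) (q - x₀) := by
      simp only [he, hf, om, PiLp.smul_apply, smul_eq_mul]; ring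
    rw [h1, abs_mul, abs_of_nonneg (by positivity)]
    have h2 : 0 < Real.sqrt Lam := Real.sqrt_pos.2 hLam
    calc frameConst lam Lam * s
        ≤ frameConst lam Lam * (2 * Real.sqrt Lam * |om (p - x₀) (q - x₀)|) :=
          mul_le_mul_of_nonneg_left hpq N.frameConst_pos.le
      _ = _ := by
        rw [frameConst, ← hc]; field_simp; ring

end NormalizedPotential

end

lemma D2_of_line {f : E 2 → ℝ} {x v : E 2} (h : ContDiffAt ℝ 2 f x) {φ : ℝ → ℝ} {c : ℝ}
    (h1 : ∀ᶠ t in nhds 0, HasDerivAt (fun s : ℝ => f (x + s • v)) (φ t) t)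
    (h2 : HasDerivAt φ c 0) : D2 f x v v = c := by
  have hx : x + (0 : ℝ) • v = x := by simp
  have h3 : ∀ᶠ t in nhds (0 : ℝ), ContDiffAt ℝ 2 f (x + t • v) := by
    have hc : Filter.Tendsto (fun s : ℝ => x + s • v) (nhds 0) (nhds x) := by
      simpa using (hasDerivAt_line x v 0).continuousAt.tendsto
    exact hc.eventually (eventually_contDiffAt h)
  have h4 : φ =ᶠ[nhds 0] fun t => fderiv ℝ f (x + t • v) v := by
    filter_upwards [h1, h3] with t ht ht'
    exact ht.unique (hasDerivAt_comp_line (ht'.differentiableAt (by norm_num)))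
  have h5 := hasDerivAt_fderiv_comp_line (f := f) (p := x) (v := v) (w := v) (t := 0) (by rwa [hx])
  rw [hx] at h5
  exact (h5.congr_of_eventuallyEq h4).unique h2

section

variable {Ω : Set (E 2)} {u : E 2 → ℝ} {x₀ : E 2} {lam Lam s : ℝ}

/-- The upper barrier used to show strict convexity in the plane. -/
def logBarrier (x₀ e f : E 2) (S K κ μ r : ℝ) (y : E 2) : ℝ :=
  S + -omL e (y - x₀) * (K + κ * (omL f (y - x₀) - r / 2) ^ 2
    + μ * Real.log (-omL e (y - x₀) / r))

lemma contDiffAt_logBarrier {e f : E 2} {S K κ μ r : ℝ} (hr : 0 < r) {y : E 2}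
    (hy : 0 < -omL e (y - x₀)) : ContDiffAt ℝ 2 (logBarrier x₀ e f S K κ μ r) y := by
  have h1 : ContDiffAt ℝ 2 (fun y : E 2 => -omL e (y - x₀)) y := by fun_prop
  have h2 : ContDiffAt ℝ 2 (fun y : E 2 => omL f (y - x₀)) y := by fun_prop
  exact contDiffAt_const.add (h1.mul ((contDiffAt_const.add (contDiffAt_const.mul
    ((h2.sub contDiffAt_const).pow 2))).add (contDiffAt_const.mul
      ((h1.div_const r).log (div_pos hy hr).ne'))))

lemma D2_logBarrier {e f : E 2} (hef : om e f = 1) {S K κ μ r : ℝ} (hr : 0 < r) {y : E 2}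
    (hy : 0 < -omL e (y - x₀)) :
    D2 (logBarrier x₀ e f S K κ μ r) y e e = 2 * κ * -omL e (y - x₀) ∧
    D2 (logBarrier x₀ e f S K κ μ r) y f f = μ / -omL e (y - x₀) := by
  have hfe : om f e = -1 := by rw [om_swap, hef]
  have hc := contDiffAt_logBarrier (f := f) (S := S) (K := K) (κ := κ) (μ := μ) hr hy
  set b := -omL e (y - x₀) with hb
  set a := omL f (y - x₀) with ha
  constructor
  · have h1 : ∀ t : ℝ, logBarrier x₀ e f S K κ μ r (y + t • e)
        = S + b * (K + κ * (a + t - r / 2) ^ 2 + μ * Real.log (b / r)) := by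
      intro t
      have e1 : y + t • e - x₀ = (y - x₀) + t • e := by abel
      have e2 : -omL e (y + t • e - x₀) = b := by
        rw [e1, map_add, map_smul, omL_apply e e, om_self, hb]; simp
      have e3 : omL f (y + t • e - x₀) = a + t := by
        rw [e1, map_add, map_smul, omL_apply f e, hef, ha]; simp
      simp only [logBarrier]
      rw [e2, e3]
    refine D2_of_line hc (φ := fun t => b * (κ * (2 * (a + t - r / 2))))
      (Filter.Eventually.of_forall fun t => ?_) ?_
    · simp only [h1]
      have hd : HasDerivAt (fun t : ℝ => a + t - r / 2) 1 t :=
        ((hasDerivAt_id t).const_add a).sub_const _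
      refine (((((hd.fun_pow 2).const_mul κ).const_add K).add_const _).const_mul b |>.const_add
        S).congr_deriv ?_
      simp
    · have hd : HasDerivAt (fun t : ℝ => a + t - r / 2) 1 0 :=
        ((hasDerivAt_id (0 : ℝ)).const_add a).sub_const _
      refine (((hd.const_mul 2).const_mul κ).const_mul b).congr_deriv ?_
      ring
  · have h1 : ∀ t : ℝ, logBarrier x₀ e f S K κ μ r (y + t • f)
        = S + (b + t) * (K + κ * (a - r / 2) ^ 2 + μ * Real.log ((b + t) / r)) := by
      intro t
      have e1 : y + t • f - x₀ = (y - x₀) + t • f := by abel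
      have e2 : -omL e (y + t • f - x₀) = b + t := by
        rw [e1, map_add, map_smul, omL_apply e f, hfe, hb]; simp; ring
      have e3 : omL f (y + t • f - x₀) = a := by
        rw [e1, map_add, map_smul, omL_apply f f, om_self, ha]; simp
      simp only [logBarrier]
      rw [e2, e3]
    set C := K + κ * (a - r / 2) ^ 2
    have hlog : ∀ t : ℝ, 0 < b + t →
        HasDerivAt (fun t : ℝ => Real.log ((b + t) / r)) (1 / (b + t)) t := by
      intro t ht
      have hd : HasDerivAt (fun t : ℝ => (b + t) / r) (1 / r) t :=
        ((hasDerivAt_id t).const_add b).div_const r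
      refine (hd.log (div_pos ht hr).ne').congr_deriv ?_
      field_simp
    refine D2_of_line hc (φ := fun t => C + μ * Real.log ((b + t) / r) + μ) ?_ ?_
    · have hpos : ∀ᶠ t : ℝ in nhds 0, 0 < b + t := by
        have : Filter.Tendsto (fun t : ℝ => b + t) (nhds 0) (nhds b) := by
          have h2 := (show Continuous fun t : ℝ => b + t by fun_prop).tendsto 0
          simpa only [add_zero] using h2
        exact this.eventually (lt_mem_nhds hy)
      filter_upwards [hpos] with t ht
      simp only [h1]
      have hd : HasDerivAt (fun t : ℝ => b + t) 1 t := (hasDerivAt_id t).const_add b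
      refine ((hd.mul (((hlog t ht).const_mul μ).const_add C)).const_add S).congr_deriv ?_
      field_simp
    · refine ((((hlog 0 (by simpa using hy)).const_mul μ).const_add C).add_const μ).congr_deriv ?_
      rw [add_zero]; ring

end

section

variable {Ω : Set (E 2)} {u : E 2 → ℝ} {x₀ : E 2} {lam Lam s : ℝ}

namespace NormalizedPotential

lemma planeMap_smul_le (N : NormalizedPotential Ω u x₀ lam Lam) {e f : E 2} {r M a b : ℝ}
    (hr : 0 < r) (hb0 : 0 ≤ b) (hbr : b ≤ r) (h0 : planeMap x₀ e f (a, 0) ∈ Ω)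
    (h1 : planeMap x₀ e f (a, r) ∈ Ω) (hs0 : 0 ≤ s) (hs : u (planeMap x₀ e f (a, 0)) ≤ s)
    (hM : u (planeMap x₀ e f (a, r)) ≤ M) : u (planeMap x₀ e f (a, b)) ≤ s + M / r * b := by
  have hbr' : b / r ≤ 1 := (div_le_one hr).2 hbr
  have hbr0 : 0 ≤ b / r := by positivity
  have h2 := N.convexOn.2 (subset_closure h0) (subset_closure h1)
    (show 0 ≤ 1 - b / r by linarith) hbr0 (by ring)
  have h3 : (1 - b / r) • planeMap x₀ e f (a, 0) + (b / r) • planeMap x₀ e f (a, r)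
      = planeMap x₀ e f (a, b) := by
    have h4 : b / r * r = b := div_mul_cancel₀ _ hr.ne'
    have h5 : (1 - b / r) • planeMap x₀ e f (a, 0) + (b / r) • planeMap x₀ e f (a, r)
      = x₀ + a • e + (b / r * r) • f := by simp only [planeMap]; module
    rw [h5, h4, planeMap]
  rw [h3, smul_eq_mul, smul_eq_mul] at h2
  have h4 := mul_le_mul_of_nonneg_left hs (show 0 ≤ 1 - b / r by linarith)
  have h5 := mul_le_mul_of_nonneg_left hM hbr0
  have h6 : M / r * b = b / r * M := by ring
  nlinarith

/-- In the plane, a convex potential with positive Monge-Ampère measure is quantitatively not flat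
along segments. -/
lemma lt_of_segment (N : NormalizedPotential Ω u x₀ lam Lam) {e f : E 2} {r M : ℝ}
    (hef : om e f = 1) (hr : 0 < r) (hM : 0 < M)
    (hbox : ∀ a ∈ Set.Icc 0 r, ∀ b ∈ Set.Icc 0 r, planeMap x₀ e f (a, b) ∈ Ω)
    (hbd : ∀ y ∈ Ω, u y ≤ M) (hseg : ∀ a ∈ Set.Icc 0 r, u (planeMap x₀ e f (a, 0)) ≤ s) :
    M * Real.exp (-(400 * M ^ 2 / (lam * r ^ 4) + 4)) < s := by
  by_contra! hcon
  have hlam := N.lam_pos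
  set L := 400 * M ^ 2 / (lam * r ^ 4) + 4 with hL
  have hL4 : 4 ≤ L := by
    have : 0 ≤ 400 * M ^ 2 / (lam * r ^ 4) := by positivity
    linarith
  have hL0 : 0 < L := by linarith
  set K := M / r with hK
  set h := r * Real.exp (-L) with hh
  set μ := r * Real.sqrt (lam / (16 * L)) with hμ
  set κ := 4 * μ * L / r ^ 2 with hκ
  set S := K * h + h * μ * L with hS
  have hK0 : 0 < K := by positivity
  have hh0 : 0 < h := by positivity
  have hμ0 : 0 < μ := by positivity
  have hκ0 : 0 < κ := by positivity
  have hsK : s ≤ K * h := by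
    refine hcon.trans (le_of_eq ?_)
    rw [hK, hh]; field_simp
  have hs0 : 0 ≤ s := by
    refine (N.nonneg _ (subset_closure (hbox 0 ?_ 0 ?_))).trans (hseg 0 ?_) <;> simp [hr.le]
  have hSK : s + h * μ * L ≤ S := by linarith
  have hμsq : μ ^ 2 * (16 * L) = lam * r ^ 2 := by
    rw [hμ, mul_pow, Real.sq_sqrt (by positivity)]; field_simp
  set A : E 2 → ℝ := fun y => omL f (y - x₀) with hA
  set B : E 2 → ℝ := fun y => -omL e (y - x₀) with hB
  have hAc : Continuous A := by fun_prop
  have hBc : Continuous B := by fun_prop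
  have hcoord : ∀ y, planeMap x₀ e f (A y, B y) = y := by
    intro y
    have h1 := planeMap_coord (e := e) (f := f) (by rw [hef]; exact one_ne_zero) x₀ y
    rw [hef, div_one, div_one] at h1
    rwa [om_swap (y - x₀) e, ← omL_apply e, ← omL_apply f] at h1
  set T : Set (E 2) := ({y | 0 ≤ A y} ∩ {y | A y ≤ r}) ∩ ({y | h ≤ B y} ∩ {y | B y ≤ r}) with hT
  have hTcl : IsClosed T := ((isClosed_le continuous_const hAc).inter
    (isClosed_le hAc continuous_const)).inter ((isClosed_le continuous_const hBc).inter
    (isClosed_le hBc continuous_const))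
  have hTmem : ∀ y ∈ T, 0 ≤ A y ∧ A y ≤ r ∧ h ≤ B y ∧ B y ≤ r := fun y hy =>
    ⟨hy.1.1, hy.1.2, hy.2.1, hy.2.2⟩
  have hTc : IsCompact T := by
    refine ((isCompact_Icc.prod isCompact_Icc).image
      (continuous_planeMap x₀ e f)).of_isClosed_subset hTcl fun y hy =>
        ⟨(A y, B y), ⟨⟨(hTmem y hy).1, (hTmem y hy).2.1⟩,
          ⟨(hTmem y hy).2.2.1, (hTmem y hy).2.2.2⟩⟩, hcoord y⟩
  have hTΩ : T ⊆ Ω := fun y hy => by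
    obtain ⟨h1, h2, h3, h4⟩ := hTmem y hy
    rw [← hcoord y]
    exact hbox _ ⟨h1, h2⟩ _ ⟨hh0.le.trans h3, h4⟩
  have hBpos : ∀ y ∈ T, 0 < B y := fun y hy => hh0.trans_le (hTmem y hy).2.2.1
  have hub : ∀ y ∈ T, u y ≤ s + K * B y := fun y hy => by
    obtain ⟨h1, h2, h3, h4⟩ := hTmem y hy
    have h5 := N.planeMap_smul_le (e := e) (f := f) (a := A y) hr (hh0.le.trans h3) h4
      (hbox _ ⟨h1, h2⟩ 0 ⟨le_rfl, hr.le⟩) (hbox _ ⟨h1, h2⟩ r ⟨hr.le, le_rfl⟩) hs0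
      (hseg _ ⟨h1, h2⟩) (hbd _ (hbox _ ⟨h1, h2⟩ r ⟨hr.le, le_rfl⟩))
    rwa [hcoord] at h5
  have hwc : ∀ y ∈ T, ContDiffAt ℝ 2 (logBarrier x₀ e f S K κ μ r) y := fun y hy =>
    contDiffAt_logBarrier hr (hBpos y hy)
  have hw : ∀ y, logBarrier x₀ e f S K κ μ r y = S + B y * (K + κ * (A y - r / 2) ^ 2
    + μ * Real.log (B y / r)) := fun y => rfl
  have hfr : ∀ y ∈ frontier T, u y ≤ logBarrier x₀ e f S K κ μ r y := by
    intro y hy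
    have hyT := hTcl.frontier_subset hy
    obtain ⟨h1, h2, h3, h4⟩ := hTmem y hyT
    have hB0 := hBpos y hyT
    have hlog : -L ≤ Real.log (B y / r) := by
      rw [Real.le_log_iff_exp_le (by positivity), le_div_iff₀ hr]
      linarith
    have hlogμ := mul_le_mul_of_nonneg_left hlog hμ0.le
    have hhμ : 0 ≤ h * μ * L := by positivity
    have hsq : 0 ≤ κ * (A y - r / 2) ^ 2 := by positivity
    have hκr : κ * (r / 2) ^ 2 = μ * L := by rw [hκ]; field_simp; norm_num
    refine (hub y hyT).trans ?_
    rw [hw]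
    have hcases : A y = 0 ∨ A y = r ∨ B y = h ∨ B y = r := by
      by_contra! hne
      refine hy.2 (mem_interior.2 ⟨({y | 0 < A y} ∩ {y | A y < r}) ∩
        ({y | h < B y} ∩ {y | B y < r}), ?_, ?_, ?_⟩)
      · rintro x ⟨⟨p1, p2⟩, p3, p4⟩
        exact ⟨⟨le_of_lt (show 0 < A x from p1), le_of_lt (show A x < r from p2)⟩,
          le_of_lt (show h < B x from p3), le_of_lt (show B x < r from p4)⟩
      · exact ((isOpen_lt continuous_const hAc).inter (isOpen_lt hAc continuous_const)).inter
          ((isOpen_lt continuous_const hBc).inter (isOpen_lt hBc continuous_const))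
      · exact ⟨⟨lt_of_le_of_ne h1 hne.1.symm, lt_of_le_of_ne h2 hne.2.1⟩,
          lt_of_le_of_ne h3 hne.2.2.1.symm, lt_of_le_of_ne h4 hne.2.2.2⟩
    rcases hcases with hc | hc | hc | hc
    · have h5 : κ * (A y - r / 2) ^ 2 = μ * L := by rw [hc, ← hκr]; ring
      have h6 : 0 ≤ B y * (κ * (A y - r / 2) ^ 2 + μ * Real.log (B y / r)) :=
        mul_nonneg hB0.le (by linarith)
      linarith
    · have h5 : κ * (A y - r / 2) ^ 2 = μ * L := by rw [hc, ← hκr]; ring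
      have h6 : 0 ≤ B y * (κ * (A y - r / 2) ^ 2 + μ * Real.log (B y / r)) :=
        mul_nonneg hB0.le (by linarith)
      linarith
    · have h6 : 0 ≤ B y * (κ * (A y - r / 2) ^ 2 + (μ * Real.log (B y / r) + μ * L)) :=
        mul_nonneg hB0.le (by linarith)
      have h7 : B y * (μ * L) = h * μ * L := by rw [hc]; ring
      linarith
    · have h5 : Real.log (B y / r) = 0 := by rw [hc, div_self hr.ne', Real.log_one]
      have h6 : 0 ≤ B y * (κ * (A y - r / 2) ^ 2) := mul_nonneg hB0.le hsq
      rw [h5]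
      linarith
  set b := r * Real.exp (-(L / 2)) with hb
  have hb0 : 0 < b := by positivity
  have hbh : 4 * h ≤ b := by
    have h1 : Real.exp (-L) = Real.exp (-(L / 2)) * Real.exp (-(L / 2)) := by
      rw [← Real.exp_add]; ring_nf
    have h2 : Real.exp (-(L / 2)) ≤ 1 / 4 := by
      have h3 : 4 ≤ Real.exp (L / 2) := by
        have := Real.quadratic_le_exp_of_nonneg (show 0 ≤ L / 2 by linarith)
        nlinarith
      rw [Real.exp_neg, one_div]
      exact inv_anti₀ (by norm_num) h3
    have h3 := mul_le_mul_of_nonneg_left h2 hb0.le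
    have h4 : h = b * Real.exp (-(L / 2)) := by rw [hh, hb, h1]; ring
    linarith
  have hbr : b ≤ r := by
    have : Real.exp (-(L / 2)) ≤ 1 := Real.exp_le_one_iff.2 (by linarith)
    nlinarith
  set z₀ := planeMap x₀ e f (r / 2, b) with hz₀
  have hz₀' : z₀ - x₀ = (r / 2) • e + b • f := by
    rw [hz₀]; simp only [planeMap]; abel
  have hAz : A z₀ = r / 2 := by
    rw [show A z₀ = omL f (z₀ - x₀) from rfl, hz₀', map_add, map_smul, map_smul, omL_apply,
      omL_apply, hef, om_self]
    simp
  have hBz : B z₀ = b := by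
    rw [show B z₀ = -omL e (z₀ - x₀) from rfl, hz₀', map_add, map_smul, map_smul, omL_apply,
      omL_apply, om_swap e f, hef, om_self]
    simp
  have hz₀T : z₀ ∈ T := by
    refine ⟨⟨show 0 ≤ A z₀ from ?_, show A z₀ ≤ r from ?_⟩, show h ≤ B z₀ from ?_,
      show B z₀ ≤ r from ?_⟩ <;> first | rw [hAz] | rw [hBz]
    all_goals linarith
  have hμL : 5 * K < μ * L := by
    have h1 : (5 * K) ^ 2 < (μ * L) ^ 2 := by
      have h2 : (μ * L) ^ 2 = lam * r ^ 2 / 16 * L := by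
        rw [← hμsq]; ring
      have h3 : lam * r ^ 2 / 16 * (400 * M ^ 2 / (lam * r ^ 4)) = (5 * K) ^ 2 := by
        rw [hK]; field_simp; norm_num
      have h4 : 0 < lam * r ^ 2 / 16 * 4 := by positivity
      rw [h2, hL, mul_add, h3]
      linarith
    exact lt_of_pow_lt_pow_left₀ 2 (by positivity) h1
  have hneg : logBarrier x₀ e f S K κ μ r z₀ < 0 := by
    have h1 : Real.log (b / r) = -(L / 2) := by
      rw [hb, mul_div_cancel_left₀ _ hr.ne', Real.log_exp]
    rw [hw, hAz, hBz, h1, hS]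
    have h2 := mul_le_mul_of_nonneg_right hbh (show 0 ≤ K + μ * L by positivity)
    have h3 := mul_lt_mul_of_pos_left hμL hb0
    nlinarith
  obtain ⟨z, hzT, hz, -⟩ := exists_isLocalMin_of_lt
    (f := fun y => logBarrier x₀ e f S K κ μ r y - u y) hTc
    (fun y hy => ((hwc y hy).continuousAt.sub
      (N.smooth y (hTΩ hy)).continuousAt).continuousWithinAt) hz₀T
    (fun y hy => by linarith [hfr y hy, N.nonneg z₀ (subset_closure (hTΩ hz₀T))])
  have hzT' := interior_subset hzT
  have huz := N.contDiffAt_two (hTΩ hzT')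
  have key : ∀ v, D2 u z v v ≤ D2 (logBarrier x₀ e f S K κ μ r) z v v := by
    intro v
    have := D2_nonneg_of_isLocalMin ((hwc z hzT').sub huz) hz v
    rw [D2_sub (hwc z hzT') huz] at this
    linarith
  obtain ⟨k1, k2⟩ := D2_logBarrier (x₀ := x₀) hef (S := S) (K := K) (κ := κ) (μ := μ) hr
    (hBpos z hzT')
  have h1 := mul_det_le (e := e) (f := f) huz ((key e).trans k1.le) ((key f).trans k2.le)
    (N.psd z (hTΩ hzT') e) (N.psd z (hTΩ hzT') f)
  rw [hef] at h1
  have h2 := N.le_det z (hTΩ hzT')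
  have h3 : 2 * κ * -omL e (z - x₀) * (μ / -omL e (z - x₀)) = 2 * κ * μ := by
    rw [mul_assoc, mul_div_cancel₀ μ (show -omL e (z - x₀) ≠ 0 from (hBpos z hzT').ne')]
  have h4 : 2 * κ * μ = lam / 2 := by
    have : 2 * κ * μ = μ ^ 2 * (16 * L) / (2 * r ^ 2) := by rw [hκ]; field_simp; norm_num
    rw [this, hμsq]; field_simp
  rw [h3, h4] at h1
  linarith

end NormalizedPotential

end

/-- The frame obtained by rotating a unit vector. -/
lemma exists_unit_frame {v : E 2} (hv : v ≠ 0) :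
    ∃ e f : E 2, v = ‖v‖ • e ∧ om e f = 1 ∧ ‖e‖ = 1 ∧ ‖f‖ = 1 := by
  have hv0 := norm_ne_zero_iff.2 hv
  set e : E 2 := ‖v‖⁻¹ • v with he
  have he1 : ‖e‖ = 1 := by rw [he, norm_smul, norm_inv, norm_norm, inv_mul_cancel₀ hv0]
  have hsq := norm_sq_eq_coord e
  rw [he1] at hsq
  refine ⟨e, !₂[-(e 1), e 0], ?_, ?_, he1, ?_⟩
  · rw [he, smul_smul, mul_inv_cancel₀ hv0, one_smul]
  · simp [om]; linarith
  · have h1 := norm_sq_eq_coord (!₂[-(e 1), e 0] : E 2)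
    simp only [Matrix.cons_val_zero, Matrix.cons_val_one] at h1
    rw [← sq_eq_sq₀ (norm_nonneg _) zero_le_one, h1]
    linarith

section

variable {Ω : Set (E 2)} {u : E 2 → ℝ} {x₀ : E 2} {lam Lam s : ℝ}

/-- Low sublevel sets of a bounded potential stay away from the boundary. -/
lemma NormalizedPotential.level_subset (N : NormalizedPotential Ω u x₀ lam Lam) {d M : ℝ}
    (hd : 0 < d) (hball : Metric.ball x₀ d ⊆ Ω) (hM : 0 < M) (hbd : ∀ y ∈ Ω, u y ≤ M)
    (hs0 : 0 ≤ s) (hs : s ≤ M * Real.exp (-(400 * M ^ 2 / (lam * (d / 3) ^ 4) + 4))) :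
    level Ω u s ⊆ Ω := by
  intro y hy
  by_contra hyΩ
  have hdist : d ≤ ‖y - x₀‖ := by
    rw [← dist_eq_norm]
    exact not_lt.1 fun h => hyΩ (hball h)
  have hne : y - x₀ ≠ 0 := norm_pos_iff.1 (hd.trans_le hdist)
  obtain ⟨e, f, hy', hef, he, hf⟩ := exists_unit_frame hne
  refine absurd hs (not_le.2 (N.lt_of_segment hef (by positivity) hM ?_ hbd ?_))
  · intro a ha b hb
    refine hball ?_
    rw [Metric.mem_ball, dist_eq_norm]
    have h1 : planeMap x₀ e f (a, b) - x₀ = a • e + b • f := by simp only [planeMap]; abel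
    have h2 := norm_add_le (a • e) (b • f)
    rw [norm_smul, norm_smul, he, hf, Real.norm_of_nonneg ha.1, Real.norm_of_nonneg hb.1] at h2
    rw [h1]
    linarith [ha.2, hb.2]
  · intro a ha
    have hpos := hd.trans_le hdist
    have h1 : a / ‖y - x₀‖ ≤ 1 := (div_le_one hpos).2 (by linarith [ha.2])
    have h2 := (N.convex_level s) (N.mem_level hs0) hy
      (show 0 ≤ 1 - a / ‖y - x₀‖ by linarith) (div_nonneg ha.1 hpos.le) (by ring)
    have h3 : (1 - a / ‖y - x₀‖) • x₀ + (a / ‖y - x₀‖) • y = planeMap x₀ e f (a, 0) := by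
      have h4 : (1 - a / ‖y - x₀‖) • x₀ + (a / ‖y - x₀‖) • y
          = x₀ + (a / ‖y - x₀‖) • (y - x₀) := by module
      have h5 : (a / ‖y - x₀‖) • (y - x₀) = a • e := by
        conv_lhs => rw [hy']
        rw [smul_smul, norm_smul, he, norm_norm, mul_one, div_mul_cancel₀ _ hpos.ne']
      rw [h4, h5, planeMap]; simp
    rw [h3] at h2
    exact h2.2

end

lemma exists_isLocalMin_of_neg {Ω : Set (E 2)} {f : E 2 → ℝ} {z₀ : E 2} (hO : IsOpen Ω)
    (hb : Bornology.IsBounded Ω) (hf : ContinuousOn f (closure Ω)) (hz₀ : z₀ ∈ closure Ω)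
    (hneg : f z₀ < 0) (hfr : ∀ y ∈ frontier Ω, 0 ≤ f y) : ∃ z ∈ Ω, IsLocalMin f z := by
  obtain ⟨z, hz, hmin⟩ := hb.isCompact_closure.exists_isMinOn ⟨z₀, hz₀⟩ hf
  have hzΩ : z ∈ Ω := by
    by_contra h
    have h1 := hfr z (by rw [hO.frontier_eq]; exact ⟨hz, h⟩)
    have h2 : f z ≤ f z₀ := hmin hz₀
    linarith
  exact ⟨z, hzΩ, (hmin.on_subset subset_closure).isLocalMin (hO.mem_nhds hzΩ)⟩

/-- The potential minus its tangent plane at `x₀`. -/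
def tangentResidual (u : E 2 → ℝ) (x₀ x : E 2) : ℝ := u x - (u x₀ + fderiv ℝ u x₀ (x - x₀))

lemma D2_tangentResidual {u : E 2 → ℝ} {x₀ x : E 2} (h : ContDiffAt ℝ 2 u x) (v w : E 2) :
    D2 (tangentResidual u x₀) x v w = D2 u x v w := by
  have h1 : (fun y => u x₀ + fderiv ℝ u x₀ (y - x₀)) = fun y =>
      0 * (0 : E 2 →L[ℝ] ℝ) y ^ 2 + 0 * (0 : E 2 →L[ℝ] ℝ) y ^ 2 + fderiv ℝ u x₀ y
        + (u x₀ - fderiv ℝ u x₀ x₀) := by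
    funext y; rw [map_sub]; simp; ring
  have h2 : ContDiff ℝ 2 fun y => u x₀ + fderiv ℝ u x₀ (y - x₀) := by fun_prop
  have h3 := D2_sub h h2.contDiffAt v w
  rw [h1, D2_quadratic] at h3
  rw [show tangentResidual u x₀ = fun y => u y - (u x₀ + fderiv ℝ u x₀ (y - x₀)) from rfl, h3]
  ring

lemma Hess_tangentResidual {u : E 2 → ℝ} {x₀ x : E 2} (h : ContDiffAt ℝ 2 u x) :
    Hess (tangentResidual u x₀) x = Hess u x := by
  ext i j
  simp only [Hess, Matrix.of_apply, pd2_eq]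
  exact D2_tangentResidual h _ _

lemma tangentResidual_self (u : E 2 → ℝ) (x₀ : E 2) : tangentResidual u x₀ x₀ = 0 := by
  simp [tangentResidual]

section

variable {Ω : Set (E 2)} {u : E 2 → ℝ} {lam Lam : ℝ} {x₀ : E 2}

namespace MASetup

lemma contDiffAt (h : MASetup Ω u) {x : E 2} (hx : x ∈ Ω) : ContDiffAt ℝ (⊤ : ℕ∞) u x :=
  h.2.2.2.2.1.contDiffAt (Filter.mem_of_superset (h.1.mem_nhds hx) subset_closure)

lemma contDiffAt_two (h : MASetup Ω u) {x : E 2} (hx : x ∈ Ω) : ContDiffAt ℝ 2 u x :=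
  (h.contDiffAt hx).of_le (by norm_cast)

lemma convexOn (h : MASetup Ω u) : ConvexOn ℝ (closure Ω) u := h.2.2.2.2.2.1

lemma continuousOn (h : MASetup Ω u) : ContinuousOn u (closure Ω) := h.2.2.2.2.1.continuousOn

lemma tangentResidual_nonneg (h : MASetup Ω u) (hx₀ : x₀ ∈ Ω) {y : E 2} (hy : y ∈ closure Ω) :
    0 ≤ tangentResidual u x₀ y := by
  have hd : DifferentiableAt ℝ u (x₀ + (0 : ℝ) • (y - x₀)) := by
    rw [zero_smul, add_zero]
    exact (h.contDiffAt_two hx₀).differentiableAt (by norm_num)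
  have h1 := (hasDerivAt_comp_line hd).tendsto_slope_zero_right
  simp only [zero_smul, add_zero, zero_add] at h1
  have h2 : fderiv ℝ u x₀ (y - x₀) ≤ u y - u x₀ := by
    refine le_of_tendsto h1 ?_
    filter_upwards [Ioo_mem_nhdsGT (show (0 : ℝ) < 1 by norm_num)] with t ht
    have h3 := h.convexOn.2 (subset_closure hx₀) hy (show 0 ≤ 1 - t by linarith [ht.2]) ht.1.le
      (by ring)
    have h4 : (1 - t) • x₀ + t • y = x₀ + t • (y - x₀) := by module
    rw [h4, smul_eq_mul, smul_eq_mul] at h3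
    rw [smul_eq_mul, inv_mul_le_iff₀ ht.1]
    linarith
  rw [tangentResidual]
  linarith

lemma psd (h : MASetup Ω u) {x : E 2} (hx : x ∈ Ω) (v : E 2) : 0 ≤ D2 u x v v := by
  have hu := h.contDiffAt_two hx
  rw [← D2_tangentResidual (x₀ := x) hu]
  refine D2_nonneg_of_isLocalMin ?_ ?_ v
  · unfold tangentResidual
    exact hu.sub (by fun_prop)
  · filter_upwards [h.1.mem_nhds hx] with y hy
    rw [tangentResidual_self]
    exact h.tangentResidual_nonneg hx (subset_closure hy)

lemma nonpos (h : MASetup Ω u) (hlam : 0 < lam) (hdet : DetBounds Ω u lam Lam) {y : E 2}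
    (hy : y ∈ closure Ω) : u y ≤ 0 := by
  by_contra! hcon
  obtain ⟨z, hz, hmin⟩ := exists_isLocalMin_of_neg (f := fun y => -u y) h.1 h.2.1
    h.continuousOn.neg hy (by linarith) (fun y hy => by rw [h.2.2.2.2.2.2 y hy]; simp)
  have huz := h.contDiffAt_two hz
  have key : ∀ v, D2 u z v v ≤ 0 := fun v => by
    have := D2_nonneg_of_isLocalMin huz.neg hmin v
    rw [D2_neg] at this
    linarith
  have h1 := mul_det_le (e := EuclideanSpace.single 0 1) (f := EuclideanSpace.single 1 1) huz
    (key _) (key _) (h.psd hz _) (h.psd hz _)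
  have h2 := (hdet z hz).1
  simp [om] at h1
  linarith

lemma neg_le (h : MASetup Ω u) (hLam : 0 < Lam) (hdet : DetBounds Ω u lam Lam) {R : ℝ}
    (hR : Ω ⊆ Metric.ball 0 R) {y : E 2} (hy : y ∈ closure Ω) : -((Lam + 1) * R ^ 2) ≤ u y := by
  set w : E 2 → ℝ := paraboloid (coordL 0) (coordL 1) (Lam + 1) (Lam + 1) 0 0
    (-((Lam + 1) * R ^ 2)) with hwdef
  have hw : ∀ x, w x = (Lam + 1) * ‖x‖ ^ 2 - (Lam + 1) * R ^ 2 := fun x => by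
    rw [norm_sq_eq_coord]; simp [hwdef, paraboloid]; ring
  have hwc : ContDiff ℝ 2 w := contDiff_paraboloid _ _ _ _ _ _ _
  by_contra! hcon
  obtain ⟨z, hz, hmin⟩ := exists_isLocalMin_of_neg (f := fun y => u y - w y) h.1 h.2.1
    (h.continuousOn.sub hwc.continuous.continuousOn) hy (by
      have : 0 ≤ (Lam + 1) * ‖y‖ ^ 2 := by positivity
      linarith [hw y]) (fun x hx => by
      have h1 : x ∈ Metric.closedBall (0 : E 2) R :=
        Metric.closure_ball_subset_closedBall (closure_mono hR (frontier_subset_closure hx))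
      rw [mem_closedBall_zero_iff] at h1
      have h2 := mul_le_mul_of_nonneg_left (pow_le_pow_left₀ (norm_nonneg _) h1 2)
        (show 0 ≤ Lam + 1 by linarith)
      rw [h.2.2.2.2.2.2 x hx, hw]
      linarith)
  have huz := h.contDiffAt_two hz
  have h1 := four_mul_le_det (e := EuclideanSpace.single 0 1) (f := EuclideanSpace.single 1 1)
    (a := Lam + 1) (b := Lam + 1) huz (by linarith) (by linarith) fun s t => by
      have := D2_nonneg_of_isLocalMin (huz.sub hwc.contDiffAt) hmin
        (s • EuclideanSpace.single 0 1 + t • EuclideanSpace.single 1 1)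
      rw [D2_sub huz hwc.contDiffAt, hwdef, D2_paraboloid] at this
      simp only [coordL_apply, PiLp.add_apply, PiLp.smul_apply] at this
      simp at this
      nlinarith
  have h2 := (hdet z hz).2
  simp [om] at h1
  nlinarith

lemma tangentResidual_le (h : MASetup Ω u) (hlam : 0 < lam) (hLam : 0 < Lam)
    (hdet : DetBounds Ω u lam Lam) {R d : ℝ} (hR0 : 0 < R) (hR : Ω ⊆ Metric.ball 0 R) (hd : 0 < d)
    (hball : Metric.ball x₀ d ⊆ Ω) {y : E 2} (hy : y ∈ closure Ω) :
    tangentResidual u x₀ y ≤ (Lam + 1) * R ^ 2 * (1 + 4 * R / d) := by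
  have hx₀ : x₀ ∈ Ω := hball (Metric.mem_ball_self hd)
  set ρ := d / (4 * R) with hρ
  have hρ0 : 0 < ρ := by positivity
  have hnorm : ∀ z ∈ closure Ω, ‖z‖ ≤ R := fun z hz =>
    mem_closedBall_zero_iff.1 (Metric.closure_ball_subset_closedBall (closure_mono hR hz))
  have hz : x₀ - ρ • (y - x₀) ∈ Ω := by
    refine hball ?_
    rw [Metric.mem_ball, dist_eq_norm, sub_sub_cancel_left, norm_neg, norm_smul,
      Real.norm_of_nonneg hρ0.le]
    have h1 : ‖y - x₀‖ ≤ R + R := (norm_sub_le _ _).trans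
      (add_le_add (hnorm y hy) (hnorm x₀ (subset_closure hx₀)))
    have h2 := mul_le_mul_of_nonneg_left h1 hρ0.le
    have h3 : ρ * (R + R) = d / 2 := by rw [hρ]; field_simp; norm_num
    linarith
  have h1 := h.tangentResidual_nonneg hx₀ (subset_closure hz)
  have h2 := h.nonpos hlam hdet (subset_closure hz)
  have h3 := h.neg_le hLam hdet hR (subset_closure hx₀)
  have h4 := h.nonpos hlam hdet hy
  rw [tangentResidual, sub_sub_cancel_left, map_neg, map_smul, smul_eq_mul] at h1
  rw [tangentResidual]
  have h5 : -fderiv ℝ u x₀ (y - x₀) ≤ (Lam + 1) * R ^ 2 / ρ := by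
    rw [le_div_iff₀ hρ0]; linarith
  have h6 : (Lam + 1) * R ^ 2 * (1 + 4 * R / d) = (Lam + 1) * R ^ 2 + (Lam + 1) * R ^ 2 / ρ := by
    rw [hρ]; field_simp
  linarith

lemma normalizedPotential (h : MASetup Ω u) (hlam : 0 < lam) (hdet : DetBounds Ω u lam Lam)
    (hx₀ : x₀ ∈ Ω) : NormalizedPotential Ω (tangentResidual u x₀) x₀ lam Lam where
  isOpen := h.1
  bounded := h.2.1
  convexOn := by
    refine ⟨h.convexOn.1, fun x hx y hy a b ha hb hab => ?_⟩
    have h1 := h.convexOn.2 hx hy ha hb hab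
    have h2 : a • x + b • y - x₀ = a • (x - x₀) + b • (y - x₀) := by
      conv_lhs => rw [← one_smul ℝ x₀, ← hab]
      module
    simp only [tangentResidual, h2, map_add, map_smul, smul_eq_mul] at h1 ⊢
    have h3 : u x₀ = a * u x₀ + b * u x₀ := by rw [← add_mul, hab, one_mul]
    linarith
  smooth x hx := by
    unfold tangentResidual
    exact (h.contDiffAt hx).sub (by fun_prop)
  continuousOn := by
    unfold tangentResidual
    exact h.continuousOn.sub (by fun_prop)
  lam_pos := hlam
  le_det x hx := by
    rw [Hess_tangentResidual (h.contDiffAt_two hx)]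
    exact (hdet x hx).1
  det_le x hx := by
    rw [Hess_tangentResidual (h.contDiffAt_two hx)]
    exact (hdet x hx).2
  mem := hx₀
  u_pole := tangentResidual_self u x₀
  nonneg y hy := h.tangentResidual_nonneg hx₀ hy
  psd x hx v := by
    rw [D2_tangentResidual (h.contDiffAt_two hx)]
    exact h.psd hx v

lemma greenData (h : MASetup Ω u) (hlam : 0 < lam) (hdet : DetBounds Ω u lam Lam)
    {V : Set (E 2)} (hV : IsOpen V) (hVΩ : V ⊆ Ω) (hx₀ : x₀ ∈ V) {g : E 2 → ℝ}
    (hg : IsGreen u V x₀ g) : GreenData (tangentResidual u x₀) g V x₀ lam where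
  isOpen := hV
  bounded := h.2.1.subset hVΩ
  mem := hx₀
  smooth x hx := (h.normalizedPotential hlam hdet (hVΩ hx₀)).smooth x (hVΩ hx)
  psd x hx := (h.normalizedPotential hlam hdet (hVΩ hx₀)).psd x (hVΩ hx)
  lam_pos := hlam
  le_det x hx := (h.normalizedPotential hlam hdet (hVΩ hx₀)).le_det x (hVΩ hx)
  u_pole := tangentResidual_self u x₀
  green := by
    have hcof : ∀ x ∈ V, cofU (tangentResidual u x₀) x = cofU u x := fun x hx => by
      rw [cofU, cofU, Hess_tangentResidual (h.contDiffAt_two (hVΩ hx))]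
    obtain ⟨h1, h2, h3, h4, h5, h6⟩ := hg
    refine ⟨h1, h2, fun x hx => ?_, h4, h5, fun φ hφ hc hs => ?_⟩
    · rw [hcof x hx.1]
      exact h3 x hx
    · rw [← h6 φ hφ hc hs]
      refine setIntegral_congr_fun hV.measurableSet fun x hx => ?_
      simp only [hcof x hx]

end MASetup

end

/-- The increment of the Green's function between consecutive dyadic levels. -/
def dyadicIncrement (lam Lam : ℝ) : ℝ :=
  1 + 264 / (lam * NormalizedPotential.frameConst lam Lam) * 2

section

variable {Ω V : Set (E 2)} {u g : E 2 → ℝ} {x₀ : E 2} {lam Lam : ℝ}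

namespace GreenData

lemma le_of_level (G : GreenData u g V x₀ lam) (N : NormalizedPotential Ω u x₀ lam Lam)
    (hVΩ : closure V ⊆ Ω) {B k₁ s₁ s : ℝ} (huB : ∀ y ∈ Ω, u y ≤ B) (hk₁ : 0 ≤ k₁) (hs : 0 < s)
    (hs₁ : s ≤ s₁) (hle : ∀ x ∈ V, s₁ ≤ u x → g x ≤ k₁) (hlev : level Ω u s ⊆ Ω) {z : E 2}
    (hz : z ∈ V) (hzs : s ≤ u z) :
    g z ≤ k₁ + 1 + 264 / (lam * NormalizedPotential.frameConst lam Lam) * (s₁ / s) := by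
  obtain ⟨e, f, hF, hsmall, hT⟩ := N.exists_frame hs hlev
  exact G.step hk₁ hs hs₁ hle (fun y hy => N.nonneg y (subset_closure (hVΩ hy)))
    (fun y hy => huB y (hVΩ hy)) (N.continuousOn.mono (hVΩ.trans subset_closure)) hsmall hF
    N.frameConst_pos hT hz hzs

lemma le_of_dyadic_level (G : GreenData u g V x₀ lam) (N : NormalizedPotential Ω u x₀ lam Lam)
    (hVΩ : closure V ⊆ Ω) {B C₀ s₀ : ℝ} (huB : ∀ y ∈ Ω, u y ≤ B) (hC₀ : 0 ≤ C₀) (hs₀ : 0 < s₀)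
    (hlev : level Ω u s₀ ⊆ Ω) (hle : ∀ x ∈ V, s₀ ≤ u x → g x ≤ C₀) (j : ℕ) :
    ∀ z ∈ V, s₀ / 2 ^ j ≤ u z → g z ≤ C₀ + j * dyadicIncrement lam Lam := by
  have hfc := N.frameConst_pos
  have hlam := N.lam_pos
  have hD : 0 ≤ dyadicIncrement lam Lam := by unfold dyadicIncrement; positivity
  induction j with
  | zero => simpa using hle
  | succ j ih =>
    intro z hz hzs
    have h1 : s₀ / 2 ^ (j + 1) ≤ s₀ / 2 ^ j := by
      gcongr
      · norm_num
      · exact j.le_succ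
    have h2 : s₀ / 2 ^ (j + 1) ≤ s₀ := div_le_self hs₀.le (one_le_pow₀ (by norm_num))
    have h3 := G.le_of_level N hVΩ huB (by positivity) (by positivity) h1 ih
      (fun y hy => hlev ⟨hy.1, hy.2.trans h2⟩) hz hzs
    have h4 : s₀ / 2 ^ j / (s₀ / 2 ^ (j + 1)) = 2 := by
      rw [pow_succ]; field_simp
    rw [h4] at h3
    push_cast
    unfold dyadicIncrement at h3 ⊢
    linarith

end GreenData

lemma exists_dyadic_le {s₀ t : ℝ} (hs₀ : 0 < s₀) (ht : 0 < t) :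
    ∃ j : ℕ, s₀ / 2 ^ j ≤ t ∧ (j : ℝ) ≤ 2 * (|Real.log s₀| + |Real.log t|) + 1 := by
  set a := 2 * (|Real.log s₀| + |Real.log t|) with ha
  have ha0 : 0 ≤ a := by positivity
  refine ⟨⌈a⌉₊, ?_, (Nat.ceil_lt_add_one ha0).le⟩
  rw [div_le_iff₀ (by positivity), ← Real.log_le_log_iff hs₀ (by positivity),
    Real.log_mul ht.ne' (by positivity), Real.log_pow]
  have h1 := Nat.le_ceil a
  have h2 := Real.log_two_gt_d9
  have h3 : a * (1 / 2) ≤ (⌈a⌉₊ : ℝ) * Real.log 2 :=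
    mul_le_mul h1 (by linarith) (by norm_num) (by positivity)
  linarith [le_abs_self (Real.log s₀), neg_abs_le (Real.log t)]

lemma one_le_abs_log {t : ℝ} (ht : 0 < t) (ht' : t < 1 / 4) : 1 ≤ |Real.log t| := by
  have h1 : Real.log t ≤ -1 := by
    rw [Real.log_le_iff_le_exp ht, Real.exp_neg, ← one_div]
    refine ht'.le.trans (one_div_le_one_div_of_le (Real.exp_pos 1) ?_)
    linarith [Real.exp_one_lt_d9]
  rw [abs_of_nonpos (by linarith)]
  linarith

lemma le_of_mem_frontier_MASection (hΩ : IsOpen Ω) {t : ℝ} {x : E 2} (hxΩ : x ∈ Ω)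
    (hux : ContinuousAt u x) (hx : x ∈ frontier (MASection Ω u x₀ t)) :
    t ≤ tangentResidual u x₀ x := by
  by_contra! hcon
  refine hx.2 (mem_interior_iff_mem_nhds.2 ?_)
  have hc : ContinuousAt (tangentResidual u x₀) x := by
    unfold tangentResidual
    exact hux.sub (by fun_prop)
  filter_upwards [hΩ.mem_nhds hxΩ, hc.eventually (gt_mem_nhds hcon)] with y hy hyt
  refine ⟨subset_closure hy, ?_⟩
  unfold tangentResidual at hyt
  linarith

lemma MASection_mono {s t : ℝ} (hst : s ≤ t) : MASection Ω u x₀ s ⊆ MASection Ω u x₀ t :=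
  fun _ hy => ⟨hy.1, hy.2.trans_le (by linarith)⟩

end

/-- Theorem 1.1(i), upper bound, `n = 2`. -/
theorem green_upper_bound_dim_two
    (lam Lam : ℝ) (hlam : 0 < lam) (hlL : lam ≤ Lam)
    (Ω V : Set (E 2)) (hV : IsOpen V) (hVΩ : CptIn V Ω) :
    ∃ C > 0, ∀ u : E 2 → ℝ,
      MASetup Ω u → DetBounds Ω u lam Lam →
      ∀ x₀ ∈ V, ∀ t : ℝ, 0 < t → t < 1 / 4 →
      CptIn (MASection Ω u x₀ (Real.sqrt t)) V →
      ∀ g : E 2 → ℝ, IsGreen u V x₀ g →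
      ∀ x ∈ frontier (MASection Ω u x₀ t), g x ≤ C * |Real.log t| := by
  have hLam : 0 < Lam := hlam.trans_le hlL
  by_cases hΩ : IsOpen Ω ∧ Bornology.IsBounded Ω
  swap
  · exact ⟨1, one_pos, fun u hu => absurd ⟨hu.1, hu.2.1⟩ hΩ⟩
  obtain ⟨hO, hB⟩ := hΩ
  obtain ⟨d, hd, hdΩ⟩ := hVΩ.1.exists_thickening_subset_open hO hVΩ.2
  obtain ⟨R, hR0, hR⟩ := hB.subset_ball_lt 0 0
  set M := (Lam + 1) * R ^ 2 * (1 + 4 * R / d) with hM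
  have hM0 : 0 < M := by positivity
  set s₀ := M * Real.exp (-(400 * M ^ 2 / (lam * (d / 3) ^ 4) + 4)) with hs₀
  have hs₀0 : 0 < s₀ := by positivity
  have hs₀M : s₀ ≤ M + 1 := by
    have h1 : Real.exp (-(400 * M ^ 2 / (lam * (d / 3) ^ 4) + 4)) ≤ 1 :=
      Real.exp_le_one_iff.2 (neg_nonpos.2 (by positivity))
    nlinarith
  set c := NormalizedPotential.frameConst lam Lam with hc
  have hc0 : 0 < c := by
    rw [hc]; unfold NormalizedPotential.frameConst; positivity
  set D := dyadicIncrement lam Lam with hD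
  have hD0 : 0 < D := by
    rw [hD]; unfold dyadicIncrement; positivity
  set C₀ := 0 + 1 + 264 / (lam * c) * ((M + 1) / s₀) with hC₀
  have hC₀0 : 0 < C₀ := by positivity
  refine ⟨C₀ + (2 * |Real.log s₀| + 3) * D, by positivity, ?_⟩
  intro u hu hdet x₀ hx₀ t ht ht4 hsec g hg x hx
  have hVΩ' : V ⊆ Ω := subset_closure.trans hVΩ.2
  have hball : Metric.ball x₀ d ⊆ Ω :=
    (Metric.ball_subset_thickening (subset_closure hx₀) d).trans hdΩ
  have N := hu.normalizedPotential hlam hdet (hVΩ' hx₀)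
  have G := hu.greenData hlam hdet hV hVΩ' hx₀ hg
  have hub : ∀ y ∈ Ω, tangentResidual u x₀ y ≤ M := fun y hy =>
    hu.tangentResidual_le hlam hLam hdet hR0 hR hd hball (subset_closure hy)
  have hlev := N.level_subset hd hball hM0 hub hs₀0.le le_rfl
  have hbase : ∀ z ∈ V, s₀ ≤ tangentResidual u x₀ z → g z ≤ C₀ := fun z hz hzs =>
    G.le_of_level N hVΩ.2 hub le_rfl hs₀0 hs₀M
      (fun y hy hyM => by linarith [hub y (hVΩ' hy)]) hlev hz hzs
  have htt : t ≤ Real.sqrt t := Real.le_sqrt_of_sq_le (by nlinarith)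
  have hxV : x ∈ V := hsec.2 (closure_mono (MASection_mono htt) (frontier_subset_closure hx))
  have hxt := le_of_mem_frontier_MASection hO (hVΩ' hxV)
    (hu.contDiffAt (hVΩ' hxV)).continuousAt hx
  obtain ⟨j, hj, hjle⟩ := exists_dyadic_le hs₀0 ht
  have h1 := G.le_of_dyadic_level N hVΩ.2 hub hC₀0.le hs₀0 hlev hbase j x hxV (hj.trans hxt)
  have h2 := one_le_abs_log ht ht4
  set T := |Real.log t|
  have h3 := mul_le_mul_of_nonneg_right hjle hD0.le
  have h4 := mul_le_mul_of_nonneg_left h2 (show 0 ≤ C₀ + (2 * |Real.log s₀| + 1) * D by positivity)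
  linarith
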